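/- arXiv:1011.0925 — 4 statements merged into one kernel-verified Lean document; each statement's English description precedes it below -/
import Mathlib

section
/- The polynomial F(X,Z) := ((Z+3)⁴ − 40(Z²+3Z+2))³·X³·(X+8)·(X−1)² + (X+2)³·((X+2)³ − 24X)³·Z⁵·(Z²+11Z−1), regarded as an element of the polynomial ring ℂ[X,Z] (e.g. MvPolynomial (Fin 2) ℂ), is irreducible. -/
open MvPolynomial

/-- The polynomial form of the equation `J_III = J_IV` (Example 1 of the paper). -/
noncomputable def chudnovskyCurvePoly : MvPolynomial (Fin 2) ℂ :=
  let X : MvPolynomial (Fin 2) ℂ := MvPolynomial.X 0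
  let Z : MvPolynomial (Fin 2) ℂ := MvPolynomial.X 1
  ((Z + 3) ^ 4 - 40 * (Z ^ 2 + 3 * Z + 2)) ^ 3 * X ^ 3 * (X + 8) * (X - 1) ^ 2
    + (X + 2) ^ 3 * ((X + 2) ^ 3 - 24 * X) ^ 3 * Z ^ 5 * (Z ^ 2 + 11 * Z - 1)
namespace Polynomial.Chud

/-- absolute value attached to an integer valuation -/
noncomputable def absV (V : ℂ[X] → ℤ)
    (hmul : ∀ f g, f ≠ 0 → g ≠ 0 → V (f * g) = V f + V g)
    (hadd : ∀ f g, f ≠ 0 → g ≠ 0 → f + g ≠ 0 → min (V f) (V g) ≤ V (f + g)) :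
    {v : AbsoluteValue ℂ[X] ℝ // IsNonarchimedean v ∧
      ∀ f, f ≠ 0 → v f = (2 : ℝ) ^ (-(5 * V f))} := by
  classical
  have hna : ∀ f g : ℂ[X], (if f + g = 0 then (0 : ℝ) else (2 : ℝ) ^ (-(5 * V (f + g)))) ≤
      max (if f = 0 then (0 : ℝ) else (2 : ℝ) ^ (-(5 * V f)))
        (if g = 0 then (0 : ℝ) else (2 : ℝ) ^ (-(5 * V g))) := by
    intro f g
    by_cases hf : f = 0
    · simp [hf]
    by_cases hg : g = 0
    · simp [hg]
    by_cases hfg : f + g = 0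
    · simp only [hfg, hf, hg, if_true, if_false]
      exact le_max_of_le_left (by positivity)
    · simp only [hfg, hf, hg, if_false]
      have := hadd f g hf hg hfg
      rcases min_le_iff.mp this with h | h
      · exact le_max_of_le_left (zpow_le_zpow_right₀ (by norm_num) (by omega))
      · exact le_max_of_le_right (zpow_le_zpow_right₀ (by norm_num) (by omega))
  have hnn : ∀ f : ℂ[X], (0 : ℝ) ≤ (if f = 0 then (0 : ℝ) else (2 : ℝ) ^ (-(5 * V f))) := by
    intro f
    split_ifs
    · exact le_rfl
    · positivity
  refine ⟨⟨⟨fun f => if f = 0 then (0 : ℝ) else (2 : ℝ) ^ (-(5 * V f)), ?_⟩, hnn, ?_, ?_⟩, ?_, ?_⟩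
  · intro f g
    by_cases hf : f = 0
    · simp [hf]
    by_cases hg : g = 0
    · simp [hg]
    simp only [mul_eq_zero, hf, hg, or_self, if_false]
    rw [hmul f g hf hg, ← zpow_add₀ (by norm_num)]
    congr 1
    ring
  · intro f
    constructor
    · intro h
      by_contra hf
      simp only [hf, if_false] at h
      have : (0 : ℝ) < (2 : ℝ) ^ (-(5 * V f)) := by positivity
      linarith
    · intro h
      simp [h]
  · intro f g
    refine (hna f g).trans (max_le ?_ ?_)
    · exact le_add_of_nonneg_right (hnn g)
    · exact le_add_of_nonneg_left (hnn f)
  · exact hna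
  · intro f hf
    change (if f = 0 then (0 : ℝ) else (2 : ℝ) ^ (-(5 * V f))) = _
    simp [hf]

theorem key (V : ℂ[X] → ℤ)
    (hmul : ∀ f g, f ≠ 0 → g ≠ 0 → V (f * g) = V f + V g)
    (hadd : ∀ f g, f ≠ 0 → g ≠ 0 → f + g ≠ 0 → min (V f) (V g) ≤ V (f + g))
    (s B : ℤ) (F G H : ℂ[X][X]) (hF : F = G * H)
    (hB : ∀ n, F.coeff n ≠ 0 → B ≤ 5 * V (F.coeff n) + s * n) (i j : ℕ)
    (hi : G.coeff i ≠ 0) (hj : H.coeff j ≠ 0) :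
    B ≤ 5 * (V (G.coeff i) + V (H.coeff j)) + s * (i + j) := by
  obtain ⟨v, hna, hv⟩ := absV V hmul hadd
  have hc : (0 : ℝ) < (2 : ℝ) ^ (-s) := by positivity
  have h1 := gaussNorm_mul hna hc G H
  have hG := G.le_gaussNorm v hc.le i
  have hH := H.le_gaussNorm v hc.le j
  have hFB : F.gaussNorm v ((2 : ℝ) ^ (-s)) ≤ (2 : ℝ) ^ (-B) := by
    obtain ⟨n, hn⟩ := exists_eq_gaussNorm v ((2 : ℝ) ^ (-s)) F
    rw [hn]
    by_cases h0 : F.coeff n = 0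
    · rw [h0, map_zero, zero_mul]
      positivity
    · rw [hv _ h0, ← zpow_natCast, ← zpow_mul, ← zpow_add₀ (by norm_num)]
      have := hB n h0
      exact zpow_le_zpow_right₀ (by norm_num) (by linarith)
  rw [← hF] at h1
  have h2 : (v (G.coeff i) * ((2 : ℝ) ^ (-s)) ^ i) * (v (H.coeff j) * ((2 : ℝ) ^ (-s)) ^ j)
      ≤ (2 : ℝ) ^ (-B) := by
    refine (mul_le_mul hG hH (by positivity) (G.gaussNorm_nonneg v hc.le)).trans ?_
    rw [← h1]
    exact hFB
  rw [hv _ hi, hv _ hj, ← zpow_natCast, ← zpow_mul, ← zpow_natCast, ← zpow_mul,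
    ← zpow_add₀ (by norm_num), ← zpow_add₀ (by norm_num), ← zpow_add₀ (by norm_num)] at h2
  have := (zpow_le_zpow_iff_right₀ (by norm_num : (1 : ℝ) < 2)).mp h2
  linarith

theorem key_root (x : ℂ) (s B : ℤ) (F G H : ℂ[X][X]) (hF : F = G * H)
    (hB : ∀ n, F.coeff n ≠ 0 → B ≤ 5 * ((F.coeff n).rootMultiplicity x : ℤ) + s * n) (i j : ℕ)
    (hi : G.coeff i ≠ 0) (hj : H.coeff j ≠ 0) :
    B ≤ 5 * (((G.coeff i).rootMultiplicity x : ℤ) + ((H.coeff j).rootMultiplicity x : ℤ))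
      + s * (i + j) := by
  refine key (fun f => (f.rootMultiplicity x : ℤ)) ?_ ?_ s B F G H hF hB i j hi hj
  · intro f g hf hg
    rw [rootMultiplicity_mul (mul_ne_zero hf hg)]
    push_cast
    ring
  · intro f g hf hg hfg
    have := rootMultiplicity_add x hfg
    exact_mod_cast this

theorem key_deg (s B : ℤ) (F G H : ℂ[X][X]) (hF : F = G * H)
    (hB : ∀ n, F.coeff n ≠ 0 → B ≤ -5 * ((F.coeff n).natDegree : ℤ) + s * n) (i j : ℕ)
    (hi : G.coeff i ≠ 0) (hj : H.coeff j ≠ 0) :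
    B ≤ -5 * (((G.coeff i).natDegree : ℤ) + ((H.coeff j).natDegree : ℤ)) + s * (i + j) := by
  have := key (fun f => -(f.natDegree : ℤ)) ?_ ?_ s B F G H hF
    (fun n hn => by have := hB n hn; linarith) i j hi hj
  · linarith
  · intro f g hf hg
    rw [natDegree_mul hf hg]
    push_cast
    ring
  · intro f g hf hg hfg
    have := natDegree_add_le f g
    omega

theorem sum_rm_le (f : ℂ[X]) (x y z : ℂ) (hxy : x ≠ y) (hxz : x ≠ z) (hyz : y ≠ z) :
    f.rootMultiplicity x + f.rootMultiplicity y + f.rootMultiplicity z ≤ f.natDegree := by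
  classical
  refine le_trans ?_ f.card_roots'
  have h := Multiset.sum_count_eq_card (s := f.roots.toFinset ∪ {x, y, z}) (m := f.roots)
    (fun a ha => by simp [ha] at *)
  rw [← h]
  have h2 : ∑ a ∈ ({x, y, z} : Finset ℂ), f.roots.count a ≤
      ∑ a ∈ f.roots.toFinset ∪ {x, y, z}, f.roots.count a :=
    Finset.sum_le_sum_of_subset Finset.subset_union_right
  rw [Finset.sum_insert (by simp [hxy, hxz]), Finset.sum_insert (by simp [hyz]),
    Finset.sum_singleton] at h2
  simp only [count_roots] at h2 ⊢
  omega

theorem coeff_swap (p : ℂ[X][X]) (i j : ℕ) :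
    ((Bivariate.swap p).coeff i).coeff j = (p.coeff j).coeff i := by
  induction p using Polynomial.induction_on' with
  | add p q hp hq => simp only [map_add, coeff_add, hp, hq]
  | monomial n a =>
    rw [Bivariate.swap_monomial, coeff_mul_C, coeff_map, coeff_C_mul, coeff_X_pow, coeff_monomial]
    by_cases h : n = j
    · simp [h]
    · simp [h, Ne.symm h]

theorem eval_swap (p : ℂ[X][X]) (x r : ℂ) :
    ((Bivariate.swap p).map (evalRingHom r)).eval x = (p.map (evalRingHom x)).eval r := by
  induction p using Polynomial.induction_on' with
  | add p q hp hq => simp only [map_add, Polynomial.map_add, eval_add, hp, hq]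
  | monomial n a =>
    rw [Bivariate.swap_monomial]
    simp [Polynomial.map_map]
    rw [show (evalRingHom r).comp C = RingHom.id ℂ by ext; simp]
    simp

noncomputable def PP : ℂ[X] := (X - C 0) ^ 3 * (X - C (-8)) * (X - C 1) ^ 2
noncomputable def CC : ℂ[X] := (X + 2) ^ 3 * ((X + 2) ^ 3 - 24 * X) ^ 3
noncomputable def AA : ℂ[X] := ((X + 3) ^ 4 - 40 * (X ^ 2 + 3 * X + 2)) ^ 3
noncomputable def DD : ℂ[X] := X ^ 7 + C 11 * X ^ 6 - X ^ 5
noncomputable def FF : ℂ[X][X] := AA.map C * C PP + DD.map C * C CC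

theorem PP_monic : PP.Monic := by unfold PP; monicity!
theorem PP_deg : PP.natDegree = 6 := by unfold PP; compute_degree!
theorem CC_monic : CC.Monic := by unfold CC; monicity!
theorem CC_deg : CC.natDegree = 12 := by unfold CC; compute_degree!
theorem AA_monic : AA.Monic := by unfold AA; monicity!
theorem AA_deg : AA.natDegree = 12 := by unfold AA; compute_degree!
theorem DD_monic : DD.Monic := by unfold DD; monicity!
theorem DD_deg : DD.natDegree = 7 := by unfold DD; compute_degree!

theorem AA_zero : AA.coeff 0 = 1 := by
  rw [coeff_zero_eq_eval_zero]; unfold AA; norm_num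

theorem DD_coeff (n : ℕ) (h : n < 5 ∨ 7 < n) : DD.coeff n = 0 := by
  unfold DD
  simp only [coeff_sub, coeff_add, coeff_C_mul, coeff_X_pow]
  rw [if_neg (by omega), if_neg (by omega), if_neg (by omega)]
  simp

theorem AA_coeff (n : ℕ) (h : 12 < n) : AA.coeff n = 0 :=
  coeff_eq_zero_of_natDegree_lt (by rw [AA_deg]; exact h)

theorem FF_coeff (n : ℕ) : FF.coeff n = C (AA.coeff n) * PP + C (DD.coeff n) * CC := by
  unfold FF
  rw [coeff_add, coeff_mul_C, coeff_mul_C, coeff_map, coeff_map]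

theorem rm_lin (x y : ℂ) (h : x ≠ y) : (X - C y : ℂ[X]).rootMultiplicity x = 0 := by
  rw [rootMultiplicity_eq_zero_iff]
  intro h1
  simp [sub_eq_zero] at h1
  exact absurd h1 h

theorem rm_pow (f : ℂ[X]) (_hf : f ≠ 0) (x : ℂ) (n : ℕ) :
    (f ^ n).rootMultiplicity x = n * f.rootMultiplicity x := by
  simp only [← count_roots, roots_pow, Multiset.count_nsmul]

theorem PP_rm (x : ℂ) : PP.rootMultiplicity x = 3 * (X - C 0 : ℂ[X]).rootMultiplicity x +
    (X - C (-8) : ℂ[X]).rootMultiplicity x + 2 * (X - C 1 : ℂ[X]).rootMultiplicity x := by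
  have h := PP_monic.ne_zero
  unfold PP at *
  rw [rootMultiplicity_mul h, rootMultiplicity_mul (left_ne_zero_of_mul h),
    rm_pow _ (X_sub_C_ne_zero _), rm_pow _ (X_sub_C_ne_zero _)]

theorem PP_rm0 : PP.rootMultiplicity 0 = 3 := by
  rw [PP_rm, rm_lin 0 (-8) (by norm_num), rm_lin 0 1 (by norm_num), rootMultiplicity_X_sub_C_self]
theorem PP_rm1 : PP.rootMultiplicity 1 = 2 := by
  rw [PP_rm, rm_lin 1 (-8) (by norm_num), rm_lin 1 0 (by norm_num), rootMultiplicity_X_sub_C_self]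
theorem PP_rm8 : PP.rootMultiplicity (-8) = 1 := by
  rw [PP_rm, rm_lin (-8) 0 (by norm_num), rm_lin (-8) 1 (by norm_num),
    rootMultiplicity_X_sub_C_self]

theorem exists_r : ∃ r s : ℂ, r ≠ s ∧ r ≠ 0 ∧ s ≠ 0 ∧
    DD = (X - C 0) ^ 5 * (X - C r) * (X - C s) := by
  obtain ⟨w, hw⟩ := IsAlgClosed.exists_pow_nat_eq (125 : ℂ) (n := 2) (by norm_num)
  refine ⟨(-11 + w) / 2, (-11 - w) / 2, ?_, ?_, ?_, ?_⟩
  · intro h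
    have : w = 0 := by linear_combination h
    rw [this] at hw
    norm_num at hw
  · intro h
    have : w = 11 := by linear_combination 2 * h
    rw [this] at hw
    norm_num at hw
  · intro h
    have : w = -11 := by linear_combination -2 * h
    rw [this] at hw
    norm_num at hw
  · have e1 : (C ((-11 + w) / 2) + C ((-11 - w) / 2) : ℂ[X]) = - C 11 := by
      rw [← C_add, ← C_neg]; congr 1; ring
    have e2 : (C ((-11 + w) / 2) * C ((-11 - w) / 2) : ℂ[X]) = - 1 := by
      rw [← C_mul, ← C_1, ← C_neg]; congr 1; linear_combination (-1/4) * hw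
    unfold DD
    rw [C_0]
    linear_combination (X ^ 6) * e1 - X ^ 5 * e2

theorem Psplit (p q : ℂ[X]) (c : ℂ) (hc : c ≠ 0) (h : p * q = C c * PP) :
    p ≠ 0 ∧ p.rootMultiplicity 0 + q.rootMultiplicity 0 = 3 ∧
    p.rootMultiplicity 1 + q.rootMultiplicity 1 = 2 ∧
    p.rootMultiplicity (-8) + q.rootMultiplicity (-8) = 1 ∧
    p.natDegree + q.natDegree = 6 ∧
    p.natDegree = p.rootMultiplicity 0 + p.rootMultiplicity 1 + p.rootMultiplicity (-8) := by
  have hn : C c * PP ≠ 0 := mul_ne_zero (by simpa using hc) PP_monic.ne_zero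
  have hn' := hn
  rw [← h] at hn'
  have hp := left_ne_zero_of_mul hn'
  have hq := right_ne_zero_of_mul hn'
  have hx : ∀ x, p.rootMultiplicity x + q.rootMultiplicity x = PP.rootMultiplicity x := by
    intro x
    rw [← rootMultiplicity_mul hn', h, rootMultiplicity_mul hn, rootMultiplicity_C, zero_add]
  have hd : p.natDegree + q.natDegree = 6 := by
    rw [← natDegree_mul hp hq, h, natDegree_C_mul hc, PP_deg]
  have h0 := hx 0
  have h1 := hx 1
  have h8 := hx (-8)
  rw [PP_rm0] at h0
  rw [PP_rm1] at h1
  rw [PP_rm8] at h8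
  have s1 := sum_rm_le p 0 1 (-8) (by norm_num) (by norm_num) (by norm_num)
  have s2 := sum_rm_le q 0 1 (-8) (by norm_num) (by norm_num) (by norm_num)
  refine ⟨hp, h0, h1, h8, hd, ?_⟩
  omega

theorem Dsplit (r s : ℂ) (hrs : r ≠ s) (hr : r ≠ 0) (hs : s ≠ 0)
    (hD : DD = (X - C 0) ^ 5 * (X - C r) * (X - C s)) (p q : ℂ[X]) (c : ℂ) (hc : c ≠ 0)
    (h : p * q = C c * DD) :
    p ≠ 0 ∧ p.rootMultiplicity 0 + q.rootMultiplicity 0 = 5 ∧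
    p.rootMultiplicity r + q.rootMultiplicity r = 1 ∧
    p.rootMultiplicity s + q.rootMultiplicity s = 1 ∧
    p.natDegree + q.natDegree = 7 ∧
    p.natDegree = p.rootMultiplicity 0 + p.rootMultiplicity r + p.rootMultiplicity s := by
  have hDx : ∀ x, DD.rootMultiplicity x = 5 * (X - C 0 : ℂ[X]).rootMultiplicity x +
    (X - C r : ℂ[X]).rootMultiplicity x + (X - C s : ℂ[X]).rootMultiplicity x := by
    intro x
    have h := DD_monic.ne_zero
    rw [hD] at *
    rw [rootMultiplicity_mul h, rootMultiplicity_mul (left_ne_zero_of_mul h),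
      rm_pow _ (X_sub_C_ne_zero _)]
  have hn : C c * DD ≠ 0 := mul_ne_zero (by simpa using hc) DD_monic.ne_zero
  have hn' := hn
  rw [← h] at hn'
  have hp := left_ne_zero_of_mul hn'
  have hq := right_ne_zero_of_mul hn'
  have hx : ∀ x, p.rootMultiplicity x + q.rootMultiplicity x = DD.rootMultiplicity x := by
    intro x
    rw [← rootMultiplicity_mul hn', h, rootMultiplicity_mul hn, rootMultiplicity_C, zero_add]
  have hd : p.natDegree + q.natDegree = 7 := by
    rw [← natDegree_mul hp hq, h, natDegree_C_mul hc, DD_deg]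
  have h0 := hx 0
  have h1 := hx r
  have h8 := hx s
  rw [hDx, rm_lin 0 r hr.symm, rm_lin 0 s hs.symm, rootMultiplicity_X_sub_C_self] at h0
  rw [hDx, rm_lin r 0 hr, rm_lin r s hrs, rootMultiplicity_X_sub_C_self] at h1
  rw [hDx, rm_lin s 0 hs, rm_lin s r hrs.symm, rootMultiplicity_X_sub_C_self] at h8
  have s1 := sum_rm_le p 0 r s hr.symm hs.symm hrs
  have s2 := sum_rm_le q 0 r s hr.symm hs.symm hrs
  refine ⟨hp, ?_, ?_, ?_, hd, ?_⟩ <;> omega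

theorem FF_map (x : ℂ) : FF.map (evalRingHom x) = C (PP.eval x) * AA + C (CC.eval x) * DD := by
  ext n
  rw [coeff_map, FF_coeff]
  simp
  ring

theorem FF_swap : Bivariate.swap FF = PP.map C * C AA + CC.map C * C DD := by
  unfold FF
  rw [map_add, map_mul, map_mul, Bivariate.swap_map_C, Bivariate.swap_map_C, Bivariate.swap_C,
    Bivariate.swap_C]
  ring

theorem FF_swap_coeff (n : ℕ) :
    (Bivariate.swap FF).coeff n = C (PP.coeff n) * AA + C (CC.coeff n) * DD := by
  rw [FF_swap, coeff_add, coeff_mul_C, coeff_mul_C, coeff_map, coeff_map]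

theorem FF_swap_natDegree : (Bivariate.swap FF).natDegree = 12 := by
  apply natDegree_eq_of_le_of_coeff_ne_zero
  · rw [natDegree_le_iff_coeff_eq_zero]
    intro n hn
    rw [FF_swap_coeff, coeff_eq_zero_of_natDegree_lt (by rw [PP_deg]; omega),
      coeff_eq_zero_of_natDegree_lt (by rw [CC_deg]; omega)]
    simp
  · rw [FF_swap_coeff, coeff_eq_zero_of_natDegree_lt (by rw [PP_deg]; omega),
      ← CC_deg, CC_monic.coeff_natDegree]
    simpa using DD_monic.ne_zero

theorem FF_swap_lead : (Bivariate.swap FF).leadingCoeff = DD := by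
  rw [leadingCoeff, FF_swap_natDegree, FF_swap_coeff,
    coeff_eq_zero_of_natDegree_lt (by rw [PP_deg]; omega), ← CC_deg, CC_monic.coeff_natDegree]
  simp

theorem FF_natDegree : FF.natDegree = 12 := by
  apply natDegree_eq_of_le_of_coeff_ne_zero
  · rw [natDegree_le_iff_coeff_eq_zero]
    intro n hn
    rw [FF_coeff, AA_coeff n hn, DD_coeff n (by omega)]
    simp
  · rw [FF_coeff, DD_coeff 12 (by omega), ← AA_deg, AA_monic.coeff_natDegree]
    simpa using PP_monic.ne_zero

theorem FF_lead : FF.leadingCoeff = PP := by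
  rw [leadingCoeff, FF_natDegree, FF_coeff, DD_coeff 12 (by omega), ← AA_deg,
    AA_monic.coeff_natDegree]
  simp

theorem FF_zero : FF.coeff 0 = PP := by
  rw [FF_coeff, DD_coeff 0 (by omega), AA_zero]
  simp

theorem FF_swap_map (r : ℂ) (hr : DD.eval r = 0) :
    (Bivariate.swap FF).map (evalRingHom r) = C (AA.eval r) * PP := by
  ext n
  rw [coeff_map, FF_swap_coeff]
  simp [hr]
  ring

theorem AA_DD (z : ℂ) (h : DD.eval z = 0) : AA.eval z ≠ 0 := by
  intro hA
  have h2 : z ^ 5 * (z ^ 2 + 11 * z - 1) = 0 := by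
    rw [← h]; unfold DD; simp; ring
  have h1 : (z + 3) ^ 4 - 40 * (z ^ 2 + 3 * z + 2) = 0 := by
    have : ((z + 3) ^ 4 - 40 * (z ^ 2 + 3 * z + 2)) ^ 3 = 0 := by
      rw [← hA]; unfold AA; simp
    exact pow_eq_zero_iff (by norm_num) |>.mp this
  have hz : z = 0 := by
    rcases mul_eq_zero.mp h2 with h3 | h3
    · exact pow_eq_zero_iff (by norm_num) |>.mp h3
    · have : 5 * z ^ 2 = 0 := by linear_combination h1 - (z ^ 2 + z - 1) * h3
      simpa using this
  rw [hz] at h1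
  norm_num at h1

structure FinData (r s : ℂ) (G H : ℂ[X][X]) (x : ℂ) (e : ℕ) : Prop where
  ksum : (G.map (evalRingHom x)).rootMultiplicity 0 + (H.map (evalRingHom x)).rootMultiplicity 0 = 5
  rsum : (G.map (evalRingHom x)).rootMultiplicity r + (H.map (evalRingHom x)).rootMultiplicity r = 1
  ssum : (G.map (evalRingHom x)).rootMultiplicity s + (H.map (evalRingHom x)).rootMultiplicity s = 1
  dsum : (G.map (evalRingHom x)).natDegree + (H.map (evalRingHom x)).natDegree = 7
  deg : (G.map (evalRingHom x)).natDegree = (G.map (evalRingHom x)).rootMultiplicity 0 +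
    (G.map (evalRingHom x)).rootMultiplicity r + (G.map (evalRingHom x)).rootMultiplicity s
  zero : 5 * (G.coeff 0).rootMultiplicity x = e * (G.map (evalRingHom x)).rootMultiplicity 0
  lead : 5 * G.leadingCoeff.rootMultiplicity x + e * (G.map (evalRingHom x)).natDegree =
    e * G.natDegree
  fr : ((Bivariate.swap G).map (evalRingHom r)).rootMultiplicity x =
    e * (G.map (evalRingHom x)).rootMultiplicity r
  fs : ((Bivariate.swap G).map (evalRingHom s)).rootMultiplicity x =
    e * (G.map (evalRingHom x)).rootMultiplicity s
  bound : ∀ j, G.coeff j ≠ 0 →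
    e * j ≤ 5 * (G.coeff j).rootMultiplicity x + e * (G.map (evalRingHom x)).natDegree

theorem coeff_map_ne (G : ℂ[X][X]) (x : ℂ) (j : ℕ) (h : (G.map (evalRingHom x)).coeff j ≠ 0) :
    G.coeff j ≠ 0 ∧ (G.coeff j).rootMultiplicity x = 0 := by
  rw [coeff_map, coe_evalRingHom] at h
  refine ⟨fun h0 => h (by rw [h0, eval_zero]), ?_⟩
  rw [rootMultiplicity_eq_zero_iff]
  intro h1
  exact absurd h1 h

theorem coeff_rm_ne (f : ℂ[X]) (hf : f ≠ 0) : f.coeff (f.rootMultiplicity 0) ≠ 0 := by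
  rw [rootMultiplicity_eq_natTrailingDegree']
  exact trailingCoeff_nonzero_iff_nonzero.mpr hf

theorem finData (r s : ℂ) (hrs : r ≠ s) (hr : r ≠ 0) (hs : s ≠ 0)
    (hD : DD = (X - C 0) ^ 5 * (X - C r) * (X - C s)) (G H : ℂ[X][X]) (hF : FF = G * H)
    (x : ℂ) (e : ℕ) (hx : PP.eval x = 0) (hC : CC.eval x ≠ 0) (he : PP.rootMultiplicity x = e) :
    FinData r s G H x e := by
  have hDr : DD.eval r = 0 := by rw [hD]; simp
  have hDs : DD.eval s = 0 := by rw [hD]; simp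
  have hprod : G.map (evalRingHom x) * H.map (evalRingHom x) = C (CC.eval x) * DD := by
    rw [← Polynomial.map_mul, ← hF, FF_map, hx]; simp
  obtain ⟨g1, g2, g3, g4, g5, g6⟩ := Dsplit r s hrs hr hs hD _ _ _ hC hprod
  obtain ⟨h1, -, -, -, -, h6⟩ := Dsplit r s hrs hr hs hD _ _ _ hC ((mul_comm _ _).trans hprod)
  have hFn : ∀ n, (n < 5 ∨ 7 < n) → FF.coeff n ≠ 0 → (FF.coeff n).rootMultiplicity x = e := by
    intro n hn h0
    rw [FF_coeff, DD_coeff n hn, C_0, zero_mul, add_zero] at *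
    rw [rootMultiplicity_mul h0, rootMultiplicity_C, he, zero_add]
  have hF12 : ∀ n, FF.coeff n ≠ 0 → n ≤ 12 := by
    intro n h0
    rw [← FF_natDegree]
    exact le_natDegree_of_ne_zero h0
  have K1 := key_root x e (5 * e) FF G H hF (by
    intro n h0
    by_cases hn : n < 5
    · rw [hFn n (Or.inl hn) h0]; nlinarith
    · have : (5 : ℤ) ≤ n := by omega
      nlinarith)
  have K2 := key_root x (-e) (-(7 * e)) FF G H hF (by
    intro n h0
    by_cases hn : 7 < n
    · rw [hFn n (Or.inr hn) h0]
      have : (n : ℤ) ≤ 12 := by exact_mod_cast hF12 n h0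
      nlinarith
    · have : (n : ℤ) ≤ 7 := by omega
      nlinarith)
  have z0 : G.coeff 0 * H.coeff 0 = PP := by rw [← mul_coeff_zero, ← hF, FF_zero]
  have zl : G.leadingCoeff * H.leadingCoeff = PP := by rw [← leadingCoeff_mul, ← hF, FF_lead]
  have nb : G.natDegree + H.natDegree = 12 := by
    rw [← natDegree_mul, ← hF, FF_natDegree]
    · rintro rfl; simp at g1
    · rintro rfl; simp at h1
  have hP := PP_monic.ne_zero
  have zG : G.coeff 0 ≠ 0 := left_ne_zero_of_mul (z0 ▸ hP)
  have zH : H.coeff 0 ≠ 0 := right_ne_zero_of_mul (z0 ▸ hP)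
  have lG : G.leadingCoeff ≠ 0 := left_ne_zero_of_mul (zl ▸ hP)
  have lH : H.leadingCoeff ≠ 0 := right_ne_zero_of_mul (zl ▸ hP)
  have zs : (G.coeff 0).rootMultiplicity x + (H.coeff 0).rootMultiplicity x = e := by
    rw [← rootMultiplicity_mul (z0 ▸ hP), z0, he]
  have ls : G.leadingCoeff.rootMultiplicity x + H.leadingCoeff.rootMultiplicity x = e := by
    rw [← rootMultiplicity_mul (zl ▸ hP), zl, he]
  obtain ⟨kG, kG'⟩ := coeff_map_ne G x _ (coeff_rm_ne _ g1)
  obtain ⟨kH, kH'⟩ := coeff_map_ne H x _ (coeff_rm_ne _ h1)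
  obtain ⟨dG, dG'⟩ := coeff_map_ne G x _ (leadingCoeff_ne_zero.mpr g1)
  obtain ⟨dH, dH'⟩ := coeff_map_ne H x _ (leadingCoeff_ne_zero.mpr h1)
  have e1 := K1 _ _ zG kH
  have e2 := K1 _ _ kG zH
  have e3 := K2 _ _ lG dH
  have e4 := K2 _ _ dG lH
  simp only [coeff_natDegree] at e3 e4
  rw [kH'] at e1
  rw [kG'] at e2
  rw [dH'] at e3
  rw [dG'] at e4
  have fgen : ∀ t, DD.eval t = 0 → (G.map (evalRingHom x)).rootMultiplicity t +
      (H.map (evalRingHom x)).rootMultiplicity t = 1 →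
      ((Bivariate.swap G).map (evalRingHom t)).rootMultiplicity x =
        e * (G.map (evalRingHom x)).rootMultiplicity t := by
    intro t ht hsum
    have hp : (Bivariate.swap G).map (evalRingHom t) * (Bivariate.swap H).map (evalRingHom t) =
        C (AA.eval t) * PP := by
      rw [← Polynomial.map_mul, ← map_mul, ← hF, FF_swap_map t ht]
    have hn : C (AA.eval t) * PP ≠ 0 := mul_ne_zero (by simpa using AA_DD t ht) hP
    have hsm : ((Bivariate.swap G).map (evalRingHom t)).rootMultiplicity x +
        ((Bivariate.swap H).map (evalRingHom t)).rootMultiplicity x = e := by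
      rw [← rootMultiplicity_mul (hp ▸ hn), hp, rootMultiplicity_mul hn, rootMultiplicity_C, he,
        zero_add]
    have aux : ∀ Q : ℂ[X][X], Q.map (evalRingHom x) ≠ 0 →
        (Q.map (evalRingHom x)).rootMultiplicity t = 0 →
        ((Bivariate.swap Q).map (evalRingHom t)).rootMultiplicity x = 0 := by
      intro Q hQ h0
      rw [rootMultiplicity_eq_zero_iff] at h0 ⊢
      intro h2
      rw [IsRoot, eval_swap] at h2
      exact absurd (h0 h2) hQ
    rcases Nat.eq_zero_or_pos ((G.map (evalRingHom x)).rootMultiplicity t) with h | h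
    · rw [aux G g1 h, h, mul_zero]
    · have h3 : (H.map (evalRingHom x)).rootMultiplicity t = 0 := by omega
      have h4 : (G.map (evalRingHom x)).rootMultiplicity t = 1 := by omega
      have := aux H h1 h3
      rw [h4, mul_one]
      omega
  refine ⟨g2, g3, g4, g5, g6, ?_, ?_, fgen r hDr g3, fgen s hDs g4, ?_⟩
  · have p : (e : ℤ) * (G.map (evalRingHom x)).rootMultiplicity 0 +
        e * (H.map (evalRingHom x)).rootMultiplicity 0 = 5 * e := by
      rw [← mul_add, mul_comm]; congr 1; exact_mod_cast g2
    have zs' : ((G.coeff 0).rootMultiplicity x : ℤ) + (H.coeff 0).rootMultiplicity x = e := by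
      exact_mod_cast zs
    clear K1 K2 fgen
    push_cast at e1 e2
    have : (5 : ℤ) * (G.coeff 0).rootMultiplicity x =
      e * (G.map (evalRingHom x)).rootMultiplicity 0 := by
      apply le_antisymm <;> linarith
    exact_mod_cast this
  · have p : (e : ℤ) * (G.map (evalRingHom x)).natDegree +
        e * (H.map (evalRingHom x)).natDegree = 7 * e := by
      rw [← mul_add, mul_comm]; congr 1; exact_mod_cast g5
    have p' : (e : ℤ) * G.natDegree + e * H.natDegree = 12 * e := by
      rw [← mul_add, mul_comm]; congr 1; exact_mod_cast nb
    have ls' : (G.leadingCoeff.rootMultiplicity x : ℤ) + H.leadingCoeff.rootMultiplicity x = e := by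
      exact_mod_cast ls
    clear K1 K2 fgen
    push_cast at e3 e4
    have : (5 : ℤ) * G.leadingCoeff.rootMultiplicity x + e * (G.map (evalRingHom x)).natDegree =
      e * G.natDegree := by
      apply le_antisymm <;> linarith
    exact_mod_cast this
  · intro j hj
    have e5 := K2 _ _ hj dH
    rw [dH'] at e5
    have p : (e : ℤ) * (G.map (evalRingHom x)).natDegree +
        e * (H.map (evalRingHom x)).natDegree = 7 * e := by
      rw [← mul_add, mul_comm]; congr 1; exact_mod_cast g5
    clear K1 K2 fgen
    push_cast at e5
    have : (e : ℤ) * j ≤ 5 * (G.coeff j).rootMultiplicity x +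
      e * (G.map (evalRingHom x)).natDegree := by
      linarith
    exact_mod_cast this

structure InfData (r s : ℂ) (G H : ℂ[X][X]) : Prop where
  ksum : (Bivariate.swap G).leadingCoeff.rootMultiplicity 0 +
    (Bivariate.swap H).leadingCoeff.rootMultiplicity 0 = 5
  asum : (Bivariate.swap G).natDegree + (Bivariate.swap H).natDegree = 12
  bsum : G.natDegree + H.natDegree = 12
  deg : (Bivariate.swap G).leadingCoeff.natDegree =
    (Bivariate.swap G).leadingCoeff.rootMultiplicity 0 +
    (Bivariate.swap G).leadingCoeff.rootMultiplicity r +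
    (Bivariate.swap G).leadingCoeff.rootMultiplicity s
  rsum : (Bivariate.swap G).leadingCoeff.rootMultiplicity r +
    (Bivariate.swap H).leadingCoeff.rootMultiplicity r = 1
  ssum : (Bivariate.swap G).leadingCoeff.rootMultiplicity s +
    (Bivariate.swap H).leadingCoeff.rootMultiplicity s = 1
  dsum : (Bivariate.swap G).leadingCoeff.natDegree +
    (Bivariate.swap H).leadingCoeff.natDegree = 7
  zero : 5 * (G.coeff 0).natDegree + 6 * (Bivariate.swap G).leadingCoeff.rootMultiplicity 0 =
    5 * (Bivariate.swap G).natDegree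
  lead : 5 * G.leadingCoeff.natDegree + 6 * G.natDegree =
    5 * (Bivariate.swap G).natDegree + 6 * (Bivariate.swap G).leadingCoeff.natDegree
  fr : ((Bivariate.swap G).map (evalRingHom r)).natDegree +
    6 * (Bivariate.swap G).leadingCoeff.rootMultiplicity r = (Bivariate.swap G).natDegree
  fs : ((Bivariate.swap G).map (evalRingHom s)).natDegree +
    6 * (Bivariate.swap G).leadingCoeff.rootMultiplicity s = (Bivariate.swap G).natDegree
  bound : ∀ j, G.coeff j ≠ 0 → 5 * (G.coeff j).natDegree +
    6 * (Bivariate.swap G).leadingCoeff.rootMultiplicity 0 ≤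
      5 * (Bivariate.swap G).natDegree + 6 * j
  zdeg : (G.coeff 0).natDegree = (G.coeff 0).rootMultiplicity 0 + (G.coeff 0).rootMultiplicity 1 +
    (G.coeff 0).rootMultiplicity (-8)
  ldeg : G.leadingCoeff.natDegree = G.leadingCoeff.rootMultiplicity 0 +
    G.leadingCoeff.rootMultiplicity 1 + G.leadingCoeff.rootMultiplicity (-8)
  rdeg : ((Bivariate.swap G).map (evalRingHom r)).natDegree =
    ((Bivariate.swap G).map (evalRingHom r)).rootMultiplicity 0 +
    ((Bivariate.swap G).map (evalRingHom r)).rootMultiplicity 1 +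
    ((Bivariate.swap G).map (evalRingHom r)).rootMultiplicity (-8)
  sdeg : ((Bivariate.swap G).map (evalRingHom s)).natDegree =
    ((Bivariate.swap G).map (evalRingHom s)).rootMultiplicity 0 +
    ((Bivariate.swap G).map (evalRingHom s)).rootMultiplicity 1 +
    ((Bivariate.swap G).map (evalRingHom s)).rootMultiplicity (-8)

theorem coeff_swap_ne (G : ℂ[X][X]) (j : ℕ) (h : (Bivariate.swap G).leadingCoeff.coeff j ≠ 0) :
    G.coeff j ≠ 0 ∧ (Bivariate.swap G).natDegree ≤ (G.coeff j).natDegree := by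
  rw [leadingCoeff, coeff_swap] at h
  exact ⟨fun h0 => h (by rw [h0, coeff_zero]), le_natDegree_of_ne_zero h⟩

theorem infData (r s : ℂ) (hrs : r ≠ s) (hr : r ≠ 0) (hs : s ≠ 0)
    (hD : DD = (X - C 0) ^ 5 * (X - C r) * (X - C s)) (G H : ℂ[X][X]) (hF : FF = G * H) :
    InfData r s G H := by
  have hDr : DD.eval r = 0 := by rw [hD]; simp
  have hDs : DD.eval s = 0 := by rw [hD]; simp
  have hS : Bivariate.swap G * Bivariate.swap H = Bivariate.swap FF := by rw [← map_mul, ← hF]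
  have hprod : (Bivariate.swap G).leadingCoeff * (Bivariate.swap H).leadingCoeff = C 1 * DD := by
    rw [← leadingCoeff_mul, hS, FF_swap_lead]; simp
  obtain ⟨g1, g2, g3, g4, g5, g6⟩ := Dsplit r s hrs hr hs hD _ _ _ one_ne_zero hprod
  obtain ⟨h1, -, -, -, -, h6⟩ :=
    Dsplit r s hrs hr hs hD _ _ _ one_ne_zero ((mul_comm _ _).trans hprod)
  have hFn : ∀ n, (n < 5 ∨ 7 < n) → (FF.coeff n).natDegree ≤ 6 := by
    intro n hn
    rw [FF_coeff, DD_coeff n hn, C_0, zero_mul, add_zero, ← PP_deg]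
    exact natDegree_C_mul_le _ _
  have hFm : ∀ n, (FF.coeff n).natDegree ≤ 12 := by
    intro n
    rw [FF_coeff]
    refine (natDegree_add_le _ _).trans (max_le ?_ ?_)
    · refine (natDegree_C_mul_le _ _).trans ?_
      rw [PP_deg]; omega
    · refine (natDegree_C_mul_le _ _).trans ?_
      rw [CC_deg]
  have hF12 : ∀ n, FF.coeff n ≠ 0 → n ≤ 12 := by
    intro n h0
    rw [← FF_natDegree]
    exact le_natDegree_of_ne_zero h0
  have K1 := key_deg 6 (-30) FF G H hF (by
    intro n h0
    have := hFm n
    by_cases hn : n < 5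
    · have := hFn n (Or.inl hn)
      omega
    · omega)
  have K2 := key_deg (-6) (-102) FF G H hF (by
    intro n h0
    have := hFm n
    have := hF12 n h0
    by_cases hn : 7 < n
    · have := hFn n (Or.inr hn)
      omega
    · omega)
  have z0 : G.coeff 0 * H.coeff 0 = C 1 * PP := by rw [← mul_coeff_zero, ← hF, FF_zero]; simp
  have zl : G.leadingCoeff * H.leadingCoeff = C 1 * PP := by
    rw [← leadingCoeff_mul, ← hF, FF_lead]; simp
  obtain ⟨zG, -, -, -, zs, zd⟩ := Psplit _ _ _ one_ne_zero z0
  obtain ⟨zH, -, -, -, -, -⟩ := Psplit _ _ _ one_ne_zero ((mul_comm _ _).trans z0)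
  obtain ⟨lG, -, -, -, ls, ld⟩ := Psplit _ _ _ one_ne_zero zl
  obtain ⟨lH, -, -, -, -, -⟩ := Psplit _ _ _ one_ne_zero ((mul_comm _ _).trans zl)
  have nb : G.natDegree + H.natDegree = 12 := by
    rw [← natDegree_mul (leadingCoeff_ne_zero.mp lG) (leadingCoeff_ne_zero.mp lH), ← hF,
      FF_natDegree]
  have na : (Bivariate.swap G).natDegree + (Bivariate.swap H).natDegree = 12 := by
    rw [← natDegree_mul (leadingCoeff_ne_zero.mp g1) (leadingCoeff_ne_zero.mp h1), hS,
      FF_swap_natDegree]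
  obtain ⟨kG, kG'⟩ := coeff_swap_ne G _ (coeff_rm_ne _ g1)
  obtain ⟨kH, kH'⟩ := coeff_swap_ne H _ (coeff_rm_ne _ h1)
  obtain ⟨dG, dG'⟩ := coeff_swap_ne G _ (leadingCoeff_ne_zero.mpr g1)
  obtain ⟨dH, dH'⟩ := coeff_swap_ne H _ (leadingCoeff_ne_zero.mpr h1)
  have e1 := K1 _ _ zG kH
  have e2 := K1 _ _ kG zH
  have e3 := K2 _ _ lG dH
  have e4 := K2 _ _ dG lH
  simp only [coeff_natDegree] at e3 e4
  have hp : ∀ t, DD.eval t = 0 →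
      (Bivariate.swap G).map (evalRingHom t) * (Bivariate.swap H).map (evalRingHom t) =
        C (AA.eval t) * PP := by
      intro t ht
      rw [← Polynomial.map_mul, hS, FF_swap_map t ht]
  have fgen : ∀ t, DD.eval t = 0 → (Bivariate.swap G).leadingCoeff.rootMultiplicity t +
      (Bivariate.swap H).leadingCoeff.rootMultiplicity t = 1 →
      ((Bivariate.swap G).map (evalRingHom t)).natDegree +
      6 * (Bivariate.swap G).leadingCoeff.rootMultiplicity t = (Bivariate.swap G).natDegree := by
    intro t ht hsum
    obtain ⟨-, -, -, -, ds, -⟩ := Psplit _ _ _ (AA_DD t ht) (hp t ht)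
    have aux : ∀ Q : ℂ[X][X], Q.leadingCoeff ≠ 0 →
        Q.leadingCoeff.rootMultiplicity t = 0 →
        (Q.map (evalRingHom t)).natDegree = Q.natDegree := by
      intro Q hQ h0
      rw [rootMultiplicity_eq_zero_iff] at h0
      apply natDegree_map_of_leadingCoeff_ne_zero
      intro h2
      exact hQ (h0 h2)
    rcases Nat.eq_zero_or_pos ((Bivariate.swap G).leadingCoeff.rootMultiplicity t) with h | h
    · rw [aux _ g1 h, h, mul_zero, add_zero]
    · have := aux _ h1 (by omega)
      omega
  refine ⟨g2, na, nb, g6, g3, g4, g5, ?_, ?_, fgen r hDr g3, fgen s hDs g4, ?_, zd, ld, ?_, ?_⟩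
  · omega
  · omega
  · intro j hj
    have e5 := K1 _ _ hj kH
    omega
  · exact (Psplit _ _ _ (AA_DD r hDr) (hp r hDr)).2.2.2.2.2
  · exact (Psplit _ _ _ (AA_DD s hDs) (hp s hDs)).2.2.2.2.2

theorem unit_of_zero (G H : ℂ[X][X]) (hF : FF = G * H) (h : (Bivariate.swap G).natDegree = 0) :
    IsUnit G := by
  have hS : Bivariate.swap FF = Bivariate.swap G * Bivariate.swap H := by rw [hF, map_mul]
  rw [natDegree_eq_zero] at h
  obtain ⟨q, hq⟩ := h
  have hq0 : q.degree = 0 := by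
    by_contra hd
    obtain ⟨z, hz⟩ := IsAlgClosed.exists_root q hd
    have h0 : (Bivariate.swap FF).map (evalRingHom z) = 0 := by
      rw [hS, ← hq, Polynomial.map_mul, map_C, coe_evalRingHom, hz.eq_zero, C_0, zero_mul]
    have h1 : DD.eval z = 0 := by
      have h2 := eval_swap FF 0 z
      rw [h0, FF_map] at h2
      have hP : PP.eval 0 = 0 := by unfold PP; simp
      have hC : CC.eval 0 = 4096 := by unfold CC; norm_num
      rw [hP, hC] at h2
      simpa using h2
    rw [FF_swap_map z h1] at h0
    exact mul_ne_zero (by simpa using AA_DD z h1) PP_monic.ne_zero h0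
  have hu : IsUnit (Bivariate.swap G) := by
    rw [← hq]
    exact (isUnit_iff_degree_eq_zero.mpr hq0).map C
  have := hu.map (Bivariate.swap (R := ℂ))
  rwa [Bivariate.swap_swap_apply] at this

theorem exists_x1 : ∃ x : ℂ, PP.eval x = -432 ∧ CC.eval x ≠ 0 := by
  have hd : (X ^ 5 + 4 * X ^ 4 - 23 * X ^ 3 + 54 * X ^ 2 - 108 * X + 216 : ℂ[X]).natDegree = 5 := by
    compute_degree!
  obtain ⟨x, hx⟩ := IsAlgClosed.exists_root
    (X ^ 5 + 4 * X ^ 4 - 23 * X ^ 3 + 54 * X ^ 2 - 108 * X + 216 : ℂ[X])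
    (by intro h; rw [natDegree_eq_of_degree_eq_some h] at hd; norm_num at hd)
  have hx : x ^ 5 + 4 * x ^ 4 - 23 * x ^ 3 + 54 * x ^ 2 - 108 * x + 216 = 0 := by
    simpa [IsRoot] using hx
  refine ⟨x, ?_, ?_⟩
  · unfold PP
    simp
    linear_combination (x + 2) * hx
  · intro h
    unfold CC at h
    simp at h
    rcases h with h | h
    · have : x = -2 := by linear_combination h
      rw [this] at hx
      norm_num at hx
    · have h4 : (x ^ 2 - 12) * (x ^ 2 + 12) = 0 := by
        linear_combination (-1/3) * (x + 2) * hx + (1/3) * x ^ 3 * h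
      rcases mul_eq_zero.mp h4 with h5 | h5
      · have : (80 : ℂ) = 0 := by linear_combination h - (x + 6) * h5
        norm_num at this
      · have h6 : x = -8/3 := by linear_combination (-1/24) * h + (1/24) * (x + 6) * h5
        rw [h6] at h5
        norm_num at h5

theorem PP_dvd (f : ℂ[X]) (hf : f ≠ 0) (h0 : 3 ≤ f.rootMultiplicity 0)
    (h1 : 2 ≤ f.rootMultiplicity 1) (h8 : 1 ≤ f.rootMultiplicity (-8)) (hd : f.natDegree ≤ 6) :
    ∃ c : ℂ, f = C c * PP := by
  rw [le_rootMultiplicity_iff hf] at h0 h1 h8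
  rw [pow_one] at h8
  have c1 : ∀ a b : ℂ, a ≠ b → IsCoprime (X - C a) (X - C b) := fun a b hab =>
    isCoprime_X_sub_C_of_isUnit_sub (by simpa [sub_eq_zero] using hab)
  have d1 : (X - C 0 : ℂ[X]) ^ 3 * (X - C (-8)) ∣ f :=
    IsCoprime.mul_dvd (IsCoprime.pow_left (c1 _ _ (by norm_num))) h0 h8
  have d2 : PP ∣ f := by
    refine IsCoprime.mul_dvd (IsCoprime.mul_left ?_ ?_) d1 h1
    · exact IsCoprime.pow (c1 _ _ (by norm_num))
    · exact IsCoprime.pow_right (c1 _ _ (by norm_num))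
  obtain ⟨q, rfl⟩ := d2
  have hq := right_ne_zero_of_mul hf
  rw [natDegree_mul PP_monic.ne_zero hq, PP_deg] at hd
  obtain ⟨c, rfl⟩ := natDegree_eq_zero.mp (show q.natDegree = 0 by omega)
  exact ⟨c, mul_comm _ _⟩

theorem numh (b k l r s k' l' r' s' : ℕ) (hr : r ≤ 1) (hs : s ≤ 1) (hr' : r' ≤ 1) (hs' : s' ≤ 1)
    (h : b = 5 * k + 5 * l + r + s) (h' : b = 5 * k' + 5 * l' + r' + s') :
    r + s = r' + s' ∧ k + l = k' + l' := by
  omega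

theorem num (a b k0 k1 k8 ki l0 l1 l8 li r0 r1 r8 ri s0 s1 s8 si : ℕ)
    (hr0 : r0 ≤ 1) (hr1 : r1 ≤ 1) (hr8 : r8 ≤ 1) (hri : ri ≤ 1)
    (hs0 : s0 ≤ 1) (hs1 : s1 ≤ 1) (hs8 : s8 ≤ 1) (hsi : si ≤ 1)
    (hk0 : k0 ≤ 1) (hk1 : k1 ≤ 1) (hk8 : k8 ≤ 1) (hki : ki ≤ 1)
       
    (b0 : b = 5 * k0 + 5 * l0 + r0 + s0) (b1 : b = 5 * k1 + 5 * l1 + r1 + s1)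
    (b8 : b = 5 * k8 + 5 * l8 + r8 + s8) (bi : b = 5 * ki + 5 * li + ri + si)
    (ak : 3 * k0 + 2 * k1 + k8 + 6 * ki = a) (al : 3 * l0 + 2 * l1 + l8 + 6 * li = a)
    (ar : 3 * r0 + 2 * r1 + r8 + 6 * ri = a) (as : 3 * s0 + 2 * s1 + s8 + 6 * si = a) :
    a = 0 ∨ a = 12 ∨ (a = 6 ∧ b = 6 ∧ ki = 1 ∧ k0 = 0 ∧ k1 = 0 ∧ k8 = 0) ∨
      (a = 6 ∧ b = 6 ∧ ki = 0 ∧ k0 = 1 ∧ k1 = 1 ∧ k8 = 1) := by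
  obtain ⟨m1, n1⟩ := numh b k1 l1 r1 s1 k0 l0 r0 s0 hr1 hs1 hr0 hs0 b1 b0
  obtain ⟨m8, n8⟩ := numh b k8 l8 r8 s8 k0 l0 r0 s0 hr8 hs8 hr0 hs0 b8 b0
  obtain ⟨mi, ni⟩ := numh b ki li ri si k0 l0 r0 s0 hri hsi hr0 hs0 bi b0
  have ha : 2 * a = 12 * (r0 + s0) := by linarith
  have ha' : 2 * a = 12 * (k0 + l0) := by linarith
  clear b1 b8 bi
  have : r0 + s0 = 0 ∨ r0 + s0 = 1 ∨ r0 + s0 = 2 := by clear * - hr0 hs0; omega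
  rcases this with h | h | h
  · left; clear * - ha h; omega
  · right; right
    have h6 : a = 6 := by clear * - ha h; omega
    have hb : b = 6 := by clear * - ha ha' h b0; omega
    have hki' : ki = 0 ∨ ki = 1 := by clear * - hki; omega
    clear * - hki' h6 hb ak hk0 hk1 hk8
    rcases hki' with h7 | h7
    · right; refine ⟨h6, hb, h7, ?_, ?_, ?_⟩ <;> omega
    · left; refine ⟨h6, hb, h7, ?_, ?_, ?_⟩ <;> omega
  · right; left; clear * - ha h; omega

theorem g1_eq (G : ℂ[X][X]) (t x y : ℂ) (ht : t ≠ 0) (hxy : x ≠ y)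
    (h0 : (G.coeff 0).natDegree = 0) (h1 : (G.coeff 1).natDegree ≤ 1)
    (dx : (G.map (evalRingHom x)).natDegree = 1) (dy : (G.map (evalRingHom y)).natDegree = 1)
    (rx : (G.map (evalRingHom x)).rootMultiplicity t ≠ 0)
    (ry : (G.map (evalRingHom y)).rootMultiplicity t ≠ 0) :
    ∃ c, G.coeff 1 = C c := by
  have hx : (G.map (evalRingHom x)).eval t = 0 := by
    by_contra h; exact rx (rootMultiplicity_eq_zero h)
  have hy : (G.map (evalRingHom y)).eval t = 0 := by
    by_contra h; exact ry (rootMultiplicity_eq_zero h)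
  rw [eval_eq_sum_range, dx] at hx
  rw [eval_eq_sum_range, dy] at hy
  obtain ⟨c0, hc0⟩ := natDegree_eq_zero.mp h0
  obtain ⟨a, b, hab⟩ := exists_eq_X_add_C_of_natDegree_le_one h1
  simp only [Finset.sum_range_succ, Finset.sum_range_zero, coeff_map, ← hc0, hab] at hx hy
  simp at hx hy
  have : a * (x - y) * t = 0 := by linear_combination hx - hy
  have ha : a = 0 := by
    rcases mul_eq_zero.mp this with h | h
    · rcases mul_eq_zero.mp h with h | h
      · exact h
      · exact absurd (sub_eq_zero.mp h) hxy
    · exact absurd h ht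
  exact ⟨b, by rw [hab, ha]; simp⟩

theorem final (r s : ℂ) (hr : r ≠ 0) (hs : s ≠ 0)
    (G H : ℂ[X][X]) (hF : FF = G * H)
    (D0 : FinData r s G H 0 3) (D1 : FinData r s G H 1 2) (D8 : FinData r s G H (-8) 1)
    (I : InfData r s G H)
    (ha : (Bivariate.swap G).natDegree = 6) (hb : G.natDegree = 6)
    (hki : (Bivariate.swap G).leadingCoeff.rootMultiplicity 0 = 5)
    (hk0 : (G.map (evalRingHom 0)).rootMultiplicity 0 = 0)
    (hk1 : (G.map (evalRingHom 1)).rootMultiplicity 0 = 0)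
    (hk8 : (G.map (evalRingHom (-8))).rootMultiplicity 0 = 0) : False := by
  have a1 := D0.deg
  have a2 := D0.lead
  have a3 := D0.rsum
  have a4 := D0.ssum
  have b1 := D1.deg
  have b2 := D1.lead
  have b3 := D1.rsum
  have b4 := D1.ssum
  have c1 := D8.deg
  have c2 := D8.lead
  have c3 := D8.rsum
  have c4 := D8.ssum
  have i1 := I.deg
  have i2 := I.lead
  have i3 := I.zero
  have i4 := I.rsum
  have i5 := I.ssum
  have i6 := I.ldeg
  have d0 : (G.map (evalRingHom 0)).natDegree = 1 := by omega
  have d1 : (G.map (evalRingHom 1)).natDegree = 1 := by omega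
  have d8 : (G.map (evalRingHom (-8))).natDegree = 1 := by omega
  have z0 : (G.coeff 0).natDegree = 0 := by omega
  have z1 : (G.coeff 1).natDegree ≤ 1 := by
    by_cases h : G.coeff 1 = 0
    · simp [h]
    · have := I.bound 1 h
      omega
  have hz : ∀ j, 2 ≤ j → j ≤ 4 → G.coeff j = 0 := by
    intro j h2 h4
    by_contra h
    have e1 := I.bound j h
    have e2 := D0.bound j h
    have e3 := D1.bound j h
    have e4 := D8.bound j h
    have e5 := sum_rm_le (G.coeff j) 0 1 (-8) (by norm_num) (by norm_num) (by norm_num)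
    have : j = 2 ∨ j = 3 ∨ j = 4 := by omega
    rcases this with rfl | rfl | rfl <;> omega
  have h5 : ∃ c, G.coeff 5 = C c * PP := by
    by_cases h : G.coeff 5 = 0
    · exact ⟨0, by simp [h]⟩
    · have e1 := I.bound 5 h
      have e2 := D0.bound 5 h
      have e3 := D1.bound 5 h
      have e4 := D8.bound 5 h
      apply PP_dvd _ h <;> omega
  have lG : G.leadingCoeff ≠ 0 := by
    rw [leadingCoeff_ne_zero]
    rintro rfl
    simp at hb
  have h6 : ∃ c, G.leadingCoeff = C c * PP := by
    apply PP_dvd _ lG <;> omega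
  have h1 : ∃ c, G.coeff 1 = C c := by
    have : ((G.map (evalRingHom 0)).rootMultiplicity r ≠ 0 ∧
        (G.map (evalRingHom 1)).rootMultiplicity r ≠ 0) ∨
        ((G.map (evalRingHom 0)).rootMultiplicity r ≠ 0 ∧
        (G.map (evalRingHom (-8))).rootMultiplicity r ≠ 0) ∨
        ((G.map (evalRingHom 1)).rootMultiplicity r ≠ 0 ∧
        (G.map (evalRingHom (-8))).rootMultiplicity r ≠ 0) ∨
        ((G.map (evalRingHom 0)).rootMultiplicity s ≠ 0 ∧
        (G.map (evalRingHom 1)).rootMultiplicity s ≠ 0) ∨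
        ((G.map (evalRingHom 0)).rootMultiplicity s ≠ 0 ∧
        (G.map (evalRingHom (-8))).rootMultiplicity s ≠ 0) ∨
        ((G.map (evalRingHom 1)).rootMultiplicity s ≠ 0 ∧
        (G.map (evalRingHom (-8))).rootMultiplicity s ≠ 0) := by omega
    rcases this with h | h | h | h | h | h
    · exact g1_eq G r 0 1 hr (by norm_num) z0 z1 d0 d1 h.1 h.2
    · exact g1_eq G r 0 (-8) hr (by norm_num) z0 z1 d0 d8 h.1 h.2
    · exact g1_eq G r 1 (-8) hr (by norm_num) z0 z1 d1 d8 h.1 h.2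
    · exact g1_eq G s 0 1 hs (by norm_num) z0 z1 d0 d1 h.1 h.2
    · exact g1_eq G s 0 (-8) hs (by norm_num) z0 z1 d0 d8 h.1 h.2
    · exact g1_eq G s 1 (-8) hs (by norm_num) z0 z1 d1 d8 h.1 h.2
  obtain ⟨u0, hu0⟩ := natDegree_eq_zero.mp z0
  obtain ⟨u1, hu1⟩ := h1
  obtain ⟨u5, hu5⟩ := h5
  obtain ⟨u6, hu6⟩ := h6
  have hu6' : G.coeff 6 = C u6 * PP := by rw [← hu6, leadingCoeff, hb]
  obtain ⟨x, hxP, hxC⟩ := exists_x1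
  have hyP : PP.eval (-2) = -432 := by unfold PP; norm_num
  have hyC : CC.eval (-2) = 0 := by unfold CC; norm_num
  have heq : G.map (evalRingHom x) = G.map (evalRingHom (-2)) := by
    ext j
    rw [coeff_map, coeff_map, coe_evalRingHom, coe_evalRingHom]
    by_cases hj : 6 < j
    · rw [coeff_eq_zero_of_natDegree_lt (by omega), eval_zero, eval_zero]
    · by_cases hj2 : 2 ≤ j ∧ j ≤ 4
      · rw [hz j hj2.1 hj2.2, eval_zero, eval_zero]
      · have : j = 0 ∨ j = 1 ∨ j = 5 ∨ j = 6 := by omega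
        rcases this with rfl | rfl | rfl | rfl
        · rw [← hu0, eval_C, eval_C]
        · rw [hu1, eval_C, eval_C]
        · rw [hu5, eval_mul, eval_mul, eval_C, eval_C, hxP, hyP]
        · rw [hu6', eval_mul, eval_mul, eval_C, eval_C, hxP, hyP]
  have hu6n : u6 ≠ 0 := by
    rintro rfl
    apply lG
    rw [hu6]
    simp
  have hdeg : (G.map (evalRingHom x)).degree ≠ 0 := by
    intro hd
    have h1 : (G.map (evalRingHom x)).coeff 6 ≠ 0 := by
      rw [coeff_map, coe_evalRingHom, hu6', eval_mul, eval_C, hxP]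
      exact mul_ne_zero hu6n (by norm_num)
    have h2 := le_natDegree_of_ne_zero h1
    have h3 : (G.map (evalRingHom x)).natDegree = 0 := natDegree_eq_of_degree_eq_some hd
    rw [h3] at h2
    exact absurd h2 (by decide)
  obtain ⟨z, hz⟩ := IsAlgClosed.exists_root _ hdeg
  have hFx : ∀ w, G.map (evalRingHom x) = G.map (evalRingHom w) →
      PP.eval w * AA.eval z + CC.eval w * DD.eval z = 0 := by
    intro w hw
    have h1 := congrArg (eval z) (FF_map w)
    rw [hF, Polynomial.map_mul, eval_mul, ← hw, hz.eq_zero, zero_mul] at h1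
    simpa using h1.symm
  have f1 := hFx x rfl
  have f2 := hFx (-2) heq
  rw [hyP, hyC] at f2
  rw [hxP] at f1
  have hA : AA.eval z = 0 := by
    simpa using f2
  rw [hA] at f1
  have hDz : DD.eval z = 0 := by
    simpa [hxC] using f1
  exact AA_DD z hDz hA

theorem le_aux {a b : ℕ} (h : a + b = 1) : a ≤ 1 := by omega

theorem sum_aux {a z p q u k0 k1 k8 ki : ℕ} (hz : z = p + q + u) (hp : p = 3 * k0)
    (hq : q = 2 * k1) (hu : u = 1 * k8) (ha : z + 6 * ki = a) :
    3 * k0 + 2 * k1 + k8 + 6 * ki = a := by omega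

theorem zero_aux {n k : ℕ} (h : n = 5 * k) (hk : k = 0) : n = 0 := by omega

theorem one_aux {n k : ℕ} (h : n = 5 * k) (hk : k = 1) : n = 5 := by omega

theorem compl_aux {a b c d : ℕ} (h : a + b = c) (h' : a = d) : b = c - d := by omega

theorem lead_le (G : ℂ[X][X]) (hG : G ≠ 0) :
    G.leadingCoeff.natDegree ≤ (Bivariate.swap G).natDegree := by
  have h : (G.coeff G.natDegree).coeff (G.coeff G.natDegree).natDegree ≠ 0 := by
    rw [coeff_natDegree, coeff_natDegree, leadingCoeff_ne_zero, leadingCoeff_ne_zero]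
    exact hG
  rw [← coeff_swap] at h
  refine le_natDegree_of_ne_zero (fun h0 => h ?_)
  rw [show G.coeff G.natDegree = G.leadingCoeff from rfl, h0, coeff_zero]

theorem numfin (e b b' d d' k k' z l l' r s : ℕ) (he : e = 3 ∨ e = 2 ∨ e = 1)
    (a1 : k + k' = 5) (a2 : d + d' = 7) (a3 : d = k + r + s) (a4 : 5 * z = e * k)
    (a5 : 5 * l + e * d = e * b) (b5 : 5 * l' + e * d' = e * b') (a6 : b + b' = 12) :
    ∃ m n, m ≤ 1 ∧ n ≤ 1 ∧ k = 5 * m ∧ z = e * m ∧ l = e * n ∧ b = 5 * m + 5 * n + r + s := by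
  refine ⟨k / 5, (b - d) / 5, ?_⟩
  rcases he with rfl | rfl | rfl <;> refine ⟨?_, ?_, ?_, ?_, ?_, ?_⟩ <;> omega

theorem numinf (a a' b b' d d' k k' z l l' r s : ℕ)
    (a1 : k + k' = 5) (a2 : d + d' = 7) (a3 : d = k + r + s) (a4 : 5 * z + 6 * k = 5 * a)
    (a5 : 5 * l + 6 * b = 5 * a + 6 * d) (b5 : 5 * l' + 6 * b' = 5 * a' + 6 * d')
    (a6 : b + b' = 12) (c1 : l ≤ a) (c2 : l' ≤ a') :
    ∃ m n, m ≤ 1 ∧ n ≤ 1 ∧ k = 5 * m ∧ z + 6 * m = a ∧ l + 6 * n = a ∧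
      b = 5 * m + 5 * n + r + s := by
  refine ⟨k / 5, (b - d) / 5, ?_⟩
  refine ⟨?_, ?_, ?_, ?_, ?_, ?_⟩ <;> omega

set_option maxHeartbeats 1000000 in
theorem FF_irreducible : Irreducible FF := by
  obtain ⟨r, s, hrs, hr, hs, hD⟩ := exists_r
  refine ⟨?_, ?_⟩
  · intro h
    have := natDegree_eq_zero_of_isUnit h
    rw [FF_natDegree] at this
    omega
  intro G H hF
  have hF' : FF = H * G := by rw [hF, mul_comm]
  have p0 : PP.eval 0 = 0 := by unfold PP; norm_num
  have p1 : PP.eval 1 = 0 := by unfold PP; norm_num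
  have p8 : PP.eval (-8) = 0 := by unfold PP; norm_num
  have q0 : CC.eval 0 ≠ 0 := by unfold CC; norm_num
  have q1 : CC.eval 1 ≠ 0 := by unfold CC; norm_num
  have q8 : CC.eval (-8) ≠ 0 := by unfold CC; norm_num
  have D0 := finData r s hrs hr hs hD G H hF 0 3 p0 q0 PP_rm0
  have D1 := finData r s hrs hr hs hD G H hF 1 2 p1 q1 PP_rm1
  have D8 := finData r s hrs hr hs hD G H hF (-8) 1 p8 q8 PP_rm8
  have E0 := finData r s hrs hr hs hD H G hF' 0 3 p0 q0 PP_rm0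
  have E1 := finData r s hrs hr hs hD H G hF' 1 2 p1 q1 PP_rm1
  have E8 := finData r s hrs hr hs hD H G hF' (-8) 1 p8 q8 PP_rm8
  have I := infData r s hrs hr hs hD G H hF
  have J := infData r s hrs hr hs hD H G hF'
  have hfin : ∀ (x : ℂ) (e : ℕ), (e = 3 ∨ e = 2 ∨ e = 1) → FinData r s G H x e →
      FinData r s H G x e → ∃ k l, k ≤ 1 ∧ l ≤ 1 ∧
      (G.map (evalRingHom x)).rootMultiplicity 0 = 5 * k ∧
      (G.coeff 0).rootMultiplicity x = e * k ∧ G.leadingCoeff.rootMultiplicity x = e * l ∧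
      G.natDegree = 5 * k + 5 * l + (G.map (evalRingHom x)).rootMultiplicity r +
        (G.map (evalRingHom x)).rootMultiplicity s := by
    intro x e he D E
    exact numfin e _ _ _ _ _ _ _ _ _ _ _ he D.ksum D.dsum D.deg D.zero D.lead E.lead I.bsum
  obtain ⟨k0, l0, hk0, hl0, x1, x2, x3, x4⟩ := hfin 0 3 (by simp) D0 E0
  obtain ⟨k1, l1, hk1, hl1, y1, y2, y3, y4⟩ := hfin 1 2 (by simp) D1 E1
  obtain ⟨k8, l8, hk8, hl8, w1, w2, w3, w4⟩ := hfin (-8) 1 (by simp) D8 E8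
  have hinf : ∃ k l, k ≤ 1 ∧ l ≤ 1 ∧
      (Bivariate.swap G).leadingCoeff.rootMultiplicity 0 = 5 * k ∧
      (G.coeff 0).natDegree + 6 * k = (Bivariate.swap G).natDegree ∧
      G.leadingCoeff.natDegree + 6 * l = (Bivariate.swap G).natDegree ∧
      G.natDegree = 5 * k + 5 * l + (Bivariate.swap G).leadingCoeff.rootMultiplicity r +
        (Bivariate.swap G).leadingCoeff.rootMultiplicity s := by
    have hF0 : FF ≠ 0 := by
      intro h
      have := FF_natDegree
      rw [h] at this
      simp at this
    exact numinf _ _ _ _ _ _ _ _ _ _ _ _ _ I.ksum I.dsum I.deg I.zero I.lead J.lead I.bsum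
      (lead_le G (by rintro rfl; exact hF0 (by rw [hF, zero_mul])))
      (lead_le H (by rintro rfl; exact hF0 (by rw [hF, mul_zero])))
  obtain ⟨ki, li, hki, hli, v1, v2, v3, v4⟩ := hinf
  rcases num _ _ k0 k1 k8 ki l0 l1 l8 li _ _ _ _ _ _ _ _ (le_aux D0.rsum) (le_aux D1.rsum)
    (le_aux D8.rsum) (le_aux I.rsum) (le_aux D0.ssum) (le_aux D1.ssum) (le_aux D8.ssum)
    (le_aux I.ssum) hk0 hk1 hk8 hki x4 y4 w4 v4 (sum_aux I.zdeg x2 y2 w2 v2)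
    (sum_aux I.ldeg x3 y3 w3 v3) (sum_aux I.rdeg D0.fr D1.fr D8.fr I.fr)
    (sum_aux I.sdeg D0.fs D1.fs D8.fs I.fs) with h | h | h | h
  · exact Or.inl (unit_of_zero G H hF h)
  · exact Or.inr (unit_of_zero H G hF' (compl_aux I.asum h))
  · obtain ⟨h1, h2, h3, h4, h5, h6⟩ := h
    exact (final r s hr hs G H hF D0 D1 D8 I h1 h2 (one_aux v1 h3) (zero_aux x1 h4)
      (zero_aux y1 h5) (zero_aux w1 h6)).elim
  · obtain ⟨h1, h2, h3, h4, h5, h6⟩ := h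
    exact (final r s hr hs H G hF' E0 E1 E8 J (compl_aux I.asum h1) (compl_aux I.bsum h2)
      (compl_aux I.ksum (zero_aux v1 h3)) (compl_aux D0.ksum (one_aux x1 h4))
      (compl_aux D1.ksum (one_aux y1 h5)) (compl_aux D8.ksum (one_aux w1 h6))).elim

theorem map_FF : Bivariate.equivMvPolynomial ℂ FF = chudnovskyCurvePoly := by
  have hP : PP = X ^ 3 * (X + 8) * (X - 1) ^ 2 := by
    have h8 : (C (-8) : ℂ[X]) = -8 := by rw [C_neg]; rfl
    unfold PP
    rw [h8, C_0, C_1]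
    ring
  have hD : DD = X ^ 5 * (X ^ 2 + 11 * X - 1) := by
    have h11 : (C 11 : ℂ[X]) = 11 := rfl
    unfold DD
    rw [h11]
    ring
  have eX : Bivariate.equivMvPolynomial ℂ (C X) = MvPolynomial.X 0 :=
    Bivariate.equivMvPolynomial_C_X
  have eY : Bivariate.equivMvPolynomial ℂ X = MvPolynomial.X 1 := Bivariate.equivMvPolynomial_X
  unfold FF chudnovskyCurvePoly
  rw [hP, hD, AA, CC]
  simp only [Polynomial.map_mul, Polynomial.map_pow, Polynomial.map_add, Polynomial.map_sub,
    Polynomial.map_X, Polynomial.map_one, Polynomial.map_ofNat, map_mul, map_pow, map_add, map_sub,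
    map_one, map_ofNat, eX, eY]
  ring

end Polynomial.Chud

theorem chudnovskyCurvePoly_irreducible : Irreducible chudnovskyCurvePoly := by
  rw [← Polynomial.Chud.map_FF, MulEquiv.irreducible_iff]
  exact Polynomial.Chud.FF_irreducible
end

section
/- Let U ⊆ ℂ be open with z·(z−1)·(z+8) ≠ 0 for all z ∈ U. Let x : ℂ → ℂ be three times differentiable on U and satisfy x(z)² − x(z)⁴ = 16(z−1)/(z³(z+8)) for all z ∈ U, with x(z)·(x(z)−1)·(x(z)+1) ≠ 0 for all z ∈ U. Let V ⊆ ℂ be open with x(U) ⊆ V, let ψ solve ψ'' = Q₁·ψ on V, and let g : ℂ → ℂ be twice differentiable and nonvanishing on U with g(z)² = x'(z) for all z ∈ U. Then Φ(z) := ψ(x(z))/g(z) solves Φ'' = Q₃·Φ on U. -/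
open Complex

/-- `f` solves the equation `ψ'' = Q·ψ` on the open set `U`. -/
def SolvesOn (Q f : ℂ → ℂ) (U : Set ℂ) : Prop :=
  (∀ x ∈ U, DifferentiableAt ℂ f x) ∧ (∀ x ∈ U, DifferentiableAt ℂ (deriv f) x) ∧
    ∀ x ∈ U, deriv (deriv f) x = Q x * f x

/-- The coefficient of the normal form (1') of the first Chudnovsky equation. -/
noncomputable def Q₁ (x : ℂ) : ℂ :=
  -(1 / 4) * (x ^ 2 + 1) ^ 2 / (x ^ 2 * (x - 1) ^ 2 * (x + 1) ^ 2)

/-- The coefficient of the normal form (3') of the third Chudnovsky equation. -/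
noncomputable def Q₃ (x : ℂ) : ℂ :=
  -(1 / 4) * (x ^ 4 + 8 * x ^ 3 + 72 * x ^ 2 - 64 * x + 64)
    / (x ^ 2 * (x - 1) ^ 2 * (x + 8) ^ 2)

theorem chudnovsky_three_one_elliptic_equivalence
    (U V : Set ℂ) (hU : IsOpen U) (hV : IsOpen V)
    (hUne : ∀ z ∈ U, z * (z - 1) * (z + 8) ≠ 0)
    (x g ψ : ℂ → ℂ)
    (hx1 : ∀ z ∈ U, DifferentiableAt ℂ x z)
    (hx2 : ∀ z ∈ U, DifferentiableAt ℂ (deriv x) z)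
    (hx3 : ∀ z ∈ U, DifferentiableAt ℂ (deriv (deriv x)) z)
    (hcurve : ∀ z ∈ U, x z ^ 2 - x z ^ 4 = 16 * (z - 1) / (z ^ 3 * (z + 8)))
    (hxne : ∀ z ∈ U, x z * (x z - 1) * (x z + 1) ≠ 0)
    (hxV : ∀ z ∈ U, x z ∈ V)
    (hψ : SolvesOn Q₁ ψ V)
    (hg1 : ∀ z ∈ U, DifferentiableAt ℂ g z)
    (hg2 : ∀ z ∈ U, DifferentiableAt ℂ (deriv g) z)
    (hgne : ∀ z ∈ U, g z ≠ 0)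
    (hgsq : ∀ z ∈ U, g z ^ 2 = deriv x z) :
    SolvesOn Q₃ (fun z => ψ (x z) / g z) U := by
  have hz0 : ∀ z ∈ U, z ≠ 0 := fun z hz h => hUne z hz (by simp [h])
  have hz1 : ∀ z ∈ U, z - 1 ≠ 0 := fun z hz h => hUne z hz (by simp [h])
  have hz8 : ∀ z ∈ U, z + 8 ≠ 0 := fun z hz h => hUne z hz (by simp [h])
  have hx0 : ∀ z ∈ U, x z ≠ 0 := fun z hz h => hxne z hz (by simp [h])
  have hy : ∀ z ∈ U, 1 - x z ^ 2 ≠ 0 := fun z hz h => hxne z hz (by linear_combination (-x z) * h)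
  have hc : ∀ z ∈ U, (x z ^ 2 - x z ^ 4) * (z ^ 3 * (z + 8)) = 16 * (z - 1) := by
    intro z hz
    have h0 := hz0 z hz
    have h8 := hz8 z hz
    rw [hcurve z hz]; field_simp
  have hdx : ∀ z ∈ U, HasDerivAt x (g z ^ 2) z := fun z hz => by
    rw [hgsq z hz]; exact (hx1 z hz).hasDerivAt
  have hdg : ∀ z ∈ U, HasDerivAt g (deriv g z) z := fun z hz => (hg1 z hz).hasDerivAt
  -- first differentiation of the curve
  have hc' : ∀ z ∈ U, g z ^ 2 * (2 * x z - 4 * x z ^ 3) * (z ^ 3 * (z + 8))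
      + (x z ^ 2 - x z ^ 4) * (3 * z ^ 2 * (z + 8) + z ^ 3) = 16 := by
    intro z hz
    have h1 := (((hdx z hz).pow 2).sub ((hdx z hz).pow 4)).mul
      (((hasDerivAt_id z).pow 3).mul ((hasDerivAt_id z).add_const 8))
    have h2 := ((hasDerivAt_id z).sub_const 1).const_mul 16
    have h3 := h1.unique (h2.congr_of_eventuallyEq
      (Filter.eventually_of_mem (hU.mem_nhds hz) (fun w hw => by simpa using hc w hw)))
    simp at h3
    linear_combination h3
  -- key relation
  have hS : ∀ z ∈ U, (z ^ 2 + 4 * z - 8) ^ 2 *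
      (4 * g z ^ 4 * ((z - 1) ^ 2 * (z + 8)) - 9 * (x z * (1 - x z ^ 2)) ^ 2 * z) = 0 := by
    intro z hz
    have h0 := hz0 z hz
    have h1 := hz1 z hz
    have h8 := hz8 z hz
    have ha := hc z hz
    have hw : (1 - 2 * x z ^ 2) ^ 2 * (z ^ 3 * (z + 8)) = (z ^ 2 + 4 * z - 8) ^ 2 := by
      linear_combination (-4) * ha
    have hb : 2 * g z ^ 2 * (1 - 2 * x z ^ 2) * (z * (z - 1) * (z + 8))
        = -3 * (z ^ 2 + 4 * z - 8) * (x z * (1 - x z ^ 2)) := by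
      have : x z * z ^ 2 * (2 * g z ^ 2 * (1 - 2 * x z ^ 2) * (z * (z - 1) * (z + 8)))
        = x z * z ^ 2 * (-3 * (z ^ 2 + 4 * z - 8) * (x z * (1 - x z ^ 2))) := by
        linear_combination (z - 1) * hc' z hz - ha
      exact mul_left_cancel₀ (mul_ne_zero (hx0 z hz) (pow_ne_zero 2 h0)) this
    apply mul_left_cancel₀ h0
    linear_combination (-4 * g z ^ 4 * ((z - 1) ^ 2 * (z + 8)) * z) * hw
      + z ^ 2 * (2 * g z ^ 2 * (1 - 2 * x z ^ 2) * (z * (z - 1) * (z + 8))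
        + -3 * (z ^ 2 + 4 * z - 8) * (x z * (1 - x z ^ 2))) * hb
  have hk : ∀ z ∈ U, 4 * g z ^ 4 * ((z - 1) ^ 2 * (z + 8))
      = 9 * (x z * (1 - x z ^ 2)) ^ 2 * z := by
    intro z hz
    by_cases hs : z ^ 2 + 4 * z - 8 = 0
    · have hne : ∀ᶠ w in nhdsWithin z {z}ᶜ, w ^ 2 + 4 * w - 8 ≠ 0 := by
        have hd : HasDerivAt (fun w : ℂ => w ^ 2 + 4 * w - 8) (2 * z + 4) z := by
          have := (((hasDerivAt_id z).pow 2).add ((hasDerivAt_id z).const_mul 4)).sub_const 8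
          simpa using this
        refine hd.eventually_ne ?_
        intro h
        have : (12 : ℂ) = 0 := by linear_combination (z / 2 + 1) * h - hs
        norm_num at this
      have hct : ContinuousAt (fun w => 4 * g w ^ 4 * ((w - 1) ^ 2 * (w + 8))
          - 9 * (x w * (1 - x w ^ 2)) ^ 2 * w) z := by
        have h1 := (hdx z hz).continuousAt
        have h2 := (hdg z hz).continuousAt
        fun_prop
      have ht := hct.tendsto.mono_left (nhdsWithin_le_nhds (s := {z}ᶜ))
      have ht2 : Filter.Tendsto (fun w => 4 * g w ^ 4 * ((w - 1) ^ 2 * (w + 8))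
          - 9 * (x w * (1 - x w ^ 2)) ^ 2 * w) (nhdsWithin z {z}ᶜ) (nhds 0) := by
        refine tendsto_const_nhds.congr' ?_
        filter_upwards [hne, nhdsWithin_le_nhds (hU.mem_nhds hz)] with w hw hwU
        exact ((mul_eq_zero.mp (hS w hwU)).resolve_left (pow_ne_zero 2 hw)).symm
      exact sub_eq_zero.mp (tendsto_nhds_unique ht ht2)
    · exact sub_eq_zero.mp ((mul_eq_zero.mp (hS z hz)).resolve_left (pow_ne_zero 2 hs))
  -- formula for g'
  have hg' : ∀ z ∈ U, deriv g z = (g z ^ 3 * (1 - 3 * x z ^ 2) / (x z * (1 - x z ^ 2))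
      - g z * (z + 2) ^ 2 / (z * (z - 1) * (z + 8))) / 2 := by
    intro z hz
    have h0 := hz0 z hz
    have h1 := hz1 z hz
    have h8 := hz8 z hz
    have hx := hx0 z hz
    have hyz := hy z hz
    have hgz := hgne z hz
    have e1 := (((hdg z hz).pow 4).const_mul 4).mul
      ((((hasDerivAt_id z).sub_const 1).pow 2).mul ((hasDerivAt_id z).add_const 8))
    have e2 := ((((hdx z hz).mul (((hdx z hz).pow 2).const_sub 1)).pow 2).const_mul 9).mul
      (hasDerivAt_id z)
    have e3 := e1.unique (e2.congr_of_eventuallyEq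
      (Filter.eventually_of_mem (hU.mem_nhds hz) (fun w hw => by simpa using hk w hw)))
    simp at e3
    have hkz := hk z hz
    generalize deriv g z = d at *
    generalize g z = γ at *
    generalize x z = a at *
    have key : (16 * γ ^ 3 * (z - 1)) * (2 * d * (a * (1 - a ^ 2)) * (z * (z - 1) * (z + 8)))
      = (16 * γ ^ 3 * (z - 1)) * (γ ^ 3 * (1 - 3 * a ^ 2) * (z * (z - 1) * (z + 8))
        - γ * (z + 2) ^ 2 * (a * (1 - a ^ 2))) := by
      linear_combination 2 * z * (a * (1 - a ^ 2)) * e3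
        - 2 * (2 * (1 - 3 * a ^ 2) * γ ^ 2 * z + a * (1 - a ^ 2)) * hkz
    have key2 := mul_left_cancel₀ (mul_ne_zero (mul_ne_zero (by norm_num) (pow_ne_zero 3 hgz)) h1) key
    field_simp
    linear_combination key2
  have hdΨ : ∀ z ∈ U, HasDerivAt (fun z => ψ (x z)) (deriv ψ (x z) * g z ^ 2) z := fun z hz =>
    ((hψ.1 _ (hxV z hz)).hasDerivAt).comp z (hdx z hz)
  have hdΨ' : ∀ z ∈ U, HasDerivAt (fun z => deriv ψ (x z))
      (Q₁ (x z) * ψ (x z) * g z ^ 2) z := fun z hz => by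
    rw [← hψ.2.2 _ (hxV z hz)]
    exact ((hψ.2.1 _ (hxV z hz)).hasDerivAt).comp z (hdx z hz)
  have hΦ : ∀ z ∈ U, HasDerivAt (fun z => ψ (x z) / g z)
      (deriv ψ (x z) * g z - ψ (x z) * deriv g z / g z ^ 2) z := fun z hz => by
    have hgz := hgne z hz
    refine ((hdΨ z hz).div (hdg z hz) hgz).congr_deriv ?_
    field_simp
  -- second derivative of g
  have hg'' : ∀ z ∈ U, HasDerivAt (deriv g)
      (g z * (Q₁ (x z) * g z ^ 4 - Q₃ z) + 2 * deriv g z ^ 2 / g z) z := by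
    intro z hz
    have h0 := hz0 z hz
    have h1 := hz1 z hz
    have h8 := hz8 z hz
    have hx := hx0 z hz
    have hyz := hy z hz
    have hgz := hgne z hz
    have hy' : x z * (1 - x z ^ 2) ≠ 0 := mul_ne_zero hx hyz
    have e1 := ((((hdg z hz).pow 3).mul ((((hdx z hz).pow 2).const_mul 3).const_sub 1)).div
      ((hdx z hz).mul (((hdx z hz).pow 2).const_sub 1)) hy')
    have e2 := (((hdg z hz).mul (((hasDerivAt_id z).add_const 2).pow 2)).div
      (((hasDerivAt_id z).mul ((hasDerivAt_id z).sub_const 1)).mul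
        ((hasDerivAt_id z).add_const 8)) (hUne z hz))
    have e3 := ((e1.sub e2).div_const 2).congr_of_eventuallyEq (f₁ := deriv g)
      (Filter.eventually_of_mem (hU.mem_nhds hz) (fun w hw => by simpa using hg' w hw))
    refine e3.congr_deriv ?_
    symm
    simp
    have hdz := hg' z hz
    have hkz := hk z hz
    have hcz := hc z hz
    rw [hdz]
    unfold Q₁ Q₃
    generalize deriv g z = d at *
    generalize g z = γ at *
    generalize x z = a at *
    have hq : a ^ 2 * (a - 1) ^ 2 * (a + 1) ^ 2 = (a * (1 - a ^ 2)) ^ 2 := by ring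
    rw [hq]
    have hfin : γ ^ 4 * (a ^ 2 - a ^ 4) / (a * (1 - a ^ 2)) ^ 2
        = 36 / ((z - 1) * z ^ 2 * (z + 8) ^ 2) := by
      rw [div_eq_div_iff (pow_ne_zero 2 hy')
        (mul_ne_zero (mul_ne_zero h1 (pow_ne_zero 2 h0)) (pow_ne_zero 2 h8))]
      apply mul_left_cancel₀ (mul_ne_zero (by norm_num : (4 : ℂ) ≠ 0) h1)
      linear_combination (a ^ 2 - a ^ 4) * z ^ 2 * (z + 8) * hkz
        + 9 * (a * (1 - a ^ 2)) ^ 2 * hcz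
    rw [← sub_eq_zero] at hfin ⊢
    have hid := congrArg (fun t => γ * t) hfin
    simp only [mul_zero] at hid
    refine Eq.trans ?_ hid
    field_simp
    ring
  refine ⟨fun z hz => (hΦ z hz).differentiableAt, ?_⟩
  have hΦ2 : ∀ z ∈ U, HasDerivAt (deriv (fun z => ψ (x z) / g z))
      (Q₃ z * (ψ (x z) / g z)) z := by
    intro z hz
    have hgz := hgne z hz
    have e1 := ((hdΨ' z hz).mul (hdg z hz)).sub
      (((hdΨ z hz).mul (hg'' z hz)).div ((hdg z hz).pow 2) (pow_ne_zero 2 hgz))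
    have e2 := e1.congr_of_eventuallyEq (f₁ := deriv (fun z => ψ (x z) / g z))
      (Filter.eventually_of_mem (hU.mem_nhds hz) (fun w hw => by simpa using (hΦ w hw).deriv))
    refine e2.congr_deriv ?_
    simp
    field_simp
    ring
  exact ⟨fun z hz => (hΦ2 z hz).differentiableAt, fun z hz => (hΦ2 z hz).deriv⟩
end

section
/- Let U ⊆ ℂ be open with z·(z−1)·(z+1) ≠ 0 for all z ∈ U. Let x : ℂ → ℂ be three times differentiable on U and satisfy 16·(x(z)⁴ − x(z)²)·(z⁴ − z²) = 1 for all z ∈ U, with x(z)·(x(z)−1)·(x(z)+1) ≠ 0 for all z ∈ U. Let V ⊆ ℂ be open with x(U) ⊆ V, let ψ solve ψ'' = Q₁·ψ on V, and let g : ℂ → ℂ be twice differentiable and nonvanishing on U with g(z)² = x'(z) for all z ∈ U. Then Φ(z) := ψ(x(z))/g(z) solves Φ'' = Q₁·Φ on U. -/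
open Complex

theorem eqOn_deriv_aux {U : Set ℂ} (hU : IsOpen U) {F G : ℂ → ℂ} (h : ∀ z ∈ U, F z = G z)
    {z a b : ℂ} (hz : z ∈ U) (hF : HasDerivAt F a z) (hG : HasDerivAt G b z) : a = b := by
  have he : F =ᶠ[nhds z] G := by
    filter_upwards [hU.mem_nhds hz] with w hw using h w hw
  exact hF.unique (hG.congr_of_eventuallyEq he)

theorem alg_final (z x g g1 g2 : ℂ) (hz : z ≠ 0) (hz1 : z - 1 ≠ 0) (hz2 : z + 1 ≠ 0)
    (hx : x ≠ 0) (hx1 : x - 1 ≠ 0) (hx2 : x + 1 ≠ 0) (hg : g ≠ 0)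
    (hc : 16 * (x ^ 4 - x ^ 2) * (z ^ 4 - z ^ 2) = 1)
    (hE : 4 * g ^ 4 * (z ^ 2 * (z ^ 2 - 1) ^ 2) = x ^ 2 - 1)
    (h1 : 8 * (g * g1) * (z ^ 2 * (z ^ 2 - 1) ^ 2) + 2 * g ^ 2 * (6 * z ^ 5 - 8 * z ^ 3 + 2 * z) = x)
    (h2 : 8 * g1 ^ 2 * (z ^ 2 * (z ^ 2 - 1) ^ 2) + 8 * (g * g2) * (z ^ 2 * (z ^ 2 - 1) ^ 2)
      + 12 * (g * g1) * (6 * z ^ 5 - 8 * z ^ 3 + 2 * z)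
      + 2 * g ^ 2 * (30 * z ^ 4 - 24 * z ^ 2 + 2) = g ^ 2) :
    Q₁ x * g ^ 4 - g2 / g + 2 * g1 ^ 2 / g ^ 2 = Q₁ z := by
  have hzz : z ^ 2 - 1 ≠ 0 := by
    have := mul_ne_zero hz1 hz2
    intro h; apply this; linear_combination h
  have hxx : x ^ 2 - 1 ≠ 0 := by
    have := mul_ne_zero hx1 hx2
    intro h; apply this; linear_combination h
  have hQx : Q₁ x * g ^ 4 = -(x ^ 2 + 1) ^ 2 / (z ^ 2 - 1) := by
    have e : g ^ 4 = (x ^ 2 - 1) / (4 * (z ^ 2 * (z ^ 2 - 1) ^ 2)) := by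
      field_simp; linear_combination hE
    rw [e, Q₁, show x ^ 2 * (x - 1) ^ 2 * (x + 1) ^ 2 = x ^ 2 * (x ^ 2 - 1) ^ 2 by ring]
    field_simp
    linear_combination (x ^ 2 + 1) ^ 2 * hc
  rw [hQx]
  have hQz : Q₁ z = -(1 / 4) * (z ^ 2 + 1) ^ 2 / (z ^ 2 * (z ^ 2 - 1) ^ 2) := by
    rw [Q₁, show z ^ 2 * (z - 1) ^ 2 * (z + 1) ^ 2 = z ^ 2 * (z ^ 2 - 1) ^ 2 by ring]
  rw [hQz]
  obtain ⟨W, hW⟩ : ∃ W, W = z ^ 2 * (z ^ 2 - 1) ^ 2 := ⟨_, rfl⟩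
  have hW0 : W ≠ 0 := by rw [hW]; simp [*]
  obtain ⟨D, hD⟩ : ∃ D, D = 6 * z ^ 5 - 8 * z ^ 3 + 2 * z := ⟨_, rfl⟩
  obtain ⟨S, hS⟩ : ∃ S, S = 30 * z ^ 4 - 24 * z ^ 2 + 2 := ⟨_, rfl⟩
  rw [← hW] at hE h1 h2
  rw [← hD] at h1 h2
  rw [← hS] at h2
  have hb : 4 * W * g ^ 4 * (-(g2 / g) + 2 * g1 ^ 2 / g ^ 2)
      = 4 * W * g ^ 2 * (-(g * g2) + 2 * g1 ^ 2) := by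
    field_simp
  -- multiply by 64 W^2 g^4
  have hfin : 8 * W * g ^ 2 * (-(g * g2) + 2 * g1 ^ 2)
      = (-1 + 2 * S) * g ^ 4 + 3 * ((x ^ 2 - 4 * D ^ 2 * g ^ 4) / (8 * W)) := by
    field_simp
    linear_combination (-8 * W * g ^ 2) * h2 + (24 * W * g * g1 + 6 * g ^ 2 * D + 3 * x) * h1
  have hT : -(g2 / g) + 2 * g1 ^ 2 / g ^ 2
      = (-1 + 2 * S) / (8 * W) + 3 / (16 * W) * (16 * x ^ 4 * (z ^ 4 - z ^ 2) - D ^ 2 / W) := by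
    have e : g ^ 4 = (x ^ 2 - 1) / (4 * W) := by
      field_simp; linear_combination hE
    have hr : 16 * x ^ 4 * (z ^ 4 - z ^ 2) = x ^ 2 / (x ^ 2 - 1) := by
      field_simp; linear_combination hc
    have h3 := hfin
    have h4 : 8 * W * g ^ 2 * (-(g * g2) + 2 * g1 ^ 2)
      = 2 * (x ^ 2 - 1) * (-(g2 / g) + 2 * g1 ^ 2 / g ^ 2) := by
      rw [← hE]; linear_combination -2 * hb
    rw [h4, e] at h3
    have h5 : 2 * (x ^ 2 - 1) ≠ 0 := by simp [hxx]
    apply mul_left_cancel₀ h5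
    rw [h3, hr]
    field_simp
    ring
  have hsp : -(x ^ 2 + 1) ^ 2 / (z ^ 2 - 1) - g2 / g + 2 * g1 ^ 2 / g ^ 2
      = -(x ^ 2 + 1) ^ 2 / (z ^ 2 - 1) + (-(g2 / g) + 2 * g1 ^ 2 / g ^ 2) := by ring
  have hD' : D ^ 2 / W = 4 * (3 * z ^ 2 - 1) ^ 2 := by
    rw [hW, hD]; field_simp; ring
  have h6 : x ^ 4 = x ^ 2 + 1 / (16 * (z ^ 2 * (z ^ 2 - 1))) := by
    field_simp; linear_combination hc
  rw [hsp, hT, hD', show (x ^ 2 + 1) ^ 2 = x ^ 4 + 2 * x ^ 2 + 1 by ring, h6, hW, hS]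
  field_simp
  ring

theorem chudnovsky_one_lemniscatic_automorphism
    (U V : Set ℂ) (hU : IsOpen U) (hV : IsOpen V)
    (hUne : ∀ z ∈ U, z * (z - 1) * (z + 1) ≠ 0)
    (x g ψ : ℂ → ℂ)
    (hx1 : ∀ z ∈ U, DifferentiableAt ℂ x z)
    (hx2 : ∀ z ∈ U, DifferentiableAt ℂ (deriv x) z)
    (hx3 : ∀ z ∈ U, DifferentiableAt ℂ (deriv (deriv x)) z)
    (hcurve : ∀ z ∈ U, 16 * (x z ^ 4 - x z ^ 2) * (z ^ 4 - z ^ 2) = 1)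
    (hxne : ∀ z ∈ U, x z * (x z - 1) * (x z + 1) ≠ 0)
    (hxV : ∀ z ∈ U, x z ∈ V)
    (hψ : SolvesOn Q₁ ψ V)
    (hg1 : ∀ z ∈ U, DifferentiableAt ℂ g z)
    (hg2 : ∀ z ∈ U, DifferentiableAt ℂ (deriv g) z)
    (hgne : ∀ z ∈ U, g z ≠ 0)
    (hgsq : ∀ z ∈ U, g z ^ 2 = deriv x z) :
    SolvesOn Q₁ (fun z => ψ (x z) / g z) U := by
  obtain ⟨hψ1, hψ2, hψ3⟩ := hψ
  have dx : ∀ z ∈ U, HasDerivAt x (g z ^ 2) z := fun z hz => by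
    rw [hgsq z hz]; exact (hx1 z hz).hasDerivAt
  have dg : ∀ z ∈ U, HasDerivAt g (deriv g z) z := fun z hz => (hg1 z hz).hasDerivAt
  have dg' : ∀ z ∈ U, HasDerivAt (deriv g) (deriv (deriv g) z) z :=
    fun z hz => (hg2 z hz).hasDerivAt
  have dW : ∀ z : ℂ, HasDerivAt (fun z : ℂ => z ^ 2 * (z ^ 2 - 1) ^ 2)
      (6 * z ^ 5 - 8 * z ^ 3 + 2 * z) z := fun z => by
    have h := (hasDerivAt_pow 2 z).mul (((hasDerivAt_pow 2 z).sub_const 1).pow 2)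
    refine HasDerivAt.congr_deriv h ?_
    simp; ring
  have dW' : ∀ z : ℂ, HasDerivAt (fun z : ℂ => 6 * z ^ 5 - 8 * z ^ 3 + 2 * z)
      (30 * z ^ 4 - 24 * z ^ 2 + 2) z := fun z => by
    have h := (((hasDerivAt_pow 5 z).const_mul 6).sub ((hasDerivAt_pow 3 z).const_mul 8)).add
      ((hasDerivAt_id z).const_mul 2)
    refine HasDerivAt.congr_deriv h ?_
    simp; ring
  -- first derivative of the curve
  have c1 : ∀ z ∈ U, (4 * x z ^ 3 - 2 * x z) * g z ^ 2 * (z ^ 4 - z ^ 2)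
      + (x z ^ 4 - x z ^ 2) * (4 * z ^ 3 - 2 * z) = 0 := fun z hz => by
    have h := eqOn_deriv_aux hU hcurve hz
      (((((dx z hz).pow 4).sub ((dx z hz).pow 2)).const_mul 16).mul
        ((hasDerivAt_pow 4 z).sub (hasDerivAt_pow 2 z))) (hasDerivAt_const z 1)
    simp at h
    linear_combination h / 16
  have c2 : ∀ z ∈ U, (12 * x z ^ 2 - 2) * g z ^ 4 * (z ^ 4 - z ^ 2)
      + (4 * x z ^ 3 - 2 * x z) * (2 * g z * deriv g z) * (z ^ 4 - z ^ 2)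
      + 2 * (4 * x z ^ 3 - 2 * x z) * g z ^ 2 * (4 * z ^ 3 - 2 * z)
      + (x z ^ 4 - x z ^ 2) * (12 * z ^ 2 - 2) = 0 := fun z hz => by
    have h := eqOn_deriv_aux hU c1 hz
      ((((((((dx z hz).pow 3).const_mul 4).sub ((dx z hz).const_mul 2)).mul ((dg z hz).pow 2)).mul
        ((hasDerivAt_pow 4 z).sub (hasDerivAt_pow 2 z)))).add
        ((((dx z hz).pow 4).sub ((dx z hz).pow 2)).mul
          (((hasDerivAt_pow 3 z).const_mul 4).sub ((hasDerivAt_id z).const_mul 2))))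
      (hasDerivAt_const z 0)
    simp at h
    linear_combination h
  have hE : ∀ z ∈ U, 4 * g z ^ 4 * (z ^ 2 * (z ^ 2 - 1) ^ 2) = x z ^ 2 - 1 := fun z hz => by
    have h0 := hcurve z hz
    have h1 := c1 z hz
    have h2 := c2 z hz
    have hzn := hUne z hz
    have hxn := hxne z hz
    generalize x z = X at *
    generalize g z = G at *
    generalize deriv g z = G1 at *
    have hz0 : z ≠ 0 := by rintro rfl; simp at hzn
    have hX0 : X ≠ 0 := by rintro rfl; simp at hxn
    have hZ : z ^ 4 - z ^ 2 ≠ 0 := by intro h; simp [h] at h0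
    have key : (2 * X ^ 2 - 1) ^ 2 * (4 * (z ^ 4 - z ^ 2)) = (2 * z ^ 2 - 1) ^ 2 := by
      linear_combination h0
    by_cases hn : 2 * X ^ 2 - 1 = 0
    · have hm : 2 * z ^ 2 - 1 = 0 := by
        rw [hn] at key; simpa using key.symm
      have hX2 : X ^ 2 = 1 / 2 := by linear_combination hn / 2
      have hz2 : z ^ 2 = 1 / 2 := by linear_combination hm / 2
      have a1 : 4 * X ^ 3 - 2 * X = 0 := by linear_combination 2 * X * hn
      rw [a1, show X ^ 4 = (X ^ 2) ^ 2 by ring, show z ^ 4 = (z ^ 2) ^ 2 by ring, hX2, hz2] at h2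
      rw [hX2, hz2]
      linear_combination -h2 / 2
    · have hq : X ^ 2 * (2 * X ^ 2 - 1) ^ 2 * (z ^ 4 - z ^ 2) ^ 2 * 4 ≠ 0 := by simp [*]
      have hsq : (2 * X * (2 * X ^ 2 - 1) * G ^ 2 * (z ^ 4 - z ^ 2)) ^ 2
          = ((X ^ 4 - X ^ 2) * (2 * z * (2 * z ^ 2 - 1))) ^ 2 := by
        have : 2 * X * (2 * X ^ 2 - 1) * G ^ 2 * (z ^ 4 - z ^ 2)
          = - ((X ^ 4 - X ^ 2) * (2 * z * (2 * z ^ 2 - 1))) := by linear_combination h1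
        rw [this]; ring
      have hF : X ^ 2 * G ^ 4 * (z ^ 4 - z ^ 2) = 4 * (X ^ 4 - X ^ 2) ^ 2 * z ^ 2 := by
        have hne : 4 * (2 * X ^ 2 - 1) ^ 2 * (z ^ 4 - z ^ 2) ≠ 0 := by simp [*]
        apply mul_left_cancel₀ hne
        linear_combination hsq - 4 * (X ^ 4 - X ^ 2) ^ 2 * z ^ 2 * key
      have hne : X ^ 2 * z ^ 2 ≠ 0 := by simp [*]
      apply mul_left_cancel₀ hne
      linear_combination 4 * (z ^ 4 - z ^ 2) * hF + z ^ 2 * (X ^ 4 - X ^ 2) * h0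
  have e1 : ∀ z ∈ U, 8 * (g z * deriv g z) * (z ^ 2 * (z ^ 2 - 1) ^ 2)
      + 2 * g z ^ 2 * (6 * z ^ 5 - 8 * z ^ 3 + 2 * z) = x z := fun z hz => by
    have h := eqOn_deriv_aux hU hE hz ((((dg z hz).pow 4).const_mul 4).mul (dW z))
      (((dx z hz).pow 2).sub_const 1)
    simp at h
    have : g z ^ 2 ≠ 0 := pow_ne_zero _ (hgne z hz)
    apply mul_left_cancel₀ this
    linear_combination h / 2
  have e2 : ∀ z ∈ U, 8 * deriv g z ^ 2 * (z ^ 2 * (z ^ 2 - 1) ^ 2)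
      + 8 * (g z * deriv (deriv g) z) * (z ^ 2 * (z ^ 2 - 1) ^ 2)
      + 12 * (g z * deriv g z) * (6 * z ^ 5 - 8 * z ^ 3 + 2 * z)
      + 2 * g z ^ 2 * (30 * z ^ 4 - 24 * z ^ 2 + 2) = g z ^ 2 := fun z hz => by
    have h := eqOn_deriv_aux hU e1 hz
      (((((dg z hz).mul (dg' z hz)).const_mul 8).mul (dW z)).add
        ((((dg z hz).pow 2).const_mul 2).mul (dW' z))) (dx z hz)
    simp at h
    linear_combination h
  have dψ : ∀ z ∈ U, HasDerivAt (fun z => ψ (x z)) (deriv ψ (x z) * g z ^ 2) z := fun z hz =>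
    (hψ1 _ (hxV z hz)).hasDerivAt.comp z (dx z hz)
  have dψ' : ∀ z ∈ U, HasDerivAt (fun z => deriv ψ (x z)) (Q₁ (x z) * ψ (x z) * g z ^ 2) z :=
    fun z hz => by
      rw [← hψ3 _ (hxV z hz)]
      exact (hψ2 _ (hxV z hz)).hasDerivAt.comp z (dx z hz)
  have dΦ : ∀ z ∈ U, HasDerivAt (fun z => ψ (x z) / g z)
      (deriv ψ (x z) * g z - ψ (x z) * deriv g z / g z ^ 2) z := fun z hz => by
    have hg := hgne z hz
    refine HasDerivAt.congr_deriv ((dψ z hz).div (dg z hz) hg) ?_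
    field_simp
  have dΦ' : ∀ z ∈ U, HasDerivAt (deriv (fun z => ψ (x z) / g z))
      (Q₁ z * (ψ (x z) / g z)) z := fun z hz => by
    have hg := hgne z hz
    have he : deriv (fun z => ψ (x z) / g z) =ᶠ[nhds z]
        fun z => deriv ψ (x z) * g z - ψ (x z) * deriv g z / g z ^ 2 := by
      filter_upwards [hU.mem_nhds hz] with w hw using (dΦ w hw).deriv
    refine HasDerivAt.congr_of_eventuallyEq ?_ he
    have hzn := hUne z hz
    have hxn := hxne z hz
    simp only [mul_ne_zero_iff] at hzn hxn
    rw [← alg_final z (x z) (g z) (deriv g z) (deriv (deriv g) z) hzn.1.1 hzn.1.2 hzn.2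
      hxn.1.1 hxn.1.2 hxn.2 hg (hcurve z hz) (hE z hz) (e1 z hz) (e2 z hz)]
    refine HasDerivAt.congr_deriv (((dψ' z hz).mul (dg z hz)).sub
      (((dψ z hz).mul (dg' z hz)).div ((dg z hz).pow 2) (pow_ne_zero 2 hg))) ?_
    simp
    field_simp
    ring
  exact ⟨fun z hz => (dΦ z hz).differentiableAt, fun z hz => (dΦ' z hz).differentiableAt,
    fun z hz => (dΦ' z hz).deriv⟩
end

section
/- Let ε := exp(2πi/3) and let θ : ℂ → ℂ be the Jacobi theta-constant θ(τ) = ∑_{n∈ℤ} exp(πi·n²·τ) (Mathlib's jacobiTheta). Define T : ℂ → ℂ by T(τ) := ε·(i·θ(τ)² + √3·θ(3τ)²)/(i·θ(τ)² − √3·θ(3τ)²). Then for every τ ∈ ℂ with Im τ > 0 and i·θ(τ)² − √3·θ(3τ)² ≠ 0, one has T'''(τ)·T'(τ) − (3/2)·T''(τ)² = −18·T(τ)⁴/(T(τ)⁶ − 1)²·T'(τ)⁴, where primes denote iterated complex derivatives; equivalently, T satisfies the Schwarzian equation {T, τ}/T'(τ)² = −18T⁴/(T⁶−1)². -/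
open Complex

/-- The Hauptmodul of Example 2 of the paper, built from Jacobi theta-constants. -/
noncomputable def hauptT (τ : ℂ) : ℂ :=
  Complex.exp (2 * Real.pi * Complex.I / 3) *
    (Complex.I * jacobiTheta τ ^ 2 + (Real.sqrt 3 : ℂ) * jacobiTheta (3 * τ) ^ 2) /
    (Complex.I * jacobiTheta τ ^ 2 - (Real.sqrt 3 : ℂ) * jacobiTheta (3 * τ) ^ 2)

section helpers
open UpperHalfPlane hiding I
open Filter Topology ModularForm MatrixGroups



def HH : Set ℂ := {z : ℂ | 0 < z.im}

def BddInf (f : ℂ → ℂ) : Prop := ∃ M C : ℝ, ∀ z : ℂ, M ≤ z.im → ‖f z‖ ≤ C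

lemma isOpen_HH : IsOpen HH := isOpen_lt continuous_const continuous_im

lemma conv_HH : Convex ℝ HH := convex_halfSpace_im_gt 0

lemma HH_S {z : ℂ} (hz : z ∈ HH) : -1 / z ∈ HH := by
  have : 0 < z.im := hz
  have h0 : z ≠ 0 := by rintro rfl; simp at this
  show 0 < (-1 / z).im
  rw [neg_div, one_div, neg_im, inv_im, neg_div, neg_neg]
  exact div_pos this (normSq_pos.2 h0)

lemma HH_ne {z : ℂ} (hz : z ∈ HH) : z ≠ 0 := by
  have : 0 < z.im := hz
  rintro rfl; simp at this

lemma HH_add {z : ℂ} (hz : z ∈ HH) (x : ℝ) : z + x ∈ HH := by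
  have : 0 < z.im := hz
  simpa [HH] using this

lemma const_of_finite {f : ℂ → ℂ} (hf : ContinuousOn f HH) {s : Set ℂ} (hs : s.Finite)
    (h : ∀ z ∈ HH, f z ∈ s) : ∀ z ∈ HH, ∀ w ∈ HH, f z = f w := by
  intro z hz w hw
  have h1 : IsPreconnected (f '' HH) := conv_HH.isPreconnected.image f hf
  have h2 : (f '' HH).Finite := hs.subset (by rintro _ ⟨z, hz, rfl⟩; exact h z hz)
  have h3 : (f '' HH).Subsingleton := h2.countable.isTotallyDisconnected _ subset_rfl h1
  exact h3 ⟨z, hz, rfl⟩ ⟨w, hw, rfl⟩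

lemma levelOne_const {F : ℂ → ℂ} (hd : DifferentiableOn ℂ F HH)
    (hS : ∀ z ∈ HH, F (-1 / z) = F z) (hT : ∀ z ∈ HH, F (z + 1) = F z) (hb : BddInf F) :
    ∀ z ∈ HH, ∀ w ∈ HH, F z = F w := by
  have hSl : (F ∘ (↑) : ℍ → ℂ) ∣[(0 : ℤ)] ModularGroup.S = (F ∘ (↑) : ℍ → ℂ) := by
    ext z
    rw [ModularForm.SL_slash_apply, UpperHalfPlane.modular_S_smul]
    have := hS z z.2
    have e : -1 / (z : ℂ) = (-z : ℂ)⁻¹ := by rw [← inv_neg_one]; field_simp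
    rw [e] at this
    simpa using this
  have hTl : (F ∘ (↑) : ℍ → ℂ) ∣[(0 : ℤ)] ModularGroup.T = (F ∘ (↑) : ℍ → ℂ) := by
    ext z
    rw [ModularForm.SL_slash_apply, UpperHalfPlane.modular_T_smul]
    have := hT z z.2
    simpa [add_comm] using this
  have hall := SlashInvariantForm.slash_action_generators_SL2Z hSl hTl
  let f : ModularForm 𝒮ℒ 0 :=
    { toFun := F ∘ (↑)
      slash_action_eq' := by
        rintro A ⟨A, rfl⟩
        exact hall A
      holo' := by
        rw [UpperHalfPlane.mdifferentiable_iff]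
        refine hd.congr fun z hz ↦ ?_
        simp [ofComplex_apply_of_im_pos hz]
      bdd_at_cusps' := by
        intro c hc
        rw [Subgroup.IsArithmetic.isCusp_iff_isCusp_SL2Z] at hc
        rw [OnePoint.isBoundedAt_iff_forall_SL2Z hc]
        intro γ _
        rw [hall]
        rw [UpperHalfPlane.isBoundedAtImInfty_iff]
        obtain ⟨M, C, h⟩ := hb
        exact ⟨C, M, fun z hz => h z hz⟩ }
  obtain ⟨c, hc⟩ := ModularFormClass.levelOne_weight_zero_const f
  have key : ∀ z ∈ HH, F z = c := fun z hz => congrFun hc ⟨z, hz⟩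
  intro z hz w hw
  rw [key z hz, key w hw]

lemma family_const {ι : Type} [Fintype ι] (g : ι → ℂ → ℂ)
    (hd : ∀ i, DifferentiableOn ℂ (g i) HH) (s t : Equiv.Perm ι)
    (hS : ∀ i, ∀ z ∈ HH, g i (-1 / z) = g (s i) z)
    (hT : ∀ i, ∀ z ∈ HH, g i (z + 1) = g (t i) z) (hb : ∀ i, BddInf (g i)) (i : ι) :
    ∀ z ∈ HH, ∀ w ∈ HH, g i z = g i w := by
  classical
  have key : ∀ z0 ∈ HH, ∀ z ∈ HH, ∃ k, g k z = g i z0 := by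
    intro z0 hz0 z hz
    have := levelOne_const (F := fun z => ∏ k, (g k z - g i z0)) ?_ ?_ ?_ ?_ z hz z0 hz0
    · have h0 : ∏ k, (g k z0 - g i z0) = 0 := Finset.prod_eq_zero (Finset.mem_univ i) (sub_self _)
      simp only [h0] at this
      obtain ⟨k, -, hk⟩ := Finset.prod_eq_zero_iff.1 this
      exact ⟨k, sub_eq_zero.1 hk⟩
    · apply DifferentiableOn.fun_finsetProd
      exact fun k _ => (hd k).sub_const _
    · intro z hz
      simp_rw [hS _ z hz]
      exact Equiv.prod_comp s (fun k => g k z - g i z0)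
    · intro z hz
      simp_rw [hT _ z hz]
      exact Equiv.prod_comp t (fun k => g k z - g i z0)
    · choose M C h using hb
      refine ⟨∑ k, |M k|, ∏ k, (C k + ‖g i z0‖), fun z hz => ?_⟩
      rw [norm_prod]
      refine Finset.prod_le_prod (fun _ _ => norm_nonneg _) fun k _ => ?_
      refine (norm_sub_le _ _).trans (by
        gcongr
        refine h k z (le_trans ?_ hz)
        exact (le_abs_self _).trans (Finset.single_le_sum (f := fun k => |M k|)
          (fun _ _ => abs_nonneg _) (Finset.mem_univ k)))
  have hI : I ∈ HH := by simp [HH]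
  refine const_of_finite (hd i).continuousOn (s := Set.range fun k => g k I) (Set.finite_range _) ?_
  intro z hz
  obtain ⟨k, hk⟩ := key z hz I hI
  exact ⟨k, hk⟩

lemma theta_family_const {ι : Type} [Fintype ι] (f : ι → ℂ → ℂ)
    (hd : ∀ i, DifferentiableOn ℂ (f i) HH) (s t : Equiv.Perm ι)
    (hS : ∀ i, ∀ z ∈ HH, f i (-1 / z) = f (s i) z)
    (hT : ∀ i, ∀ z ∈ HH, f i (z + 2) = f (t i) z) (hb : ∀ i, BddInf (f i))
    (hb1 : ∀ i, BddInf (fun z => f i (1 - 1 / z))) (i : ι) :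
    ∀ z ∈ HH, ∀ w ∈ HH, f i z = f i w := by
  have hT' : ∀ i, ∀ z ∈ HH, f i (z - 2) = f (t.symm i) z := by
    intro i z hz
    have := hT (t.symm i) (z - 2) (by simpa [sub_eq_add_neg] using HH_add hz (-2))
    simpa using this.symm
  let e : Equiv.Perm (Fin 3) := Equiv.swap 1 2
  let e' : Equiv.Perm (Fin 3) := Equiv.swap 0 1
  let g : ι × Fin 3 → ℂ → ℂ := fun k =>
    match k with
    | (i, 0) => f i
    | (i, 1) => fun z => f i (z + 1)
    | (i, 2) => fun z => f i (1 - 1 / z)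
  let S : ι × Fin 3 → ι × Fin 3 := fun k =>
    match k with
    | (i, 0) => (s i, 0)
    | (i, 1) => (i, 2)
    | (i, 2) => (i, 1)
  let S' : ι × Fin 3 → ι × Fin 3 := fun k =>
    match k with
    | (i, 0) => (s.symm i, 0)
    | (i, 1) => (i, 2)
    | (i, 2) => (i, 1)
  let T : ι × Fin 3 → ι × Fin 3 := fun k =>
    match k with
    | (i, 0) => (i, 1)
    | (i, 1) => (t i, 0)
    | (i, 2) => (t.symm (s i), 2)
  let T' : ι × Fin 3 → ι × Fin 3 := fun k =>
    match k with
    | (i, 1) => (i, 0)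
    | (i, 0) => (t.symm i, 1)
    | (i, 2) => (s.symm (t i), 2)
  let SE : Equiv.Perm (ι × Fin 3) := ⟨S, S',
    by rintro ⟨i, k⟩; fin_cases k <;> simp [S, S'],
    by rintro ⟨i, k⟩; fin_cases k <;> simp [S, S']⟩
  let TE : Equiv.Perm (ι × Fin 3) := ⟨T, T',
    by rintro ⟨i, k⟩; fin_cases k <;> simp [T, T'],
    by rintro ⟨i, k⟩; fin_cases k <;> simp [T, T']⟩
  refine family_const g ?_ SE TE ?_ ?_ ?_ (i, 0)
  · rintro ⟨i, k⟩
    fin_cases k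
    · exact hd i
    · refine (hd i).comp (by fun_prop) fun z hz => by simpa using HH_add hz 1
    · refine (hd i).comp (t := HH) (DifferentiableOn.sub (by fun_prop)
        (DifferentiableOn.div (by fun_prop) (by fun_prop) fun z hz => HH_ne hz)) fun z hz => ?_
      have := HH_add (HH_S hz) 1
      convert this using 1
      push_cast; ring
  · rintro ⟨i, k⟩ z hz
    fin_cases k
    · exact hS i z hz
    · show f i (-1 / z + 1) = f i (1 - 1 / z)
      congr 1; ring
    · show f i (1 - 1 / (-1 / z)) = f i (z + 1)
      congr 1
      have := HH_ne hz
      field_simp; ring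
  · rintro ⟨i, k⟩ z hz
    fin_cases k
    · rfl
    · show f i (z + 1 + 1) = f (t i) z
      rw [← hT i z hz]; congr 1; ring
    · show f i (1 - 1 / (z + 1)) = f (t.symm (s i)) (1 - 1 / z)
      have h1 : (1 - 1 / z) ∈ HH := by
        have := HH_add (HH_S hz) 1
        convert this using 1
        push_cast; ring
      rw [← hT' _ _ h1, ← hS]
      · congr 1
        have := HH_ne hz
        have h2 : z + 1 ≠ 0 := HH_ne (by simpa using HH_add hz 1)
        have h3 : 1 - 1 / z - 2 = - (z + 1) / z := by field_simp; ring
        rw [h3]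
        field_simp; ring
      · simpa [sub_eq_add_neg] using HH_add h1 (-2)
  · rintro ⟨i, k⟩
    fin_cases k
    · exact hb i
    · obtain ⟨M, C, h⟩ := hb i
      exact ⟨M, C, fun z hz => h _ (by simpa using hz)⟩
    · exact hb1 i


noncomputable def imInf : Filter ℂ := comap Complex.im atTop

def LTm (F : ℂ → ℂ) (a : ℝ) (L : ℂ) : Prop :=
  Tendsto (fun z => F z * cexp (-(Real.pi * I * a * z))) imInf (𝓝 L)

lemma imInf_ev (M : ℝ) : ∀ᶠ z in imInf, M ≤ z.im := tendsto_comap.eventually_ge_atTop M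

lemma imInf_HH : ∀ᶠ z in imInf, z ∈ HH := tendsto_comap.eventually_gt_atTop 0

instance imInf_neBot : imInf.NeBot := by
  refine comap_neBot_iff.2 fun t ht => ?_
  obtain ⟨x, hx⟩ := (mem_atTop_sets.1 ht)
  exact ⟨x * I, by simpa using hx x le_rfl⟩

lemma imInf_exists {P : ℂ → Prop} (h : ∀ᶠ z in imInf, P z) : ∃ M : ℝ, ∀ z, M ≤ z.im → P z := by
  obtain ⟨t, ht, h⟩ := h
  obtain ⟨x, hx⟩ := (mem_atTop_sets.1 ht)
  exact ⟨x, fun z hz => h (hx _ hz)⟩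

lemma LTm.mul {F G a b L M} (hF : LTm F a L) (hG : LTm G b M) :
    LTm (fun z => F z * G z) (a + b) (L * M) := by
  refine (Tendsto.mul hF hG).congr fun z => ?_
  rw [mul_mul_mul_comm, ← Complex.exp_add]
  congr 2; push_cast; ring

lemma LTm.pow {F a L} (hF : LTm F a L) (n : ℕ) : LTm (fun z => F z ^ n) (n * a) (L ^ n) := by
  refine (Tendsto.pow hF n).congr fun z => ?_
  rw [mul_pow, ← Complex.exp_nat_mul]
  congr 2; push_cast; ring

lemma LTm.add {F G a L M} (hF : LTm F a L) (hG : LTm G a M) :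
    LTm (fun z => F z + G z) a (L + M) := by
  refine (Tendsto.add hF hG).congr fun z => ?_
  ring

lemma LTm.sub {F G a L M} (hF : LTm F a L) (hG : LTm G a M) :
    LTm (fun z => F z - G z) a (L - M) := by
  refine (Tendsto.sub hF hG).congr fun z => ?_
  ring

lemma LTm.cmul {F a L} (hF : LTm F a L) (c : ℂ) : LTm (fun z => c * F z) a (c * L) := by
  refine (Tendsto.const_mul c hF).congr fun z => ?_
  ring

lemma LTm.one : LTm (fun _ => 1) 0 1 := by
  simp [LTm]

lemma tendsto_exp_imInf {d : ℝ} (hd : 0 < d) :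
    Tendsto (fun z : ℂ => cexp (Real.pi * I * d * z)) imInf (𝓝 0) := by
  rw [tendsto_zero_iff_norm_tendsto_zero]
  have : Tendsto (fun y : ℝ => Real.exp (-(Real.pi * d * y))) atTop (𝓝 0) :=
    Real.tendsto_exp_neg_atTop_nhds_zero.comp (tendsto_id.const_mul_atTop (by positivity))
  refine (this.comp tendsto_comap).congr fun z => ?_
  simp [Complex.norm_exp]

lemma LTm.lower {F a L} (hF : LTm F a L) {b : ℝ} (hb : b < a) : LTm F b 0 := by
  have := Tendsto.mul hF (tendsto_exp_imInf (sub_pos.2 hb))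
  rw [mul_zero] at this
  refine this.congr fun z => ?_
  rw [mul_assoc, ← Complex.exp_add]
  congr 2; push_cast; ring

lemma LTm.comp {F a L} (hF : LTm F a L) {r : ℝ} (hr : 0 < r) :
    LTm (fun z => F (r * z)) (r * a) L := by
  have : Tendsto (fun z : ℂ => (r : ℂ) * z) imInf imInf := by
    refine tendsto_comap_iff.2 ?_
    have : Tendsto (fun z : ℂ => r * z.im) imInf atTop := tendsto_comap.const_mul_atTop hr
    refine this.congr fun z => by simp
  refine (Tendsto.comp hF this).congr fun z => ?_
  simp only [Function.comp]
  congr 3; push_cast; ring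

lemma LTm.comp_add {F a L} (hF : LTm F a L) (r : ℝ) :
    LTm (fun z => F (z + r)) a (cexp (Real.pi * I * a * r) * L) := by
  have : Tendsto (fun z : ℂ => z + (r : ℂ)) imInf imInf := by
    refine tendsto_comap_iff.2 ?_
    refine tendsto_comap.congr fun z => by simp
  refine ((Tendsto.comp hF this).const_mul _).congr fun z => ?_
  simp only [Function.comp]
  rw [mul_left_comm, ← Complex.exp_add]
  congr 2; ring

lemma deriv_tendsto_zero {g : ℂ → ℂ} (hd : DifferentiableOn ℂ g HH)
    (h : Tendsto g imInf (𝓝 0)) : Tendsto (deriv g) imInf (𝓝 0) := by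
  rw [Metric.tendsto_nhds] at h ⊢
  intro ε hε
  obtain ⟨M, hM⟩ := imInf_exists (h (ε / 2) (by positivity))
  filter_upwards [imInf_ev (max M 1 + 1)] with z hz
  have him : ∀ w ∈ Metric.closedBall z 1, max M 1 ≤ w.im := by
    intro w hw
    have h1 : |(w - z).im| ≤ 1 := (Complex.abs_im_le_norm _).trans (by simpa [Complex.dist_eq] using hw)
    rw [sub_im, abs_le] at h1
    linarith [h1.1]
  have := Complex.norm_deriv_le_of_forall_mem_sphere_norm_le (c := z) (R := 1) (C := ε / 2)
    (f := g) one_pos ?_ ?_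
  · simp only [dist_zero_right]
    linarith
  · refine DifferentiableOn.diffContOnCl_ball (U := HH) hd fun w hw => ?_
    have := him w hw
    show 0 < w.im
    linarith [le_max_right M 1]
  · intro w hw
    have := hM w ((le_max_left M 1).trans (him w (Metric.sphere_subset_closedBall hw)))
    simp only [dist_zero_right] at this
    exact this.le

lemma LTm.deriv {F a L} (hF : LTm F a L) (hd : DifferentiableOn ℂ F HH) :
    LTm (deriv F) a (Real.pi * I * a * L) := by
  have hde : Differentiable ℂ (fun z : ℂ => cexp (-(Real.pi * I * a * z))) := by fun_prop
  have h1 := deriv_tendsto_zero (g := fun z => F z * cexp (-(Real.pi * I * a * z)) - L)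
    ((hd.mul hde.differentiableOn).sub_const _) (by simpa using Tendsto.sub_const hF L)
  have h2 := h1.add (Tendsto.const_mul (Real.pi * I * a) hF)
  rw [zero_add] at h2
  refine h2.congr' ?_
  filter_upwards [imInf_HH] with z hz
  have e1 : HasDerivAt (fun z : ℂ => cexp (-(Real.pi * I * a * z)))
      (cexp (-(Real.pi * I * a * z)) * (-(Real.pi * I * a * 1))) z :=
    (((hasDerivAt_id z).const_mul (Real.pi * I * a)).neg).cexp
  have e2 := (((hd.differentiableAt (isOpen_HH.mem_nhds hz)).hasDerivAt.mul e1).sub_const L).deriv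
  simp only [Pi.mul_def] at e2
  rw [e2]
  ring

lemma LTm.div {F G a b L M} (hF : LTm F a L) (hG : LTm G b M) (hM : M ≠ 0) (hab : a = b) :
    Tendsto (fun z => F z / G z) imInf (𝓝 (L / M)) := by
  subst hab
  refine (Tendsto.div hF hG hM).congr fun z => ?_
  simp only [Pi.div_apply]
  rw [mul_div_mul_right _ _ (Complex.exp_ne_zero _)]

lemma bdd_of_tendsto {F : ℂ → ℂ} {L : ℂ} (h : Tendsto F imInf (𝓝 L)) : BddInf F := by
  have : ∀ᶠ z in imInf, ‖F z‖ ≤ ‖L‖ + 1 := h.norm.eventually_le_const (by linarith)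
  obtain ⟨M, hM⟩ := imInf_exists this
  exact ⟨M, _, hM⟩

lemma BddInf.congr {F G : ℂ → ℂ} (h : BddInf F) (hFG : ∀ z ∈ HH, F z = G z) : BddInf G := by
  obtain ⟨M, C, h⟩ := h
  refine ⟨max M 1, C, fun z hz => ?_⟩
  rw [← hFG z (show 0 < z.im by linarith [le_max_right M 1])]
  exact h z ((le_max_left _ _).trans hz)

lemma LTm.congr {F G : ℂ → ℂ} {a b L M} (h : LTm F a L) (hFG : ∀ z ∈ HH, F z = G z) (hab : a = b)
    (hLM : L = M) : LTm G b M := by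
  subst hab hLM
  refine Tendsto.congr' ?_ h
  filter_upwards [imInf_HH] with z hz
  rw [hFG z hz]

lemma const_eq_lim {F : ℂ → ℂ} {L : ℂ} (hc : ∀ z ∈ HH, ∀ w ∈ HH, F z = F w)
    (h : Tendsto F imInf (𝓝 L)) : ∀ z ∈ HH, F z = L := by
  intro z hz
  refine tendsto_nhds_unique (tendsto_const_nhds.congr' ?_) h
  filter_upwards [imInf_HH] with w hw using hc z hz w hw

/-- transformation of derivatives under `z ↦ a - 1/z` -/
lemma weight_one_deriv {X Y : ℂ → ℂ} (hX : DifferentiableOn ℂ X HH) (hY : DifferentiableOn ℂ Y HH)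
    {a : ℝ} {c : ℂ} (h : ∀ z ∈ HH, X (a - 1 / z) = c * z * Y z) :
    ∀ z ∈ HH, deriv X (a - 1 / z) = c * (z ^ 2 * Y z + z ^ 3 * deriv Y z) := by
  intro z hz
  have h0 := HH_ne hz
  have hm : (a - 1 / z : ℂ) ∈ HH := by
    have := HH_add (HH_S hz) a
    convert this using 1; ring
  have e1 : HasDerivAt (fun z : ℂ => (a : ℂ) - 1 / z) (1 / z ^ 2) z := by
    have := ((hasDerivAt_inv h0).const_sub (a : ℂ))
    simp only [one_div]
    convert! this using 1
    simp
  have e2 := (hX.differentiableAt (isOpen_HH.mem_nhds hm)).hasDerivAt.comp z e1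
  have e3 := ((hasDerivAt_id z).const_mul c).mul
    (hY.differentiableAt (isOpen_HH.mem_nhds hz)).hasDerivAt
  have e4 : (X ∘ fun z : ℂ => (a : ℂ) - 1 / z) =ᶠ[𝓝 z] (fun z => c * z * Y z) := by
    filter_upwards [isOpen_HH.mem_nhds hz] with w hw using h w hw
  have e5 := (e2.congr_of_eventuallyEq e4.symm).unique e3
  simp only [id] at e5
  generalize hq : (a : ℂ) - 1 / z = q at e5 ⊢
  field_simp at e5
  rw [e5]; ring

lemma weight_one_deriv2 {X Y : ℂ → ℂ} (hX : DifferentiableOn ℂ X HH) (hY : DifferentiableOn ℂ Y HH)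
    {a : ℝ} {c : ℂ} (h : ∀ z ∈ HH, X (a - 1 / z) = c * z * Y z) :
    ∀ z ∈ HH, deriv (deriv X) (a - 1 / z) =
      c * (2 * z ^ 3 * Y z + 4 * z ^ 4 * deriv Y z + z ^ 5 * deriv (deriv Y) z) := by
  intro z hz
  have h0 := HH_ne hz
  have hX' := hX.deriv isOpen_HH
  have hY' := hY.deriv isOpen_HH
  have hm : (a - 1 / z : ℂ) ∈ HH := by
    have := HH_add (HH_S hz) a
    convert this using 1; ring
  have e1 : HasDerivAt (fun z : ℂ => (a : ℂ) - 1 / z) (1 / z ^ 2) z := by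
    have := ((hasDerivAt_inv h0).const_sub (a : ℂ))
    simp only [one_div]
    convert! this using 1
    simp
  have e2 := (hX'.differentiableAt (isOpen_HH.mem_nhds hm)).hasDerivAt.comp z e1
  have e3 := ((((hasDerivAt_id z).pow 2).mul
    (hY.differentiableAt (isOpen_HH.mem_nhds hz)).hasDerivAt).add (((hasDerivAt_id z).pow 3).mul
    (hY'.differentiableAt (isOpen_HH.mem_nhds hz)).hasDerivAt)).const_mul c
  have e4 : (deriv X ∘ fun z : ℂ => (a : ℂ) - 1 / z) =ᶠ[𝓝 z]
      (fun z => c * (z ^ 2 * Y z + z ^ 3 * deriv Y z)) := by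
    filter_upwards [isOpen_HH.mem_nhds hz] with w hw using weight_one_deriv hX hY h w hw
  have e5 := (e2.congr_of_eventuallyEq e4.symm).unique e3
  simp [id, -one_div] at e5
  generalize hq : (a : ℂ) - 1 / z = q at e5 ⊢
  field_simp at e5
  rw [e5]; ring


noncomputable def tA (z : ℂ) : ℂ := jacobiTheta z ^ 2

noncomputable def tC (z : ℂ) : ℂ := cexp (Real.pi * I * z / 2) * jacobiTheta₂ (z / 2) z ^ 2

lemma tA_diff : DifferentiableOn ℂ tA HH := fun z hz =>
  ((differentiableAt_jacobiTheta hz).pow 2).differentiableWithinAt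

lemma tC_diff : DifferentiableOn ℂ tC HH := by
  intro z hz
  have h1 := (hasFDerivAt_jacobiTheta₂ (z / 2) hz).differentiableAt
  have h2 : DifferentiableAt ℂ (fun w : ℂ => ((w / 2, w) : ℂ × ℂ)) z := by fun_prop
  have h3 : DifferentiableAt ℂ (fun w : ℂ => jacobiTheta₂ (w / 2) w) z :=
    DifferentiableAt.comp (f := fun w : ℂ => ((w / 2, w) : ℂ × ℂ))
      (g := fun p : ℂ × ℂ => jacobiTheta₂ p.1 p.2) z h1 h2
  have h4 : DifferentiableAt ℂ (fun w : ℂ => cexp (Real.pi * I * w / 2)) z := by fun_prop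
  exact (h4.mul (h3.pow 2)).differentiableWithinAt

lemma tA_add_two (z : ℂ) : tA (z + 2) = tA z := by
  rw [tA, add_comm, jacobiTheta_two_add, tA]

lemma cpow_half_sq (w : ℂ) : (w ^ (1 / 2 : ℂ)) ^ 2 = w := by
  rw [← cpow_nat_mul]; norm_num

lemma tA_S {z : ℂ} (hz : z ∈ HH) : tA (-1 / z) = -I * z * tA z := by
  have h0 := HH_ne hz
  have h := jacobiTheta₂_functional_equation 0 z
  have h2 : -I * z ≠ 0 := by simp [h0]
  have h3 : (-I * z) ^ (1 / 2 : ℂ) ≠ 0 := by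
    intro h; have := cpow_half_sq (-I * z); rw [h] at this; simp at this; exact h0 this
  simp only [tA, jacobiTheta_eq_jacobiTheta₂]
  rw [h]
  have := cpow_half_sq (-I * z)
  generalize (-I * z) ^ (1 / 2 : ℂ) = r at this h3 ⊢
  rw [← this, zero_div]
  generalize jacobiTheta₂ 0 (-1 / z) = j
  have e : -Real.pi * I * 0 ^ 2 / z = 0 := by simp
  rw [e, Complex.exp_zero]
  field_simp

lemma exp_pi_even {k : ℤ} (hk : Even k) : cexp (Real.pi * I * k) = 1 := by
  obtain ⟨m, rfl⟩ := hk
  rw [Complex.exp_eq_one_iff]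
  exact ⟨m, by push_cast; ring⟩

lemma theta_one_add (w : ℂ) : jacobiTheta (1 + w) = jacobiTheta₂ (1 / 2) w := by
  rw [jacobiTheta_eq_jacobiTheta₂]
  unfold jacobiTheta₂
  refine tsum_congr fun n => ?_
  unfold jacobiTheta₂_term
  have h : Even (n ^ 2 - n) := by
    have := Int.even_mul_pred_self n
    convert this using 1; ring
  have := exp_pi_even h
  have e : 2 * Real.pi * I * n * 0 + Real.pi * I * n ^ 2 * (1 + w) =
      Real.pi * I * (n ^ 2 - n : ℤ) + (2 * Real.pi * I * n * (1 / 2) + Real.pi * I * n ^ 2 * w) := by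
    push_cast; ring
  rw [e, Complex.exp_add, this, one_mul]

lemma tA_cusp {z : ℂ} (hz : z ∈ HH) : tA (1 - 1 / z) = -I * z * tC z := by
  have h0 := HH_ne hz
  have h := jacobiTheta₂_functional_equation (z / 2) z
  have h3 : (-I * z) ^ (1 / 2 : ℂ) ≠ 0 := by
    intro h; have := cpow_half_sq (-I * z); rw [h] at this; simp at this; exact h0 this
  have e : (1 - 1 / z : ℂ) = 1 + (-1 / z) := by ring
  simp only [tA, tC]
  rw [e, theta_one_add, h]
  have := cpow_half_sq (-I * z)
  generalize (-I * z) ^ (1 / 2 : ℂ) = r at this h3 ⊢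
  have e2 : z / 2 / z = 1 / 2 := by field_simp
  rw [e2, mul_pow, mul_pow, ← Complex.exp_nat_mul]
  have e3 : cexp (Real.pi * I * z / 2) * cexp ((2 : ℕ) * (-Real.pi * I * (z / 2) ^ 2 / z)) = 1 := by
    rw [← Complex.exp_add, Complex.exp_eq_one_iff]
    refine ⟨0, ?_⟩
    field_simp; push_cast; ring
  generalize cexp ((2 : ℕ) * (-Real.pi * I * (z / 2) ^ 2 / z)) = y at e3 ⊢
  generalize cexp (Real.pi * I * z / 2) = x at e3 ⊢
  generalize jacobiTheta₂ (1 / 2) (-1 / z) = j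
  rw [← this]
  field_simp
  linear_combination (-j ^ 2) * e3

lemma tC_add_one (z : ℂ) : tC (z + 1) = I * tC z := by
  have : jacobiTheta₂ ((z + 1) / 2) (z + 1) = jacobiTheta₂ (z / 2) z := by
    unfold jacobiTheta₂
    refine tsum_congr fun n => ?_
    unfold jacobiTheta₂_term
    have h : Even (n ^ 2 + n) := by
      have := Int.even_mul_succ_self n
      convert this using 1; ring
    have := exp_pi_even h
    have e : 2 * Real.pi * I * n * ((z + 1) / 2) + Real.pi * I * n ^ 2 * (z + 1) =
        Real.pi * I * (n ^ 2 + n : ℤ) + (2 * Real.pi * I * n * (z / 2) + Real.pi * I * n ^ 2 * z) := by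
      push_cast; ring
    rw [e, Complex.exp_add, this, one_mul]
  have e : Real.pi * I * (z + 1) / 2 = Real.pi / 2 * I + Real.pi * I * z / 2 := by ring
  rw [tC, this, tC, ← mul_assoc, e, Complex.exp_add, Complex.exp_pi_div_two_mul_I]

lemma dom_lim {ι : Type} (e : ι → ℕ) (hs : Summable fun n => Real.exp (-Real.pi * e n)) :
    Tendsto (fun z : ℂ => ∑' n, cexp (Real.pi * I * e n * z)) imInf
      (𝓝 (∑' n, if e n = 0 then 1 else 0)) := by
  refine tendsto_tsum_of_dominated_convergence hs ?_ ?_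
  · intro n
    split_ifs with h
    · simp [h]
    · exact_mod_cast tendsto_exp_imInf (d := e n) (by exact_mod_cast Nat.pos_of_ne_zero h)
  · filter_upwards [imInf_ev 1] with z hz n
    rw [Complex.norm_exp]
    simp
    have : 0 ≤ Real.pi * e n := by positivity
    nlinarith

lemma exp_nat_summable : Summable fun n : ℕ => Real.exp (-Real.pi * n) := by
  have h : Real.exp (-Real.pi) < 1 := by simp [Real.pi_pos]
  refine (summable_geometric_of_lt_one (Real.exp_pos _).le h).congr fun n => ?_
  rw [← Real.exp_nat_mul]; congr 1; ring

lemma theta_sub_one_LT : LTm (fun z => jacobiTheta z - 1) 1 2 := by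
  have hs : Summable fun n : ℕ => Real.exp (-Real.pi * ((n ^ 2 + 2 * n : ℕ) : ℝ)) := by
    refine Summable.of_nonneg_of_le (fun _ => (Real.exp_pos _).le) (fun n => ?_) exp_nat_summable
    refine Real.exp_le_exp.2 ?_
    have : (n : ℝ) ≤ ((n ^ 2 + 2 * n : ℕ) : ℝ) := by exact_mod_cast (by nlinarith)
    nlinarith [Real.pi_pos]
  have h := (dom_lim (fun n : ℕ => n ^ 2 + 2 * n) hs).const_mul 2
  have h1 : (∑' n : ℕ, if n ^ 2 + 2 * n = 0 then (1 : ℂ) else 0) = 1 := by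
    rw [tsum_eq_single 0]
    · simp
    · intro n hn; simp [hn]
  rw [h1, mul_one] at h
  refine h.congr' ?_
  filter_upwards [imInf_HH] with z hz
  have h2 := jacobiTheta_eq_tsum_nat hz
  rw [h2, add_sub_cancel_left, mul_assoc, ← tsum_mul_right]
  congr 1
  refine tsum_congr fun n => ?_
  rw [← Complex.exp_add]
  congr 1; push_cast; ring

lemma theta_two_LT : LTm (fun z => jacobiTheta₂ (z / 2) z) 0 2 := by
  have hnn : ∀ n : ℤ, 0 ≤ n ^ 2 + n := fun n => by
    rcases le_or_gt 0 n with h | h <;> nlinarith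
  have hs : Summable fun n : ℤ => Real.exp (-Real.pi * (((n ^ 2 + n).toNat : ℕ) : ℝ)) := by
    have := (summable_jacobiTheta₂_term_iff (I / 2) I).2 (by simp)
    refine this.norm.congr fun n => ?_
    rw [norm_jacobiTheta₂_term]
    congr 1
    have : (((n ^ 2 + n).toNat : ℕ) : ℝ) = (n : ℝ) ^ 2 + n := by
      exact_mod_cast congrArg (Int.cast : ℤ → ℝ) (Int.toNat_of_nonneg (hnn n))
    rw [this]; simp; ring
  have h := (dom_lim (fun n : ℤ => (n ^ 2 + n).toNat) hs)
  have h1 : (∑' n : ℤ, if (n ^ 2 + n).toNat = 0 then (1 : ℂ) else 0) = 2 := by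
    rw [tsum_eq_sum (s := {0, -1})]
    · rw [Finset.sum_pair (by norm_num)]; norm_num
    · intro n hn
      rw [if_neg]
      simp at hn ⊢
      rcases le_or_gt 0 n with h | h
      · have : 0 < n := by omega
        positivity
      · have : n ≤ -2 := by omega
        nlinarith
  rw [h1] at h
  refine h.congr fun z => ?_
  simp only [ofReal_zero, mul_zero, zero_mul, neg_zero, Complex.exp_zero, mul_one]
  unfold jacobiTheta₂
  refine tsum_congr fun n => ?_
  unfold jacobiTheta₂_term
  congr 1
  have : (((n ^ 2 + n).toNat : ℕ) : ℂ) = (n : ℂ) ^ 2 + n := by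
    exact_mod_cast congrArg (Int.cast : ℤ → ℂ) (Int.toNat_of_nonneg (hnn n))
  rw [this]; ring

lemma tC_LT : LTm tC (1 / 2) 4 := by
  refine (theta_two_LT.pow 2).congr (G := fun z => jacobiTheta₂ (z / 2) z ^ 2) (b := 0) (M := 4)
    (fun z _ => rfl) (by simp) (by norm_num) |>.congr' ?_ 
  refine Eventually.of_forall fun z => ?_
  simp only [tC]
  have e : cexp (Real.pi * I * z / 2) * cexp (-(Real.pi * I * ((1 / 2 : ℝ) : ℂ) * z)) = 1 := by
    rw [← Complex.exp_add, Complex.exp_eq_one_iff]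
    exact ⟨0, by push_cast; ring⟩
  rw [mul_right_comm (cexp _), e]
  simp

lemma tA_sub_one_LT : LTm (fun z => tA z - 1) 1 4 := by
  have h := theta_sub_one_LT
  have h1 : LTm (fun z => jacobiTheta z + 1) 0 2 :=
    ((h.lower (b := 0) one_pos).add (LTm.one.cmul 2)).congr (fun z _ => by ring) rfl (by norm_num)
  exact (h.mul h1).congr (fun z _ => by simp only [tA]; ring) (by norm_num) (by norm_num)

lemma tA_LT : LTm tA 0 1 :=
  ((tA_sub_one_LT.lower (b := 0) one_pos).add LTm.one).congr (fun z _ => by ring) rfl (by norm_num)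


noncomputable def tE (z : ℂ) : ℂ := tA z ^ 2 * tA (z + 1) ^ 2 * tC z ^ 2

lemma HH_add_one {z : ℂ} (hz : z ∈ HH) : z + 1 ∈ HH := by
  simpa using HH_add hz 1

lemma HH_add_two {z : ℂ} (hz : z ∈ HH) : z + 2 ∈ HH := by
  simpa using HH_add hz 2

lemma HH_cusp {z : ℂ} (hz : z ∈ HH) : 1 - 1 / z ∈ HH := by
  have := HH_add_one (HH_S hz)
  convert this using 1; ring

lemma tE_diff : DifferentiableOn ℂ tE HH := by
  have h : DifferentiableOn ℂ (fun z => tA (z + 1)) HH :=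
    tA_diff.comp (by fun_prop) fun z hz => HH_add_one hz
  exact ((tA_diff.pow 2).mul (h.pow 2)).mul (tC_diff.pow 2)

lemma tC_S {z : ℂ} (hz : z ∈ HH) : tC (-1 / z) = -I * z * tA (z + 1) := by
  have h0 := HH_ne hz
  have h := tA_cusp (HH_S hz)
  have e : 1 - 1 / (-1 / z) = z + 1 := by field_simp; ring
  rw [e] at h
  rw [h]
  generalize tC (-1 / z) = y
  field_simp
  simp

lemma tE_S {z : ℂ} (hz : z ∈ HH) : tE (-1 / z) = -z ^ 6 * tE z := by
  have e : -1 / z + 1 = 1 - 1 / z := by ring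
  rw [tE, tE, tA_S hz, e, tA_cusp hz, tC_S hz]
  have : I ^ 2 = -1 := I_sq
  have h6 : I ^ 6 = -1 := by rw [show 6 = 2 * 3 by norm_num, pow_mul, this]; norm_num
  linear_combination (z ^ 6 * tA z ^ 2 * tA (z + 1) ^ 2 * tC z ^ 2) * h6

lemma tE_add_one (z : ℂ) : tE (z + 1) = -tE z := by
  have e : z + 1 + 1 = z + 2 := by ring
  rw [tE, tE, tC_add_one, e, tA_add_two]
  linear_combination (tA z ^ 2 * tA (z + 1) ^ 2 * tC z ^ 2) * I_sq

lemma tE_add_two (z : ℂ) : tE (z + 2) = tE z := by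
  have e : z + 2 = z + 1 + 1 := by ring
  rw [e, tE_add_one, tE_add_one, neg_neg]

lemma tE_cusp {z : ℂ} (hz : z ∈ HH) : tE (1 - 1 / z) = z ^ 6 * tE z := by
  have e : 1 - 1 / z = -1 / z + 1 := by ring
  rw [e, tE_add_one, tE_S hz]; ring

lemma tE_LT : LTm tE 1 16 := by
  have h := tA_LT.comp_add 1
  simp only [ofReal_one, ofReal_zero, mul_zero, zero_mul, Complex.exp_zero, one_mul] at h
  exact (((tA_LT.pow 2).mul (h.pow 2)).mul (tC_LT.pow 2)).congr (fun z _ => rfl)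
    (by norm_num) (by norm_num)

lemma csq24 {z : ℂ} (hz : z ≠ 0) : Complex.sqrt z ^ 24 = z ^ 12 := by
  rw [sqrt_eq_exp hz, ← exp_nat_mul]
  ring_nf
  rw [show (log z * 12) = (12 : ℕ) * log z by push_cast; ring, exp_nat_mul, exp_log hz]

lemma delta_S {z : ℂ} (hz : z ∈ HH) :
    ModularForm.eta (-1 / z) ^ 24 = z ^ 12 * ModularForm.eta z ^ 24 := by
  have h : ModularForm.eta (-1 / z) = (Complex.sqrt I)⁻¹ * (Complex.sqrt z * ModularForm.eta z) := by
    simpa using eta_comp_eq_csqrt_I_inv hz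
  rw [h, mul_pow, mul_pow, inv_pow, csq24 I_ne_zero, csq24 (HH_ne hz),
    show (12 : ℕ) = 4 * 3 by norm_num, pow_mul I, I_pow_four]
  simp

lemma delta_T {z : ℂ} (hz : z ∈ HH) : ModularForm.eta (z + 1) ^ 24 = ModularForm.eta z ^ 24 := by
  have h1 := discriminant_eq_q_prod ⟨z, hz⟩
  have h2 := discriminant_eq_q_prod ⟨z + 1, HH_add_one hz⟩
  have e : Function.Periodic.qParam 1 (z + 1) = Function.Periodic.qParam 1 z := by
    simp only [Function.Periodic.qParam]
    rw [← Complex.exp_periodic (2 * Real.pi * I * z / (1 : ℝ))]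
    congr 1; push_cast; ring
  have e2 : ∀ n, eta_q n (z + 1) = eta_q n z := by
    intro n
    simp [eta_q, e]
  have h1' : ModularForm.eta z ^ 24 =
    Function.Periodic.qParam 1 z * ∏' n, (1 - eta_q n z) ^ 24 := h1
  have h2' : ModularForm.eta (z + 1) ^ 24 =
    Function.Periodic.qParam 1 (z + 1) * ∏' n, (1 - eta_q n (z + 1)) ^ 24 := h2
  rw [h1', h2', e]
  simp only [e2]

lemma delta_bd : ∃ M c : ℝ, 0 < c ∧ ∀ z ∈ HH, M ≤ z.im →
    Real.exp (-2 * Real.pi * z.im) ≤ c * ‖ModularForm.eta z ^ 24‖ := by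
  obtain ⟨c, hc, h⟩ := exp_isBigO_discriminant.exists_pos
  have h := h.bound
  obtain ⟨M, hM⟩ := (UpperHalfPlane.atImInfty_mem _).1 h
  refine ⟨M, c, hc, fun z hz hzM => ?_⟩
  have := hM ⟨z, hz⟩ hzM
  have h2 : ‖Real.exp (-2 * Real.pi * z.im)‖ ≤ c * ‖ModularForm.eta z ^ 24‖ := this
  rwa [Real.norm_of_nonneg (Real.exp_pos _).le] at h2

lemma tE_ne {z : ℂ} (hz : z ∈ HH) : tE z ≠ 0 := by
  have hd : DifferentiableOn ℂ (fun z => tE z ^ 2 / ModularForm.eta z ^ 24) HH := by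
    refine (tE_diff.pow 2).div (fun z hz => ?_) (fun z hz => pow_ne_zero _ (eta_ne_zero hz))
    exact ((differentiableAt_eta_of_mem_upperHalfPlaneSet hz).pow 24).differentiableWithinAt
  have hc := levelOne_const hd ?_ ?_ ?_
  · intro h
    have h2 : ∀ w ∈ HH, tE w = 0 := by
      intro w hw
      have := hc w hw z hz
      simp only [h] at this
      have h3 := eta_ne_zero hw
      simpa [h3] using this
    have h3 := tE_LT.congr (G := fun _ => 0) (b := 1) (M := 16) h2 rfl rfl
    have : Tendsto (fun _ : ℂ => (0 : ℂ)) imInf (𝓝 16) := by simp [LTm] at h3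
    have := tendsto_nhds_unique this tendsto_const_nhds
    norm_num at this
  · intro z hz
    have h0 := HH_ne hz
    have h1 := eta_ne_zero hz
    rw [tE_S hz, delta_S hz]
    field_simp
  · intro z hz
    rw [tE_add_one, delta_T hz, neg_sq]
  · obtain ⟨M, c, hc, h⟩ := delta_bd
    obtain ⟨M1, C1, h1⟩ := bdd_of_tendsto (tE_LT.pow 2)
    refine ⟨max (max M M1) 1, C1 * c, fun z hz => ?_⟩
    have hz0 : z ∈ HH := show 0 < z.im by linarith [le_max_right (max M M1) 1]
    have hz1 : M ≤ z.im := (le_max_left M M1).trans ((le_max_left _ 1).trans hz)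
    have hz2 : M1 ≤ z.im := (le_max_right M M1).trans ((le_max_left _ 1).trans hz)
    have a := h z hz0 hz1
    have b := h1 z hz2
    have hp : 0 < ‖ModularForm.eta z ^ 24‖ := norm_pos_iff.2 (pow_ne_zero _ (eta_ne_zero hz0))
    rw [norm_div, div_le_iff₀ hp]
    rw [norm_mul, Complex.norm_exp] at b
    have e : (-(Real.pi * I * (((2 : ℕ) * 1 : ℝ) : ℂ) * z)).re = 2 * Real.pi * z.im := by
      simp; left; ring
    rw [e] at b
    have e2 : Real.exp (2 * Real.pi * z.im) * Real.exp (-2 * Real.pi * z.im) = 1 := by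
      rw [← Real.exp_add]; simp
    have hC : 0 ≤ C1 := (by positivity : (0:ℝ) ≤ _).trans b
    calc ‖tE z ^ 2‖ = ‖tE z ^ 2‖ * Real.exp (2 * Real.pi * z.im) * Real.exp (-2 * Real.pi * z.im) := by
          rw [mul_assoc, e2, mul_one]
      _ ≤ C1 * (c * ‖ModularForm.eta z ^ 24‖) := by gcongr
      _ = _ := by ring

lemma tA_ne {z : ℂ} (hz : z ∈ HH) : tA z ≠ 0 := by
  intro h
  exact tE_ne hz (by simp [tE, h])


noncomputable def tb : Fin 4 → ℂ → ℂ :=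
  ![fun z => tA (3 * z), fun z => tA (z / 3) / 3, fun z => tA ((z + 2) / 3) / 3,
    fun z => tA ((z + 4) / 3) / 3]

def sP : Equiv.Perm (Fin 4) := ⟨![1, 0, 3, 2], ![1, 0, 3, 2], by decide, by decide⟩
def tP : Equiv.Perm (Fin 4) := ⟨![0, 2, 3, 1], ![0, 3, 1, 2], by decide, by decide⟩

lemma tb0 (z : ℂ) : tb 0 z = tA (3 * z) := rfl
lemma tb1 (z : ℂ) : tb 1 z = tA (z / 3) / 3 := rfl
lemma tb2 (z : ℂ) : tb 2 z = tA ((z + 2) / 3) / 3 := rfl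
lemma tb3 (z : ℂ) : tb 3 z = tA ((z + 4) / 3) / 3 := rfl

lemma HH_mul {z : ℂ} (hz : z ∈ HH) {r : ℝ} (hr : 0 < r) : r * z ∈ HH := by
  have : 0 < z.im := hz
  show 0 < (r * z).im
  simp; positivity

lemma HH_three {z : ℂ} (hz : z ∈ HH) : 3 * z ∈ HH := by
  simpa using HH_mul hz (r := 3) (by norm_num)

lemma HH_third {z : ℂ} (hz : z ∈ HH) : z / 3 ∈ HH := by
  have := HH_mul hz (r := 1 / 3) (by norm_num)
  convert this using 1; push_cast; ring

lemma HH_third2 {z : ℂ} (hz : z ∈ HH) : (z + 2) / 3 ∈ HH := HH_third (HH_add_two hz)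
lemma HH_third4 {z : ℂ} (hz : z ∈ HH) : (z + 4) / 3 ∈ HH := by
  have := HH_third (HH_add_two (HH_add_two hz))
  convert this using 1; ring

lemma tb_diff (i : Fin 4) : DifferentiableOn ℂ (tb i) HH := by
  fin_cases i
  · exact tA_diff.comp (f := fun z : ℂ => 3 * z) (by fun_prop) fun z hz => HH_three hz
  · exact (tA_diff.comp (f := fun z : ℂ => z / 3) (by fun_prop) fun z hz => HH_third hz).div_const 3
  · exact (tA_diff.comp (f := fun z : ℂ => (z + 2) / 3) (by fun_prop)
      fun z hz => HH_third2 hz).div_const 3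
  · exact (tA_diff.comp (f := fun z : ℂ => (z + 4) / 3) (by fun_prop)
      fun z hz => HH_third4 hz).div_const 3

lemma tb_ne (i : Fin 4) {z : ℂ} (hz : z ∈ HH) : tb i z ≠ 0 := by
  fin_cases i
  · exact tA_ne (HH_three hz)
  · exact div_ne_zero (tA_ne (HH_third hz)) (by norm_num)
  · exact div_ne_zero (tA_ne (HH_third2 hz)) (by norm_num)
  · exact div_ne_zero (tA_ne (HH_third4 hz)) (by norm_num)

lemma tb_T (i : Fin 4) (z : ℂ) : tb i (z + 2) = tb (tP i) z := by
  fin_cases i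
  · show tA (3 * (z + 2)) = tA (3 * z)
    rw [← tA_add_two (3 * z), ← tA_add_two (3 * z + 2), ← tA_add_two (3 * z + 2 + 2)]
    congr 1; ring
  · rfl
  · show tA ((z + 2 + 2) / 3) / 3 = tA ((z + 4) / 3) / 3
    congr 2; ring
  · show tA ((z + 2 + 4) / 3) / 3 = tA (z / 3) / 3
    rw [← tA_add_two (z / 3)]
    congr 2; ring

lemma HH_sub_two {z : ℂ} (hz : z ∈ HH) : z - 2 ∈ HH := by
  have := HH_add hz (-2)
  convert this using 1; push_cast; ring

lemma tb2_S {z : ℂ} (hz : z ∈ HH) : tb 2 (-1 / z) = I * z * tb 3 z := by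
  have h0 := HH_ne hz
  rw [tb2, tb3]
  obtain ⟨w, hw⟩ : ∃ w, w = (z + 4) / 3 := ⟨_, rfl⟩
  have hwH : w ∈ HH := hw ▸ HH_third4 hz
  have hz' : z = 3 * w - 4 := by rw [hw]; ring
  rw [← hw]
  have k1 := HH_sub_two hwH
  have k2 := HH_sub_two (HH_S k1)
  have k3 := HH_sub_two (HH_S k2)
  have n1 := HH_ne k1
  obtain ⟨x, hx⟩ : ∃ x, x = -1 / (w - 2) - 2 := ⟨_, rfl⟩
  rw [← hx] at k2 k3
  have n2 := HH_ne k2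
  obtain ⟨y, hy⟩ : ∃ y, y = -1 / x - 2 := ⟨_, rfl⟩
  rw [← hy] at k3
  have n3 := HH_ne k3
  have a1 := tA_S k3
  rw [← tA_add_two y, show y + 2 = -1 / x by rw [hy]; ring, tA_S k2, ← tA_add_two x,
    show x + 2 = -1 / (w - 2) by rw [hx]; ring, tA_S k1, ← tA_add_two (w - 2), sub_add_cancel] at a1
  have exw : x * (w - 2) = 3 - 2 * w := by rw [hx]; field_simp; ring
  have eyx : y * x = -1 - 2 * x := by rw [hy]; field_simp
  have eyxw : y * x * (w - 2) = 3 * w - 4 := by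
    rw [eyx]; linear_combination (-2) * exw
  have earg : (-1 / z + 2) / 3 = -1 / y := by
    have : y * (3 - 2 * w) = 3 * w - 4 := by rw [← exw, ← eyxw]; ring
    rw [eq_div_iff n3]
    rw [hz'] at h0 ⊢
    field_simp
    linear_combination (-3) * this
  rw [earg, a1, hz']
  have : I ^ 3 = -I := I_pow_three
  linear_combination (-I ^ 3 * tA w / 3) * eyxw - ((3 * w - 4) * tA w / 3) * this

def tsg : Fin 4 → ℂ := ![-I, -I, I, I]

lemma tsg_sq (i : Fin 4) : tsg i ^ 2 = -1 := by
  fin_cases i <;> simp [tsg]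

lemma tb_S (i : Fin 4) : ∀ z ∈ HH, tb i (-1 / z) = tsg i * z * tb (sP i) z := by
  intro z hz
  have h0 := HH_ne hz
  fin_cases i
  · show tA (3 * (-1 / z)) = -I * z * (tA (z / 3) / 3)
    have := tA_S (HH_third hz)
    rw [show 3 * (-1 / z) = -1 / (z / 3) by field_simp, this]; ring
  · show tA (-1 / z / 3) / 3 = -I * z * tA (3 * z)
    have := tA_S (HH_three hz)
    rw [show -1 / z / 3 = -1 / (3 * z) by field_simp, this]; ring
  · exact tb2_S hz
  · show tb 3 (-1 / z) = I * z * tb 2 z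
    have := tb2_S (HH_S hz)
    rw [show -1 / (-1 / z) = z by field_simp] at this
    rw [this]
    generalize tb 3 (-1 / z) = y
    field_simp
    simp

lemma tb_cusp0 {z : ℂ} (hz : z ∈ HH) : tb 0 (1 - 1 / z) = -I * z * (tC (z / 3) / 3) := by
  have h0 := HH_ne hz
  have := tA_cusp (HH_third hz)
  rw [tb0, show 3 * (1 - 1 / z) = 1 - 1 / (z / 3) + 2 by field_simp; ring, tA_add_two, this]
  ring

lemma tb_cusp2 {z : ℂ} (hz : z ∈ HH) : tb 2 (1 - 1 / z) = -I * z * tC (3 * z) := by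
  have h0 := HH_ne hz
  have := tA_cusp (HH_three hz)
  rw [tb2, show (1 - 1 / z + 2) / 3 = 1 - 1 / (3 * z) by field_simp; ring, this]
  ring

lemma BddInf.shift {f : ℂ → ℂ} (h : BddInf f) (r : ℝ) : BddInf (fun z => f (z + r)) := by
  obtain ⟨M, C, h⟩ := h
  exact ⟨M, C, fun z hz => h _ (by simpa using hz)⟩

lemma family4 (f : Fin 4 → ℂ → ℂ) (hd : ∀ i, DifferentiableOn ℂ (f i) HH)
    (hS : ∀ i, ∀ z ∈ HH, f i (-1 / z) = f (sP i) z)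
    (hT : ∀ i, ∀ z ∈ HH, f i (z + 2) = f (tP i) z) (hb0 : BddInf (f 0)) (hb1 : BddInf (f 1))
    (hc0 : BddInf (fun z => f 0 (1 - 1 / z))) (hc2 : BddInf (fun z => f 2 (1 - 1 / z))) :
    ∀ i, ∀ z ∈ HH, ∀ w ∈ HH, f i z = f 0 w := by
  have hb2 : BddInf (f 2) := by
    refine (hb1.shift 2).congr fun z hz => ?_
    push_cast; exact hT 1 z hz
  have hb3 : BddInf (f 3) := by
    refine (hb2.shift 2).congr fun z hz => ?_
    push_cast; exact hT 2 z hz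
  have hcs : ∀ i j, tP j = sP i → ∀ z ∈ HH, f i (1 - 1 / (z + (1 : ℝ))) = f j (1 - 1 / z) := by
    intro i j hij z hz
    have h0 := HH_ne hz
    have h1 := HH_ne (HH_add_one hz)
    have h2 := HH_cusp hz
    have h3 : (1 - 1 / z - 2) ∈ HH := by
      have := HH_add h2 (-2)
      convert this using 1; push_cast; ring
    have h4 := hS i _ h3
    have h5 := hT j _ h3
    rw [← hij, ← h5, sub_add_cancel] at h4
    rw [← h4]
    congr 1
    have h6 := HH_ne h3
    rw [eq_div_iff h6]
    push_cast
    field_simp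
    ring
  have hc3 : BddInf (fun z => f 3 (1 - 1 / z)) :=
    (hc0.shift 1).congr (hcs 0 3 (by decide))
  have hc1 : BddInf (fun z => f 1 (1 - 1 / z)) :=
    (hc3.shift 1).congr (hcs 3 1 (by decide))
  have key := theta_family_const f hd sP tP hS hT
    (by intro i; fin_cases i; exacts [hb0, hb1, hb2, hb3])
    (by intro i; fin_cases i; exacts [hc0, hc1, hc2, hc3])
  have k1 : ∀ z ∈ HH, ∀ w ∈ HH, f 1 z = f 0 w := fun z hz w hw => by
    have := hS 1 z hz
    rw [key 1 z hz _ (HH_S hz), this]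
    exact key 0 _ hz _ hw
  have k2 : ∀ z ∈ HH, ∀ w ∈ HH, f 2 z = f 0 w := fun z hz w hw => by
    have := hT 1 z hz
    exact this.symm.trans (k1 _ (HH_add_two hz) _ hw)
  have k3 : ∀ z ∈ HH, ∀ w ∈ HH, f 3 z = f 0 w := fun z hz w hw => by
    have := hT 2 z hz
    exact this.symm.trans (k2 _ (HH_add_two hz) _ hw)
  intro i
  fin_cases i
  exacts [key 0, k1, k2, k3]


noncomputable def qp (X Y : ℂ → ℂ) (z : ℂ) : ℂ := (X z ^ 2 - Y z ^ 2) * (X z ^ 2 - 9 * Y z ^ 2)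
noncomputable def qW (X Y : ℂ → ℂ) (z : ℂ) : ℂ := X z * deriv Y z - deriv X z * Y z
noncomputable def qQ (X Y : ℂ → ℂ) (z : ℂ) : ℂ :=
  (X z ^ 2 - Y z ^ 2) * (X z ^ 2 - 9 * Y z ^ 2) ^ 3 / (tE z * Y z ^ 2)
noncomputable def qR (X Y : ℂ → ℂ) (z : ℂ) : ℂ := qW X Y z ^ 2 / qp X Y z ^ 2
noncomputable def qP (X : ℂ → ℂ) (z : ℂ) : ℂ := X z * deriv (deriv X) z - 2 * deriv X z ^ 2

lemma LTm.comp_div3 {F a L} (hF : LTm F a L) : LTm (fun z => F (z / 3)) (a / 3) L :=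
  (hF.comp (r := 1 / 3) (by norm_num)).congr (fun z _ => by congr 1; push_cast; ring) (by ring) rfl

lemma LTm.comp_mul3 {F a L} (hF : LTm F a L) : LTm (fun z => F (3 * z)) (3 * a) L :=
  (hF.comp (r := 3) (by norm_num)).congr (fun z _ => by congr 1) (by ring) rfl

lemma deriv_sub_c (F : ℂ → ℂ) (c : ℂ) : deriv (fun z => F z - c) = deriv F := by
  funext z; exact deriv_sub_const c

-- asymptotics of `tb 0`
lemma tb0_sub_LT : LTm (fun z => tb 0 z - 1) 3 4 :=
  tA_sub_one_LT.comp_mul3.congr (fun _ _ => rfl) (by norm_num) rfl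
lemma tb0_LT : LTm (tb 0) 0 1 :=
  tA_LT.comp_mul3.congr (fun _ _ => rfl) (by norm_num) rfl
lemma tb1_sub_LT : LTm (fun z => tb 1 z - 1 / 3) (1 / 3) (4 / 3) :=
  (tA_sub_one_LT.comp_div3.cmul (1 / 3)).congr (fun z _ => by rw [tb1]; ring) rfl (by norm_num)
lemma tb1_LT : LTm (tb 1) 0 (1 / 3) :=
  (tA_LT.comp_div3.cmul (1 / 3)).congr (fun z _ => by rw [tb1]; ring) (by norm_num) (by norm_num)

lemma tA_deriv_LT : LTm (deriv tA) 1 (4 * Real.pi * I) := by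
  have := tA_sub_one_LT.deriv (tA_diff.sub_const 1)
  rw [deriv_sub_c] at this
  exact this.congr (fun _ _ => rfl) rfl (by push_cast; ring)
lemma tb0_deriv_LT : LTm (deriv (tb 0)) 1 0 := by
  have := tb0_sub_LT.deriv ((tb_diff 0).sub_const 1)
  rw [deriv_sub_c] at this
  exact this.lower (by norm_num)
lemma tb1_deriv_LT : LTm (deriv (tb 1)) (1 / 3) (4 / 9 * Real.pi * I) := by
  have := tb1_sub_LT.deriv ((tb_diff 1).sub_const (1 / 3))
  rw [deriv_sub_c] at this
  exact this.congr (fun _ _ => rfl) rfl (by push_cast; ring)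

lemma m0_LT : LTm (fun z => tA z ^ 2 - tb 0 z ^ 2) 1 8 := by
  have h1 := tA_sub_one_LT.sub (tb0_sub_LT.lower (b := 1) (by norm_num))
  exact (h1.mul (tA_LT.add tb0_LT)).congr (fun z _ => by ring) (by norm_num) (by norm_num)
lemma n0_LT : LTm (fun z => tA z ^ 2 - 9 * tb 0 z ^ 2) 0 (-8) :=
  ((tA_LT.pow 2).sub (((tb0_LT.pow 2).cmul 9).congr (fun _ _ => rfl) rfl rfl)).congr
    (fun z _ => rfl) (by norm_num) (by norm_num)
lemma m1_LT : LTm (fun z => tA z ^ 2 - tb 1 z ^ 2) 0 (8 / 9) :=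
  ((tA_LT.pow 2).sub (tb1_LT.pow 2)).congr
    (fun z _ => rfl) (by norm_num) (by norm_num)
lemma n1_LT : LTm (fun z => tA z ^ 2 - 9 * tb 1 z ^ 2) (1 / 3) (-8) := by
  have h1 := (tA_sub_one_LT.lower (b := 1 / 3) (by norm_num)).sub (tb1_sub_LT.cmul 3)
  exact (h1.mul (tA_LT.add (tb1_LT.cmul 3))).congr (fun z _ => by ring) (by norm_num) (by norm_num)

lemma p0_LT : LTm (qp tA (tb 0)) 1 (-64) :=
  (m0_LT.mul n0_LT).congr (fun _ _ => rfl) (by norm_num) (by norm_num)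
lemma p1_LT : LTm (qp tA (tb 1)) (1 / 3) (-64 / 9) :=
  (m1_LT.mul n1_LT).congr (fun _ _ => rfl) (by norm_num) (by norm_num)
lemma W0_LT : LTm (qW tA (tb 0)) 1 (-4 * Real.pi * I) :=
  (((tA_LT.mul tb0_deriv_LT).congr (fun _ _ => rfl) (zero_add 1) rfl).sub
    ((tA_deriv_LT.mul tb0_LT).congr (fun _ _ => rfl) (add_zero 1) rfl)).congr (fun _ _ => rfl) rfl
    (by ring)
lemma W1_LT : LTm (qW tA (tb 1)) (1 / 3) (4 / 9 * Real.pi * I) :=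
  (((tA_LT.mul tb1_deriv_LT).congr (fun _ _ => rfl) (zero_add _) rfl).sub
    (((tA_deriv_LT.lower (b := 1 / 3) (by norm_num)).mul tb1_LT).congr (fun _ _ => rfl)
    (add_zero _) rfl)).congr (fun _ _ => rfl) rfl
    (by ring)

noncomputable def c0 (z : ℂ) : ℂ := tC (z / 3) / 3
noncomputable def c2 (z : ℂ) : ℂ := tC (3 * z)

lemma c0_diff : DifferentiableOn ℂ c0 HH :=
  (tC_diff.comp (f := fun z : ℂ => z / 3) (by fun_prop) fun z hz => HH_third hz).div_const 3
lemma c2_diff : DifferentiableOn ℂ c2 HH :=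
  tC_diff.comp (f := fun z : ℂ => 3 * z) (by fun_prop) fun z hz => HH_three hz

lemma c0_LT : LTm c0 (1 / 6) (4 / 3) :=
  (tC_LT.comp_div3.cmul (1 / 3)).congr (fun z _ => by rw [c0]; ring) (by norm_num) (by norm_num)
lemma c2_LT : LTm c2 (3 / 2) 4 :=
  tC_LT.comp_mul3.congr (fun z _ => rfl) (by norm_num) (by norm_num)

lemma mc0_LT : LTm (fun z => tC z ^ 2 - c0 z ^ 2) (1 / 3) (-16 / 9) :=
  (((tC_LT.pow 2).lower (b := 1 / 3) (by norm_num)).sub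
    ((c0_LT.pow 2).congr (fun _ _ => rfl) (by norm_num) rfl)).congr (fun _ _ => rfl) rfl (by norm_num)
lemma nc0_LT : LTm (fun z => tC z ^ 2 - 9 * c0 z ^ 2) (1 / 3) (-16) :=
  (((tC_LT.pow 2).lower (b := 1 / 3) (by norm_num)).sub
    (((c0_LT.pow 2).cmul 9).congr (fun _ _ => rfl) (by norm_num) rfl)).congr
    (fun _ _ => rfl) rfl (by norm_num)
lemma mc2_LT : LTm (fun z => tC z ^ 2 - c2 z ^ 2) 1 16 :=
  (((tC_LT.pow 2).congr (fun _ _ => rfl) (by norm_num) rfl).sub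
    ((c2_LT.pow 2).lower (b := 1) (by norm_num))).congr (fun _ _ => rfl) rfl (by norm_num)
lemma nc2_LT : LTm (fun z => tC z ^ 2 - 9 * c2 z ^ 2) 1 16 :=
  (((tC_LT.pow 2).congr (fun _ _ => rfl) (by norm_num) rfl).sub
    (((c2_LT.pow 2).cmul 9).lower (b := 1) (by norm_num))).congr (fun _ _ => rfl) rfl (by norm_num)

lemma LTm.W {X Y a b L M} (hX : LTm X a L) (hY : LTm Y b M) (hXd : DifferentiableOn ℂ X HH)
    (hYd : DifferentiableOn ℂ Y HH) : ∃ N, LTm (qW X Y) (a + b) N :=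
  ⟨_, (hX.mul (hY.deriv hYd)).sub ((hX.deriv hXd).mul hY)⟩

lemma deriv_T {X Y : ℂ → ℂ} (h : ∀ z, X (z + 2) = Y z) (z : ℂ) : deriv X (z + 2) = deriv Y z := by
  rw [← deriv_comp_add_const, funext h]

-- transformation rules
section rules
variable {X Y X1 Y1 : ℂ → ℂ} {a : ℝ} {c d : ℂ}

lemma qp_rule (hc : c ^ 2 = -1) (hd : d ^ 2 = -1) (hX : ∀ z ∈ HH, X (a - 1 / z) = c * z * X1 z)
    (hY : ∀ z ∈ HH, Y (a - 1 / z) = d * z * Y1 z) :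
    ∀ z ∈ HH, qp X Y (a - 1 / z) = z ^ 4 * qp X1 Y1 z := by
  intro z hz
  rw [qp, hX z hz, hY z hz, qp]
  simp only [mul_pow, hc, hd]
  ring

lemma qW_rule (hXd : DifferentiableOn ℂ X HH) (hYd : DifferentiableOn ℂ Y HH)
    (hXd1 : DifferentiableOn ℂ X1 HH) (hYd1 : DifferentiableOn ℂ Y1 HH)
    (hX : ∀ z ∈ HH, X (a - 1 / z) = c * z * X1 z)
    (hY : ∀ z ∈ HH, Y (a - 1 / z) = d * z * Y1 z) :
    ∀ z ∈ HH, qW X Y (a - 1 / z) = c * d * z ^ 4 * qW X1 Y1 z := by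
  intro z hz
  rw [qW, hX z hz, hY z hz, weight_one_deriv hXd hXd1 hX z hz, weight_one_deriv hYd hYd1 hY z hz, qW]
  ring

lemma qR_rule (hc : c ^ 2 = -1) (hd : d ^ 2 = -1)
    (hXd : DifferentiableOn ℂ X HH) (hYd : DifferentiableOn ℂ Y HH)
    (hXd1 : DifferentiableOn ℂ X1 HH) (hYd1 : DifferentiableOn ℂ Y1 HH)
    (hX : ∀ z ∈ HH, X (a - 1 / z) = c * z * X1 z)
    (hY : ∀ z ∈ HH, Y (a - 1 / z) = d * z * Y1 z) :
    ∀ z ∈ HH, qR X Y (a - 1 / z) = qR X1 Y1 z := by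
  intro z hz
  have h0 := HH_ne hz
  rw [qR, qp_rule hc hd hX hY z hz, qW_rule hXd hYd hXd1 hYd1 hX hY z hz, qR]
  have : (c * d * z ^ 4 * qW X1 Y1 z) ^ 2 = (z ^ 4) ^ 2 * qW X1 Y1 z ^ 2 := by
    simp only [mul_pow, hc, hd]; ring
  rw [this, mul_pow, mul_div_mul_left _ _ (by positivity)]

lemma qQ_rule {e : ℂ} (he : e ^ 2 = 1) (hc : c ^ 2 = -1) (hd : d ^ 2 = -1)
    (hX : ∀ z ∈ HH, X (a - 1 / z) = c * z * X1 z)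
    (hY : ∀ z ∈ HH, Y (a - 1 / z) = d * z * Y1 z) (hE : ∀ z ∈ HH, tE (a - 1 / z) = -e * z ^ 6 * tE z) :
    ∀ z ∈ HH, qQ X Y (a - 1 / z) = e * qQ X1 Y1 z := by
  intro z hz
  have h0 := HH_ne hz
  have he0 : e ≠ 0 := by rintro rfl; norm_num at he
  rw [qQ, hX z hz, hY z hz, hE z hz, qQ]
  simp only [mul_pow, hc, hd]
  have e1 : -e * z ^ 6 * tE z * (-1 * z ^ 2 * Y1 z ^ 2) = (e * z ^ 8) * (tE z * Y1 z ^ 2) := by ring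
  have e2 : (-1 * z ^ 2 * X1 z ^ 2 - -1 * z ^ 2 * Y1 z ^ 2) *
      (-1 * z ^ 2 * X1 z ^ 2 - 9 * (-1 * z ^ 2 * Y1 z ^ 2)) ^ 3 = (e * z ^ 8) *
      (e * ((X1 z ^ 2 - Y1 z ^ 2) * (X1 z ^ 2 - 9 * Y1 z ^ 2) ^ 3)) := by
    linear_combination (-z ^ 8 * ((X1 z ^ 2 - Y1 z ^ 2) * (X1 z ^ 2 - 9 * Y1 z ^ 2) ^ 3)) * he
  rw [e1, e2, mul_div_mul_left _ _ (mul_ne_zero he0 (pow_ne_zero _ h0)), mul_div_assoc]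

lemma qP_rule (hc : c ^ 2 = -1) (hXd : DifferentiableOn ℂ X HH) (hXd1 : DifferentiableOn ℂ X1 HH)
    (hX : ∀ z ∈ HH, X (a - 1 / z) = c * z * X1 z) :
    ∀ z ∈ HH, qP X (a - 1 / z) = -z ^ 6 * qP X1 z := by
  intro z hz
  rw [qP, hX z hz, weight_one_deriv hXd hXd1 hX z hz, weight_one_deriv2 hXd hXd1 hX z hz, qP]
  linear_combination (z ^ 6 * (X1 z * deriv (deriv X1) z - 2 * deriv X1 z ^ 2)) * hc
end rules

lemma negI_sq : (-I) ^ 2 = -1 := by simp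
lemma tA_S' : ∀ z ∈ HH, tA ((0 : ℝ) - 1 / z) = -I * z * tA z := fun z hz => by
  rw [← tA_S hz]; congr 1; push_cast; ring
lemma tb_S' (i : Fin 4) : ∀ z ∈ HH, tb i ((0 : ℝ) - 1 / z) = tsg i * z * tb (sP i) z :=
  fun z hz => by rw [← tb_S i z hz]; congr 1; push_cast; ring
lemma tE_S' : ∀ z ∈ HH, tE ((0 : ℝ) - 1 / z) = -1 * z ^ 6 * tE z := fun z hz => by
  rw [show ((0 : ℝ) : ℂ) - 1 / z = -1 / z by push_cast; ring, tE_S hz]; ring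
lemma tA_c : ∀ z ∈ HH, tA ((1 : ℝ) - 1 / z) = -I * z * tC z := fun z hz => by
  rw [← tA_cusp hz]; simp
lemma tb0_c : ∀ z ∈ HH, tb 0 ((1 : ℝ) - 1 / z) = -I * z * c0 z := fun z hz => by
  rw [c0, ← tb_cusp0 hz]; simp
lemma tb2_c : ∀ z ∈ HH, tb 2 ((1 : ℝ) - 1 / z) = -I * z * c2 z := fun z hz => by
  rw [c2, ← tb_cusp2 hz]; simp
lemma tE_c : ∀ z ∈ HH, tE ((1 : ℝ) - 1 / z) = -(-1) * z ^ 6 * tE z := fun z hz => by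
  rw [ofReal_one, tE_cusp hz]; ring

lemma Q_lim0 : Tendsto (qQ tA (tb 0)) imInf (𝓝 (-256)) := by
  have := (m0_LT.mul (n0_LT.pow 3)).div (tE_LT.mul (tb0_LT.pow 2)) (by norm_num) (by norm_num)
  norm_num at this
  exact this

lemma Q_const (i : Fin 4) : ∀ z ∈ HH, qQ tA (tb i) z = -256 := by
  intro z hz
  have key := family4 (fun i => qQ tA (tb i)) ?_ ?_ ?_ (bdd_of_tendsto Q_lim0) ?_ ?_ ?_
  · rw [key i z hz z hz]
    exact const_eq_lim (key 0) Q_lim0 z hz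
  · intro i
    exact ((((tA_diff.pow 2).sub ((tb_diff i).pow 2)).mul
      (((tA_diff.pow 2).sub (((tb_diff i).pow 2).const_mul 9)).pow 3))).div
      (tE_diff.mul ((tb_diff i).pow 2))
      fun z hz => mul_ne_zero (tE_ne hz) (pow_ne_zero _ (tb_ne i hz))
  · intro i z hz
    have := qQ_rule (e := 1) (by norm_num) negI_sq (tsg_sq i) tA_S' (tb_S' i) tE_S' z hz
    rw [one_mul] at this
    rw [← this]
    congr 1; push_cast; ring
  · intro i z hz
    simp only [qQ]
    rw [tA_add_two, tb_T, tE_add_two]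
  · exact bdd_of_tendsto ((m1_LT.mul (n1_LT.pow 3)).div (tE_LT.mul (tb1_LT.pow 2)) (by norm_num)
      (by norm_num))
  · have := bdd_of_tendsto (((mc0_LT.mul (nc0_LT.pow 3)).div (tE_LT.mul (c0_LT.pow 2))
      (by norm_num) (by norm_num)).const_mul (-1))
    refine this.congr fun z hz => ?_
    have := qQ_rule (e := -1) (by norm_num) negI_sq negI_sq tA_c tb0_c tE_c z hz
    rw [ofReal_one] at this
    exact this.symm
  · have := bdd_of_tendsto (((mc2_LT.mul (nc2_LT.pow 3)).div (tE_LT.mul (c2_LT.pow 2))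
      (by norm_num) (by norm_num)).const_mul (-1))
    refine this.congr fun z hz => ?_
    have := qQ_rule (e := -1) (by norm_num) negI_sq negI_sq tA_c tb2_c tE_c z hz
    rw [ofReal_one] at this
    exact this.symm

lemma qp_ne (i : Fin 4) {z : ℂ} (hz : z ∈ HH) : qp tA (tb i) z ≠ 0 := by
  intro h
  have := Q_const i z hz
  rw [qQ] at this
  have h2 : (tA z ^ 2 - tb i z ^ 2) * (tA z ^ 2 - 9 * tb i z ^ 2) ^ 3 = 0 := by
    rw [qp] at h
    linear_combination (tA z ^ 2 - 9 * tb i z ^ 2) ^ 2 * h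
  rw [h2] at this
  norm_num at this

lemma qW_diff (i : Fin 4) : DifferentiableOn ℂ (qW tA (tb i)) HH :=
  (tA_diff.mul ((tb_diff i).deriv isOpen_HH)).sub ((tA_diff.deriv isOpen_HH).mul (tb_diff i))

lemma qp_diff (i : Fin 4) : DifferentiableOn ℂ (qp tA (tb i)) HH :=
  ((tA_diff.pow 2).sub ((tb_diff i).pow 2)).mul ((tA_diff.pow 2).sub (((tb_diff i).pow 2).const_mul 9))

lemma R_lim0 : Tendsto (qR tA (tb 0)) imInf (𝓝 (-(Real.pi : ℂ) ^ 2 / 256)) := by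
  have := (W0_LT.pow 2).div (p0_LT.pow 2) (by norm_num) (by norm_num)
  have e : (-4 * (Real.pi : ℂ) * I) ^ 2 / (-64) ^ 2 = -(Real.pi : ℂ) ^ 2 / 256 := by
    rw [mul_pow, I_sq]; ring
  rw [e] at this
  exact this

lemma R_const : ∀ z ∈ HH, qR tA (tb 0) z = -(Real.pi : ℂ) ^ 2 / 256 := by
  intro z hz
  have key := family4 (fun i => qR tA (tb i)) ?_ ?_ ?_ (bdd_of_tendsto R_lim0) ?_ ?_ ?_
  · exact const_eq_lim (key 0) R_lim0 z hz
  · intro i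
    exact ((qW_diff i).pow 2).div ((qp_diff i).pow 2) fun z hz => pow_ne_zero _ (qp_ne i hz)
  · intro i z hz
    have := qR_rule negI_sq (tsg_sq i) tA_diff (tb_diff i) tA_diff (tb_diff _) tA_S' (tb_S' i) z hz
    rw [← this]
    congr 1; push_cast; ring
  · intro i z hz
    simp only [qR, qW, qp]
    rw [tA_add_two, tb_T, deriv_T tA_add_two, deriv_T (tb_T i)]
  · exact bdd_of_tendsto ((W1_LT.pow 2).div (p1_LT.pow 2) (by norm_num) (by norm_num))
  · obtain ⟨N, hN⟩ := tC_LT.W c0_LT tC_diff c0_diff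
    refine (bdd_of_tendsto ((hN.pow 2).div ((mc0_LT.mul nc0_LT).pow 2) (by norm_num)
      (by norm_num))).congr fun z hz => ?_
    have := qR_rule negI_sq negI_sq tA_diff (tb_diff 0) tC_diff c0_diff tA_c tb0_c z hz
    rw [ofReal_one] at this
    exact this.symm
  · obtain ⟨N, hN⟩ := tC_LT.W c2_LT tC_diff c2_diff
    refine (bdd_of_tendsto ((hN.pow 2).div ((mc2_LT.mul nc2_LT).pow 2) (by norm_num)
      (by norm_num))).congr fun z hz => ?_
    have := qR_rule negI_sq negI_sq tA_diff (tb_diff 2) tC_diff c2_diff tA_c tb2_c z hz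
    rw [ofReal_one] at this
    exact this.symm

lemma W_eq : ∃ s : ℂ, s ^ 2 = -(Real.pi : ℂ) ^ 2 / 256 ∧
    ∀ z ∈ HH, qW tA (tb 0) z = s * qp tA (tb 0) z := by
  have hsq : ∀ z ∈ HH, (qW tA (tb 0) z / qp tA (tb 0) z) ^ 2 = -(Real.pi : ℂ) ^ 2 / 256 := by
    intro z hz
    rw [div_pow]; exact R_const z hz
  have hI : I ∈ HH := by simp [HH]
  have hfin : {s : ℂ | s ^ 2 = -(Real.pi : ℂ) ^ 2 / 256}.Finite := by
    refine (Set.toFinite {qW tA (tb 0) I / qp tA (tb 0) I, -(qW tA (tb 0) I / qp tA (tb 0) I)}).subset ?_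
    intro s hs
    have : s ^ 2 = (qW tA (tb 0) I / qp tA (tb 0) I) ^ 2 := by rw [hsq I hI]; exact hs
    exact sq_eq_sq_iff_eq_or_eq_neg.1 this
  have hc := const_of_finite (f := fun z => qW tA (tb 0) z / qp tA (tb 0) z)
    (((qW_diff 0).div (qp_diff 0) fun z hz => qp_ne 0 hz).continuousOn) hfin hsq
  refine ⟨qW tA (tb 0) I / qp tA (tb 0) I, hsq I hI, fun z hz => ?_⟩
  rw [← hc z hz I hI, div_mul_cancel₀ _ (qp_ne 0 hz)]

lemma P_lim : Tendsto (fun z => qP tA z / tE z) imInf (𝓝 (-(Real.pi : ℂ) ^ 2 / 4)) := by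
  have h2 := tA_deriv_LT.deriv (tA_diff.deriv isOpen_HH)
  have h3 := ((tA_LT.mul h2).congr (fun _ _ => rfl) (zero_add _) rfl).sub
    (((tA_deriv_LT.pow 2).cmul 2).lower (b := 1) (by norm_num))
  have := h3.div tE_LT (by norm_num) rfl
  refine this.congr' ?_ |>.trans (le_of_eq ?_)
  · exact Eventually.of_forall fun z => rfl
  · congr 1
    push_cast
    linear_combination (Real.pi : ℂ) ^ 2 / 4 * I_sq

lemma P_eq : ∀ z ∈ HH, qP tA z = -(Real.pi : ℂ) ^ 2 / 4 * tE z := by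
  intro z hz
  have key := theta_family_const (ι := Unit) (fun _ z => qP tA z / tE z) ?_ 1 1 ?_ ?_
    (fun _ => bdd_of_tendsto P_lim) ?_ ()
  · have := const_eq_lim key P_lim z hz
    rw [← this, div_mul_cancel₀ _ (tE_ne hz)]
  · intro i
    have h1 := tA_diff.deriv isOpen_HH
    exact ((tA_diff.mul (h1.deriv isOpen_HH)).sub ((h1.pow 2).const_mul 2)).div tE_diff
      fun z hz => tE_ne hz
  · intro i z hz
    have h1 := qP_rule negI_sq tA_diff tA_diff tA_S' z hz
    have h2 := tE_S' z hz
    have h0 := HH_ne hz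
    rw [show -1 / z = ((0 : ℝ) : ℂ) - 1 / z by push_cast; ring, h1, h2, neg_one_mul,
      mul_div_mul_left _ _ (neg_ne_zero.2 (pow_ne_zero _ h0))]
  · intro i z hz
    simp only [qP]
    rw [tA_add_two, tE_add_two, deriv_T (deriv_T tA_add_two), deriv_T tA_add_two]
  · intro i
    have h2 := tC_LT.deriv tC_diff
    have h3 := h2.deriv (tC_diff.deriv isOpen_HH)
    have h4 := ((tC_LT.mul h3).congr (b := 1) (fun _ _ => rfl) (by norm_num) rfl).sub
      (((h2.pow 2).cmul 2).congr (b := 1) (fun _ _ => rfl) (by norm_num) rfl)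
    refine (bdd_of_tendsto ((h4.div tE_LT (by norm_num) rfl).const_mul (-1))).congr fun z hz => ?_
    have h1 := qP_rule negI_sq tA_diff tC_diff tA_c z hz
    have h2 := tE_c z hz
    have h0 := HH_ne hz
    rw [ofReal_one] at h1 h2
    have h3 := tE_ne hz
    have e : -z ^ 6 * qP tC z / (-(-1) * z ^ 6 * tE z) = -1 * (qP tC z / tE z) := by field_simp
    rw [h1, h2, e]
    rfl


lemma hasD {F : ℂ → ℂ} (hF : DifferentiableOn ℂ F HH) {z : ℂ} (hz : z ∈ HH) :
    HasDerivAt F (deriv F z) z := (hF.differentiableAt (isOpen_HH.mem_nhds hz)).hasDerivAt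

lemma L_alg (s A B A1 B1 A2 B2 p p1 p2 : ℂ) (hA : A ≠ 0) (hB : B ≠ 0)
    (hp : p = (A ^ 2 - B ^ 2) * (A ^ 2 - 9 * B ^ 2))
    (hp1 : p1 = 4 * A ^ 3 * A1 - 20 * A * A1 * B ^ 2 - 20 * A ^ 2 * B * B1 + 36 * B ^ 3 * B1)
    (hp2 : p2 = 12 * A ^ 2 * A1 ^ 2 + 4 * A ^ 3 * A2 - 20 * A1 ^ 2 * B ^ 2 - 20 * A * A2 * B ^ 2
      - 80 * A * A1 * B * B1 - 20 * A ^ 2 * B1 ^ 2 - 20 * A ^ 2 * B * B2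
      + 108 * B ^ 2 * B1 ^ 2 + 36 * B ^ 3 * B2)
    (h1 : A * B1 - A1 * B = s * p) (h2 : A * B2 - A2 * B = s * p1)
    (h3 : B ^ 2 * (A * A2 - 2 * A1 ^ 2) = -(s ^ 2 / 4) * ((A ^ 2 - B ^ 2) * (A ^ 2 - 9 * B ^ 2) ^ 3)) :
    2 * A ^ 2 * B ^ 2 * (A * (p * p2 - 3 / 2 * p1 ^ 2) + 2 * p * p1 * A1 - 2 * p ^ 2 * A2) =
      -s ^ 2 * p ^ 2 * (A ^ 2 + 3 * B ^ 2) ^ 4 * A := by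
  have e1 : B1 = (s * p + A1 * B) / A := by rw [← h1]; field_simp; ring
  have e2 : A2 = (-(s ^ 2 / 4) * ((A ^ 2 - B ^ 2) * (A ^ 2 - 9 * B ^ 2) ^ 3) / B ^ 2 + 2 * A1 ^ 2) / A := by
    rw [← h3]; field_simp; ring
  have e3 : B2 = (s * p1 + A2 * B) / A := by rw [← h2]; field_simp; ring
  rw [hp2, e3, hp1, e2, e1, hp]
  field_simp
  ring

lemma L_alg2 (s A B A1 B1 A2 B2 p p1 p2 q : ℂ) (hA : A ≠ 0)
    (h1 : A * B1 - A1 * B = s * p) (h2 : A * B2 - A2 * B = s * p1)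
    (h : 2 * A ^ 2 * B ^ 2 * (A * (p * p2 - 3 / 2 * p1 ^ 2) + 2 * p * p1 * A1 - 2 * p ^ 2 * A2) =
      q * A) :
    2 * A ^ 2 * B ^ 2 * (B * (p * p2 - 3 / 2 * p1 ^ 2) + 2 * p * p1 * B1 - 2 * p ^ 2 * B2) =
      q * B := by
  refine mul_left_cancel₀ hA ?_
  linear_combination B * h + 4 * A ^ 2 * B ^ 2 * p * p1 * h1 - 4 * A ^ 2 * B ^ 2 * p ^ 2 * h2

lemma fin_alg (e s i r A B A1 B1 A2 B2 p p1 p2 : ℂ) (he : e ^ 3 = 1) (hi : i ^ 2 = -1) (hr : r ^ 2 = 3)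
    (hA : A ≠ 0) (hB : B ≠ 0) (hp0 : p ≠ 0)
    (hp : p = (A ^ 2 - B ^ 2) * (A ^ 2 - 9 * B ^ 2)) (D N D1 D2 : ℂ) (hD : D = i * A - r * B)
    (hD1 : D1 = i * A1 - r * B1) (hD2 : D2 = i * A2 - r * B2)
    (hN : N = i * A + r * B) (hD0 : D ≠ 0)
    (hLA : 2 * A ^ 2 * B ^ 2 * (A * (p * p2 - 3 / 2 * p1 ^ 2) + 2 * p * p1 * A1 - 2 * p ^ 2 * A2) =
      -s ^ 2 * p ^ 2 * (A ^ 2 + 3 * B ^ 2) ^ 4 * A)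
    (hLB : 2 * A ^ 2 * B ^ 2 * (B * (p * p2 - 3 / 2 * p1 ^ 2) + 2 * p * p1 * B1 - 2 * p ^ 2 * B2) =
      -s ^ 2 * p ^ 2 * (A ^ 2 + 3 * B ^ 2) ^ 4 * B)
    (K T T1 T2 T3 : ℂ) (hK : K = 2 * i * r * e * s) (hT : T = e * N / D)
    (hT1 : T1 = K * p / D ^ 2) (hT2 : T2 = K * (p1 * D - 2 * p * D1) / D ^ 3)
    (hT3 : T3 = K * (p2 * D ^ 2 - 4 * p1 * D * D1 - 2 * p * D * D2 + 6 * p * D1 ^ 2) / D ^ 4) :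
    T3 * T1 - (3 / 2) * T2 ^ 2 = -18 * T ^ 4 / (T ^ 6 - 1) ^ 2 * T1 ^ 4 := by
  have hL : 2 * A ^ 2 * B ^ 2 * (D * (p * p2 - 3 / 2 * p1 ^ 2) + 2 * p * p1 * D1 - 2 * p ^ 2 * D2) =
      -s ^ 2 * p ^ 2 * (A ^ 2 + 3 * B ^ 2) ^ 4 * D := by
    rw [hD, hD1, hD2]; linear_combination i * hLA - r * hLB
  have hND : N * D = -(A ^ 2 + 3 * B ^ 2) := by
    rw [hN, hD]; linear_combination A ^ 2 * hi - B ^ 2 * hr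
  have hi0 : i ≠ 0 := by rintro rfl; norm_num at hi
  have hr0 : r ≠ 0 := by rintro rfl; norm_num at hr
  have h6 : N ^ 6 - D ^ 6 = 12 * i * r * A * B * p := by
    have hi4 : i ^ 4 = 1 := by rw [show 4 = 2 * 2 by norm_num, pow_mul, hi]; norm_num
    have hr4 : r ^ 4 = 9 := by rw [show 4 = 2 * 2 by norm_num, pow_mul, hr]; norm_num
    rw [hN, hD, hp]
    linear_combination (12 * i * r * A ^ 5 * B) * hi4 + (40 * i * r ^ 3 * A ^ 3 * B ^ 3) * hi
      - (40 * i * r * A ^ 3 * B ^ 3) * hr + (12 * i * r * A * B ^ 5) * hr4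
  have hT6 : T ^ 6 - 1 = 12 * i * r * A * B * p / D ^ 6 := by
    rw [← h6, hT]
    have : e ^ 6 = 1 := by rw [show 6 = 3 * 2 by norm_num, pow_mul, he]; norm_num
    rw [div_pow, mul_pow, this]; field_simp
  have hT4 : T ^ 4 = e * (A ^ 2 + 3 * B ^ 2) ^ 4 / D ^ 8 := by
    have h4 : (A ^ 2 + 3 * B ^ 2) ^ 4 = (N * D) ^ 4 := by rw [hND]; ring
    rw [h4, hT]
    have : e ^ 4 = e := by rw [show 4 = 3 + 1 by norm_num, pow_add, he]; ring
    rw [div_pow, mul_pow, this]; field_simp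
  have hK2 : K ^ 2 = -12 * e ^ 2 * s ^ 2 := by
    rw [hK]; simp only [mul_pow, hi, hr]; ring
  have hl : T3 * T1 - (3 / 2) * T2 ^ 2 = K ^ 2 / D ^ 5 *
      (D * (p * p2 - 3 / 2 * p1 ^ 2) + 2 * p * p1 * D1 - 2 * p ^ 2 * D2) := by
    rw [hT1, hT2, hT3]; field_simp; ring
  have hl2 : D * (p * p2 - 3 / 2 * p1 ^ 2) + 2 * p * p1 * D1 - 2 * p ^ 2 * D2 =
      -s ^ 2 * p ^ 2 * (A ^ 2 + 3 * B ^ 2) ^ 4 * D / (2 * A ^ 2 * B ^ 2) := by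
    rw [← hL]; field_simp
  rw [hl, hl2, hT6, hT4, hT1]
  have hden : (12 * i * r * A * B * p / D ^ 6) ^ 2 = -432 * A ^ 2 * B ^ 2 * p ^ 2 / D ^ 12 := by
    rw [div_pow]; simp only [mul_pow, hi, hr]; ring
  have hK4 : (K * p / D ^ 2) ^ 4 = K ^ 2 * (-12 * e ^ 2 * s ^ 2) * p ^ 4 / D ^ 8 := by
    rw [← hK2]; ring
  rw [hden, hK4]
  generalize (A ^ 2 + 3 * B ^ 2) = G
  field_simp
  linear_combination (432 * K ^ 2 * s ^ 2 * G ^ 4) * he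




theorem haupt_main (τ : ℂ) (hτ : 0 < τ.im)
    (hden : Complex.I * jacobiTheta τ ^ 2
      - (Real.sqrt 3 : ℂ) * jacobiTheta (3 * τ) ^ 2 ≠ 0) (hauptT : ℂ → ℂ)
    (hdef : hauptT = fun τ => Complex.exp (2 * Real.pi * Complex.I / 3) *
    (Complex.I * jacobiTheta τ ^ 2 + (Real.sqrt 3 : ℂ) * jacobiTheta (3 * τ) ^ 2) /
    (Complex.I * jacobiTheta τ ^ 2 - (Real.sqrt 3 : ℂ) * jacobiTheta (3 * τ) ^ 2)) :
    deriv (deriv (deriv hauptT)) τ * deriv hauptT τ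
      - (3 / 2) * (deriv (deriv hauptT) τ) ^ 2 =
      -18 * hauptT τ ^ 4 / (hauptT τ ^ 6 - 1) ^ 2 * (deriv hauptT τ) ^ 4 := by
  obtain ⟨e, hedef⟩ : ∃ e, e = Complex.exp (2 * Real.pi * Complex.I / 3) := ⟨_, rfl⟩
  obtain ⟨r, hrdef⟩ : ∃ r : ℂ, r = (Real.sqrt 3 : ℂ) := ⟨_, rfl⟩
  have he : e ^ 3 = 1 := by
    rw [hedef, ← Complex.exp_nat_mul, Complex.exp_eq_one_iff]
    exact ⟨1, by push_cast; ring⟩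
  have hr : r ^ 2 = 3 := by
    rw [hrdef, ← ofReal_pow, Real.sq_sqrt (by norm_num)]; norm_num
  obtain ⟨A, hAd⟩ : ∃ A, A = tA := ⟨_, rfl⟩
  obtain ⟨B, hBd⟩ : ∃ B, B = tb 0 := ⟨_, rfl⟩
  have dA : DifferentiableOn ℂ A HH := hAd ▸ tA_diff
  have dB : DifferentiableOn ℂ B HH := hBd ▸ tb_diff 0
  have dA1 := dA.deriv isOpen_HH
  have dB1 := dB.deriv isOpen_HH
  obtain ⟨s, hs2, hW⟩ := W_eq
  rw [← hAd, ← hBd] at hW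
  have hT : hauptT = fun z => e * (I * A z + r * B z) / (I * A z - r * B z) := by
    rw [hdef, hedef, hrdef, hAd, hBd]; rfl
  have hD0 : I * A τ - r * B τ ≠ 0 := by rw [hrdef, hAd, hBd]; exact hden
  clear hden hdef
  subst hT
  obtain ⟨D, hDd⟩ : ∃ D, D = fun z => I * A z - r * B z := ⟨_, rfl⟩
  have dD : DifferentiableOn ℂ D HH := by
    rw [hDd]; exact (dA.const_mul I).sub (dB.const_mul r)
  have dD1 := dD.deriv isOpen_HH
  obtain ⟨p, hpd⟩ : ∃ p, p = qp A B := ⟨_, rfl⟩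
  have dp : DifferentiableOn ℂ p HH := by
    rw [hpd, hAd, hBd]; exact qp_diff 0
  have dp1 := dp.deriv isOpen_HH
  rw [← hpd] at hW
  have D1 : ∀ z ∈ HH, deriv D z = I * deriv A z - r * deriv B z := fun z hz => by
    rw [hDd]; exact (((hasD dA hz).const_mul I).sub ((hasD dB hz).const_mul r)).deriv
  have ev : ∀ z ∈ HH, ∀ᶠ w in 𝓝 z, w ∈ HH := fun z hz => isOpen_HH.mem_nhds hz
  have D2 : ∀ z ∈ HH, deriv (deriv D) z = I * deriv (deriv A) z - r * deriv (deriv B) z :=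
    fun z hz => by
    have : deriv D =ᶠ[𝓝 z] fun z => I * deriv A z - r * deriv B z := by
      filter_upwards [ev z hz] with w hw using D1 w hw
    rw [this.deriv_eq]
    exact (((hasD dA1 hz).const_mul I).sub ((hasD dB1 hz).const_mul r)).deriv
  have P1 : ∀ z ∈ HH, deriv p z = 4 * A z ^ 3 * deriv A z - 20 * A z * deriv A z * B z ^ 2
      - 20 * A z ^ 2 * B z * deriv B z + 36 * B z ^ 3 * deriv B z := fun z hz => by
    have h := ((((hasD dA hz).pow 2).sub ((hasD dB hz).pow 2)).mul
      (((hasD dA hz).pow 2).sub (((hasD dB hz).pow 2).const_mul 9))).deriv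
    rw [hpd]
    refine Eq.trans (Eq.trans ?_ h) ?_
    · rfl
    · simp; ring
  have P2 : ∀ z ∈ HH, deriv (deriv p) z = 12 * A z ^ 2 * deriv A z ^ 2 + 4 * A z ^ 3 * deriv (deriv A) z
      - 20 * deriv A z ^ 2 * B z ^ 2 - 20 * A z * deriv (deriv A) z * B z ^ 2
      - 80 * A z * deriv A z * B z * deriv B z - 20 * A z ^ 2 * deriv B z ^ 2
      - 20 * A z ^ 2 * B z * deriv (deriv B) z
      + 108 * B z ^ 2 * deriv B z ^ 2 + 36 * B z ^ 3 * deriv (deriv B) z := fun z hz => by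
    have : deriv p =ᶠ[𝓝 z] fun z => 4 * A z ^ 3 * deriv A z - 20 * A z * deriv A z * B z ^ 2
      - 20 * A z ^ 2 * B z * deriv B z + 36 * B z ^ 3 * deriv B z := by
      filter_upwards [ev z hz] with w hw using P1 w hw
    rw [this.deriv_eq]
    have hA := hasD dA hz
    have hB := hasD dB hz
    have hA1 := hasD dA1 hz
    have hB1 := hasD dB1 hz
    have h := ((((((hA.pow 3).const_mul 4).mul hA1).sub (((hA.const_mul 20).mul hA1).mul (hB.pow 2))).sub
      ((((hA.pow 2).const_mul 20).mul hB).mul hB1)).add (((hB.pow 3).const_mul 36).mul hB1)).deriv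
    refine Eq.trans (Eq.trans ?_ h) ?_
    · rfl
    · simp; ring
  have W1 : ∀ z ∈ HH, A z * deriv (deriv B) z - deriv (deriv A) z * B z = s * deriv p z :=
    fun z hz => by
    have h1 : qW A B =ᶠ[𝓝 z] fun z => s * p z := by
      filter_upwards [ev z hz] with w hw using hW w hw
    have h2 := h1.deriv_eq
    rw [((hasD dp hz).const_mul s).deriv] at h2
    rw [← h2]
    have h := (((hasD dA hz).mul (hasD dB1 hz)).sub ((hasD dA1 hz).mul (hasD dB hz))).deriv
    refine Eq.symm (Eq.trans (Eq.trans ?_ h) ?_)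
    · rfl
    · ring
  have hz : τ ∈ HH := hτ
  have hA0 : A τ ≠ 0 := hAd ▸ tA_ne hz
  have hB0 : B τ ≠ 0 := hBd ▸ tb_ne 0 hz
  have hp0 : p τ ≠ 0 := by rw [hpd, hAd, hBd]; exact qp_ne 0 hz
  have hDτ : D τ ≠ 0 := by rw [hDd]; exact hD0
  have evD : ∀ᶠ w in 𝓝 τ, w ∈ HH ∧ D w ≠ 0 :=
    (ev τ hz).and ((hasD dD hz).continuousAt.eventually_ne hDτ)
  have h3 : B τ ^ 2 * (A τ * deriv (deriv A) τ - 2 * deriv A τ ^ 2) =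
      -(s ^ 2 / 4) * ((A τ ^ 2 - B τ ^ 2) * (A τ ^ 2 - 9 * B τ ^ 2) ^ 3) := by
    have hP := P_eq τ hz
    have hQ := Q_const 0 τ hz
    have hE := tE_ne hz
    rw [qP, ← hAd] at hP
    rw [qQ, ← hAd, ← hBd, div_eq_iff (mul_ne_zero hE (pow_ne_zero _ hB0))] at hQ
    rw [hP, hQ, hs2]
    ring
  have hL := L_alg s (A τ) (B τ) (deriv A τ) (deriv B τ) (deriv (deriv A) τ) (deriv (deriv B) τ)
    (p τ) (deriv p τ) (deriv (deriv p) τ) hA0 hB0 (by rw [hpd, qp]) (P1 τ hz) (P2 τ hz) (hW τ hz)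
    (W1 τ hz) h3
  have hL2 := L_alg2 s _ _ _ _ _ _ _ _ _ _ hA0 (hW τ hz) (W1 τ hz) hL
  have T1 : ∀ z, z ∈ HH ∧ D z ≠ 0 →
      deriv (fun z => e * (I * A z + r * B z) / (I * A z - r * B z)) z =
      2 * I * r * e * s * p z / D z ^ 2 := by
    rintro z ⟨hz, hD⟩
    have h := ((((hasD dA hz).const_mul I).add ((hasD dB hz).const_mul r)).const_mul e).div
      (((hasD dA hz).const_mul I).sub ((hasD dB hz).const_mul r)) (by rw [hDd] at hD; exact hD)
    refine h.deriv.trans ?_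
    have hw := hW z hz
    rw [qW] at hw
    rw [hDd]
    simp only [Pi.add_apply, Pi.sub_apply]
    congr 1
    linear_combination (2 * I * r * e) * hw
  have T2 : ∀ z, z ∈ HH ∧ D z ≠ 0 → deriv (fun z => 2 * I * r * e * s * p z / D z ^ 2) z =
      2 * I * r * e * s * (deriv p z * D z - 2 * p z * deriv D z) / D z ^ 3 := by
    rintro z ⟨hz, hD⟩
    have h := ((hasD dp hz).const_mul (2 * I * r * e * s)).div ((hasD dD hz).pow 2) (pow_ne_zero _ hD)
    refine h.deriv.trans ?_
    simp
    field_simp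
  have T3 : ∀ z, z ∈ HH ∧ D z ≠ 0 → deriv (fun z => 2 * I * r * e * s *
      (deriv p z * D z - 2 * p z * deriv D z) / D z ^ 3) z =
      2 * I * r * e * s * (deriv (deriv p) z * D z ^ 2 - 4 * deriv p z * D z * deriv D z
        - 2 * p z * D z * deriv (deriv D) z + 6 * p z * deriv D z ^ 2) / D z ^ 4 := by
    rintro z ⟨hz, hD⟩
    have h := ((((hasD dp1 hz).mul (hasD dD hz)).sub
      (((hasD dp hz).const_mul 2).mul (hasD dD1 hz))).const_mul (2 * I * r * e * s)).div
      ((hasD dD hz).pow 3) (pow_ne_zero _ hD)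
    refine h.deriv.trans ?_
    simp
    field_simp
    ring
  have E1 : deriv (fun z => e * (I * A z + r * B z) / (I * A z - r * B z)) =ᶠ[𝓝 τ]
      fun z => 2 * I * r * e * s * p z / D z ^ 2 := by
    filter_upwards [evD] with w hw using T1 w hw
  have E2 : deriv (deriv (fun z => e * (I * A z + r * B z) / (I * A z - r * B z))) =ᶠ[𝓝 τ]
      fun z => 2 * I * r * e * s * (deriv p z * D z - 2 * p z * deriv D z) / D z ^ 3 := by
    refine E1.deriv.trans ?_
    filter_upwards [evD] with w hw using T2 w hw
  have hτD : τ ∈ HH ∧ D τ ≠ 0 := ⟨hz, hDτ⟩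
  exact fin_alg e s I r (A τ) (B τ) (deriv A τ) (deriv B τ) (deriv (deriv A) τ) (deriv (deriv B) τ)
    (p τ) (deriv p τ) (deriv (deriv p) τ) he I_sq hr hA0 hB0 hp0 (by rw [hpd, qp])
    (D τ) (I * A τ + r * B τ) (deriv D τ) (deriv (deriv D) τ) (by rw [hDd]) (D1 τ hz) (D2 τ hz) rfl hDτ
    hL hL2 _ _ _ _ _ rfl (by rw [hDd]) (T1 τ hτD) E2.eq_of_nhds (E2.deriv_eq.trans (T3 τ hτD))

end helpers

theorem hauptT_schwarzian_equation (τ : ℂ) (hτ : 0 < τ.im)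
    (hden : Complex.I * jacobiTheta τ ^ 2
      - (Real.sqrt 3 : ℂ) * jacobiTheta (3 * τ) ^ 2 ≠ 0) :
    deriv (deriv (deriv hauptT)) τ * deriv hauptT τ
      - (3 / 2) * (deriv (deriv hauptT) τ) ^ 2 =
      -18 * hauptT τ ^ 4 / (hauptT τ ^ 6 - 1) ^ 2 * (deriv hauptT τ) ^ 4 := by
  exact haupt_main τ hτ hden hauptT rfl
end
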